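/- arXiv:2511.14443 — 3 statements merged into one kernel-verified Lean document; each statement's English description precedes it below -/
import Mathlib

section
/- Let θ_ℓ (m+1 ≤ ℓ ≤ n) be an interior knot of Θ with θ_ℓ > θ_{ℓ−1} and multiplicity μ in Θ, and let 0 ≤ ν ≤ μ−1. Then the row vector c_{ℓ,ν}^T Γ D_m^T D_{m+1}^T ⋯ D_{2m−1}^T ∈ ℝ^{n−m} equals (m−1−ν)!·(N_{2m,k}^{(ν)}(θ_ℓ); 1 ≤ k ≤ n−m), where N_{2m,k}^{(ν)} denotes the ν-th derivative of the order-2m B-spline N_{2m,k} on the same knot vector Θ (this derivative exists at θ_ℓ since ν ≤ μ−1 ≤ m−2). -/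
open scoped BigOperators
open MeasureTheory Matrix

noncomputable def omegaB (θ : ℕ → ℝ) (j k : ℕ) (x : ℝ) : ℝ :=
  if θ k < θ (k + j) then (x - θ k) / (θ (k + j) - θ k) else 0

noncomputable def Nspl (θ : ℕ → ℝ) : ℕ → ℕ → ℝ → ℝ
  | 0, _, _ => 0
  | 1, k, x => if θ k ≤ x ∧ x < θ (k + 1) then 1 else 0
  | j + 2, k, x =>
      omegaB θ (j + 1) k x * Nspl θ (j + 1) k x
        + (1 - omegaB θ (j + 1) (k + 1) x) * Nspl θ (j + 1) (k + 1) x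

noncomputable def Gram (θ : ℕ → ℝ) (a b : ℝ) (m n : ℕ) : Matrix (Fin n) (Fin n) ℝ :=
  Matrix.of fun j k => ∫ x in a..b, Nspl θ m (j.1 + 1) x * Nspl θ m (k.1 + 1) x

noncomputable def Dmat (θ : ℕ → ℝ) (ord p q : ℕ) : Matrix (Fin p) (Fin q) ℝ :=
  Matrix.of fun k j =>
    if j.1 = k.1 then (ord : ℝ) / (θ (k.1 + 1 + ord) - θ (k.1 + 1))
    else if j.1 = k.1 + 1 then -((ord : ℝ) / (θ (k.1 + 2 + ord) - θ (k.1 + 2)))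
    else 0

noncomputable def Dprod (θ : ℕ → ℝ) (m n : ℕ) : (ν : ℕ) → Matrix (Fin (n - ν - 1)) (Fin n) ℝ
  | 0 => Dmat θ m (n - 1) n
  | ν + 1 => Dmat θ (m + ν + 1) (n - (ν + 1) - 1) (n - ν - 1) * Dprod θ m n ν

noncomputable def DprodFull (θ : ℕ → ℝ) (m n : ℕ) (hm : 1 ≤ m) :
    Matrix (Fin (n - m)) (Fin n) ℝ :=
  Matrix.reindex (finCongr (by omega : n - (m - 1) - 1 = n - m)) (Equiv.refl _)
    (Dprod θ m n (m - 1))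

noncomputable def knotMult (θ : ℕ → ℝ) (N ℓ : ℕ) : ℕ :=
  ((Finset.Icc 1 N).filter fun i => θ i = θ ℓ).card

structure IsOpenKnot (θ : ℕ → ℝ) (a b : ℝ) (m n : ℕ) : Prop where
  mono : ∀ i, 1 ≤ i → i < n + m → θ i ≤ θ (i + 1)
  left : ∀ i, 1 ≤ i → i ≤ m → θ i = a
  right : ∀ i, n + 1 ≤ i → i ≤ n + m → θ i = b
  intMult : ∀ k, m + 1 ≤ k → k ≤ n → knotMult θ (n + m) k ≤ m - 1

noncomputable def esymmF (r : ℕ) (s : Finset ℕ) (y : ℕ → ℝ) : ℝ :=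
  ∑ t ∈ s.powersetCard r, ∏ i ∈ t, y i

noncomputable def cVec (θ : ℕ → ℝ) (m n ℓ ν : ℕ) : Fin n → ℝ :=
  fun k =>
    if k.1 + 1 ≤ ℓ - m + ν then
      esymmF (m - 1 - ν) (Finset.Icc (k.1 + 2) (k.1 + m)) (fun i => θ ℓ - θ i)
        / ((m - 1).choose ν : ℝ)
    else 0

noncomputable def Fpoly (ν : ℕ) (s : Finset ℕ) (y : ℕ → ℝ) : ℝ :=
  (2 ^ ν * (ν.factorial : ℝ))⁻¹ *
    ∑ f ∈ (Fintype.piFinset fun _ : Fin (2 * ν) => s).filter (fun f => Function.Injective f),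
      ∏ i : Fin ν,
        (y (f ⟨i.1, by have := i.2; omega⟩) - y (f ⟨ν + i.1, by have := i.2; omega⟩)) ^ 2

noncomputable def uCoef (θ : ℕ → ℝ) (m ν k : ℕ) : ℝ :=
  ((m + ν : ℕ) : ℝ) / (θ (k + m + ν) - θ k) * Fpoly ν (Finset.Icc (k + 1) (k + m + ν - 1)) θ

noncomputable def Smat (θ : ℕ → ℝ) (m n : ℕ) : ℕ → Matrix (Fin n) (Fin n) ℝ
  | 0 => Matrix.diagonal fun k : Fin n => uCoef θ m 0 (k.1 + 1)
  | ν + 1 => Smat θ m n ν +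
      (Dprod θ m n ν)ᵀ *
        Matrix.diagonal (fun k : Fin (n - ν - 1) => uCoef θ m (ν + 1) (k.1 + 1)) *
        Dprod θ m n ν
noncomputable def alpha2 (θ : ℕ → ℝ) (n j : ℕ) : ℝ :=
  if 1 ≤ j ∧ j ≤ n - 1 then (θ (j + 2) - θ (j + 1)) ^ 2 / (θ (j + 3) - θ j) else 0

noncomputable def beta2 (θ : ℕ → ℝ) (j : ℕ) : ℝ :=
  -(2 * (θ (j + 2) - θ (j + 1)) ^ 2) /
    ((θ (j + 2) - θ j) * (θ (j + 3) - θ j) * (θ (j + 3) - θ (j + 1)))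

/-- The approximate-dual matrix `S` for `m = 2` (symmetric tridiagonal). -/
noncomputable def S2 (θ : ℕ → ℝ) (n : ℕ) : Matrix (Fin n) (Fin n) ℝ :=
  Matrix.of fun i k =>
    if k.1 = i.1 then
      2 / (θ (i.1 + 3) - θ (i.1 + 1))
        + 2 * (alpha2 θ n i.1 + alpha2 θ n (i.1 + 1)) / (θ (i.1 + 3) - θ (i.1 + 1)) ^ 2
    else if k.1 = i.1 + 1 then beta2 θ (i.1 + 1)
    else if i.1 = k.1 + 1 then beta2 θ (k.1 + 1)
    else 0

/-- The explicit matrix `Z` for `m = 2` (lower triangular, three nonzero diagonals). -/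
noncomputable def Zmat2 (θ : ℕ → ℝ) (n : ℕ) : Matrix (Fin n) (Fin (n - 2)) ℝ :=
  Matrix.of fun i j =>
    if i.1 = j.1 then
      (θ (j.1 + 3) - θ (j.1 + 2)) * (θ (j.1 + 4) - θ (j.1 + 3)) ^ 2
        / (18 * (θ (j.1 + 4) - θ (j.1 + 2)))
    else if i.1 = j.1 + 1 then
      -((θ (j.1 + 3) - θ (j.1 + 2)) * (θ (j.1 + 4) - θ (j.1 + 3)) / 18)
    else if i.1 = j.1 + 2 then
      (θ (j.1 + 3) - θ (j.1 + 2)) ^ 2 * (θ (j.1 + 4) - θ (j.1 + 3))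
        / (18 * (θ (j.1 + 4) - θ (j.1 + 2)))
    else 0

/-- The approximate-dual matrix `S = U₀ + D₃ᵀ U₁ D₃ + D₃ᵀ D₄ᵀ U₂ D₄ D₃` for `m = 3`. -/
noncomputable def S3 (θ : ℕ → ℝ) (n : ℕ) : Matrix (Fin n) (Fin n) ℝ :=
  Matrix.diagonal (fun k : Fin n => uCoef θ 3 0 (k.1 + 1))
    + (Dmat θ 3 (n - 1) n)ᵀ *
        Matrix.diagonal (fun k : Fin (n - 1) => uCoef θ 3 1 (k.1 + 1)) * Dmat θ 3 (n - 1) n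
    + (Dmat θ 4 (n - 2) (n - 1) * Dmat θ 3 (n - 1) n)ᵀ *
        Matrix.diagonal (fun k : Fin (n - 2) => uCoef θ 3 2 (k.1 + 1)) *
        (Dmat θ 4 (n - 2) (n - 1) * Dmat θ 3 (n - 1) n)


open Filter Topology

namespace BS

lemma Nspl_succ (θ : ℕ → ℝ) {j : ℕ} (hj : 1 ≤ j) (k : ℕ) (x : ℝ) :
    Nspl θ (j + 1) k x = omegaB θ j k x * Nspl θ j k x
      + (1 - omegaB θ j (k + 1) x) * Nspl θ j (k + 1) x := by
  obtain ⟨i, rfl⟩ := Nat.exists_eq_add_of_le' hj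
  rfl

lemma Nspl_supp {θ : ℕ → ℝ} (hθ : Monotone θ) (j : ℕ) (k : ℕ) (x : ℝ)
    (h : ¬ (θ k ≤ x ∧ x < θ (k + j))) : Nspl θ j k x = 0 := by
  induction j generalizing k with
  | zero => rfl
  | succ j ih =>
    rcases Nat.eq_zero_or_pos j with rfl | hj
    · simp only [zero_add] at h ⊢
      simp only [Nspl, if_neg h]
    · rw [Nspl_succ θ hj, ih k, ih (k + 1)]
      · simp
      · rintro ⟨h1, h2⟩
        exact h ⟨(hθ (by omega)).trans h1, h2.trans_le (hθ (by omega))⟩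
      · rintro ⟨h1, h2⟩
        exact h ⟨h1, h2.trans_le (hθ (by omega))⟩

noncomputable def G (θ : ℕ → ℝ) (j k : ℕ) (x : ℝ) : ℝ := Nspl θ j k x / (θ (k + j) - θ k)

lemma G_mul {θ : ℕ → ℝ} (hθ : Monotone θ) (j k : ℕ) (x : ℝ) :
    G θ j k x * (θ (k + j) - θ k) = Nspl θ j k x := by
  unfold G
  by_cases h : θ (k + j) - θ k = 0
  · rw [Nspl_supp hθ]
    · simp
    · rintro ⟨h1, h2⟩
      linarith
  · field_simp

lemma Nspl_G {θ : ℕ → ℝ} (hθ : Monotone θ) {j : ℕ} (hj : 1 ≤ j) (k : ℕ) (x : ℝ) :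
    Nspl θ (j + 1) k x = (x - θ k) * G θ j k x
      + (θ (k + 1 + j) - x) * G θ j (k + 1) x := by
  have key : ∀ k, omegaB θ j k x * Nspl θ j k x = (x - θ k) * G θ j k x := by
    intro k
    unfold omegaB G
    split_ifs with h
    · ring
    · have : θ (k + j) - θ k = 0 := by
        have := hθ (show k ≤ k + j by omega)
        linarith
      simp [this]
  have h1 := key (k + 1)
  have h2 := G_mul hθ j (k + 1) x
  rw [Nspl_succ θ hj, key]
  linear_combination -h1 - h2

lemma eventually_right (c x : ℝ) : ∀ᶠ y in 𝓝[≥] x, (c ≤ y ↔ c ≤ x) ∧ (y < c ↔ x < c) := by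
  rcases lt_or_ge x c with h | h
  · have : ∀ᶠ y in 𝓝[≥] x, y < c := nhdsWithin_le_nhds (gt_mem_nhds h)
    filter_upwards [this] with y hy
    exact ⟨by constructor <;> intro h' <;> linarith, by simp [hy, h]⟩
  · filter_upwards [self_mem_nhdsWithin] with y hy
    have hy : x ≤ y := hy
    exact ⟨by constructor <;> intro h' <;> linarith, by constructor <;> intro h' <;> linarith⟩

lemma eventually_left (c x : ℝ) : ∀ᶠ y in 𝓝[<] x, (c ≤ y ↔ c < x) ∧ (y < c ↔ x ≤ c) := by
  rcases lt_or_ge c x with h | h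
  · have : ∀ᶠ y in 𝓝[<] x, c < y := nhdsWithin_le_nhds (lt_mem_nhds h)
    filter_upwards [this] with y hy
    exact ⟨by constructor <;> intro h' <;> linarith, by constructor <;> intro h' <;> linarith⟩
  · filter_upwards [self_mem_nhdsWithin] with y hy
    have hy : y < x := hy
    exact ⟨by constructor <;> intro h' <;> linarith, by constructor <;> intro h' <;> linarith⟩

lemma aux1 {θ : ℕ → ℝ} (hθ : Monotone θ) {j : ℕ} (hj : 1 ≤ j) (k : ℕ) (x : ℝ) :
    (x - θ k) * ((G θ j k x - G θ j (k + 1) x) / (θ (k + (j + 1)) - θ k))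
      = G θ (j + 1) k x - G θ j (k + 1) x := by
  have h1 := hθ (show k ≤ k + 1 by omega)
  have h2 := hθ (show k + 1 ≤ k + 1 + j by omega)
  have e : k + (j + 1) = k + 1 + j := by omega
  rw [G, G, G, Nspl_G hθ hj, e]
  by_cases h : θ (k + 1 + j) - θ k = 0
  · have : θ (k + 1 + j) - θ (k + 1) = 0 := by linarith
    simp [this, h]
  · rw [← G, ← G]
    field_simp
    ring

lemma aux2 {θ : ℕ → ℝ} (hθ : Monotone θ) {j : ℕ} (hj : 1 ≤ j) (k : ℕ) (x : ℝ) :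
    (θ (k + (j + 1)) - x) * ((G θ j k x - G θ j (k + 1) x) / (θ (k + (j + 1)) - θ k))
      = G θ j k x - G θ (j + 1) k x := by
  have h1 := hθ (show k + j ≤ k + 1 + j by omega)
  have h2 := hθ (show k ≤ k + j by omega)
  have e : k + (j + 1) = k + 1 + j := by omega
  rw [G, G, G, Nspl_G hθ hj, e]
  by_cases h : θ (k + 1 + j) - θ k = 0
  · have : θ (k + j) - θ k = 0 := by linarith
    simp [this, h]
  · rw [← G, ← G]
    field_simp
    ring

lemma hasDeriv_right {θ : ℕ → ℝ} (hθ : Monotone θ) (j k : ℕ) (x : ℝ) :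
    HasDerivWithinAt (Nspl θ (j + 1) k) (j * (G θ j k x - G θ j (k + 1) x)) (Set.Ici x) x := by
  induction j generalizing k with
  | zero =>
    have : (Nspl θ (0 + 1) k) =ᶠ[𝓝[≥] x] fun _ => Nspl θ (0 + 1) k x := by
      filter_upwards [eventually_right (θ k) x, eventually_right (θ (k + 1)) x] with y h1 h2
      simp [Nspl, h1.1, h2.2]
    simpa using (hasDerivWithinAt_const x (Set.Ici x) (Nspl θ (0 + 1) k x)).congr_of_eventuallyEq
      this rfl
  | succ j ih =>
    have hG : ∀ k, HasDerivWithinAt (G θ (j + 1) k)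
        (j * (G θ j k x - G θ j (k + 1) x) / (θ (k + (j + 1)) - θ k)) (Set.Ici x) x :=
      fun k => (ih k).div_const _
    have e : Nspl θ (j + 1 + 1) k = fun y => (y - θ k) * G θ (j + 1) k y
      + (θ (k + 1 + (j + 1)) - y) * G θ (j + 1) (k + 1) y := by
      funext y
      exact Nspl_G hθ (by omega) k y
    rw [e]
    have d := (((hasDerivWithinAt_id x (Set.Ici x)).sub_const (θ k)).mul (hG k)).add
      (((hasDerivWithinAt_id x (Set.Ici x)).const_sub (θ (k + 1 + (j + 1)))).mul (hG (k + 1)))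
    refine d.congr_deriv ?_
    simp only [id]
    rcases Nat.eq_zero_or_pos j with rfl | hj
    · simp; ring
    · have a1 := aux1 hθ hj k x
      have a2 := aux2 hθ hj (k + 1) x
      push_cast
      linear_combination (j : ℝ) * a1 + (j : ℝ) * a2

noncomputable def M (θ : ℕ → ℝ) : ℕ → ℕ → ℝ → ℝ
  | 0, _, _ => 0
  | 1, k, x => if θ k < x ∧ x ≤ θ (k + 1) then 1 else 0
  | j + 2, k, x =>
      omegaB θ (j + 1) k x * M θ (j + 1) k x
        + (1 - omegaB θ (j + 1) (k + 1) x) * M θ (j + 1) (k + 1) x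

lemma omegaB_cont (θ : ℕ → ℝ) (j k : ℕ) : Continuous (omegaB θ j k) := by
  unfold omegaB
  split_ifs
  · fun_prop
  · fun_prop

lemma left_lim (θ : ℕ → ℝ) (j k : ℕ) (x : ℝ) :
    Tendsto (Nspl θ (j + 1) k) (𝓝[<] x) (𝓝 (M θ (j + 1) k x)) := by
  induction j generalizing k with
  | zero =>
    refine tendsto_const_nhds.congr' ?_
    filter_upwards [eventually_left (θ k) x, eventually_left (θ (k + 1)) x] with y h1 h2
    simp [Nspl, M, h1.1, h2.2]
  | succ j ih =>
    have c : ∀ k, Tendsto (omegaB θ (j + 1) k) (𝓝[<] x) (𝓝 (omegaB θ (j + 1) k x)) :=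
      fun k => ((omegaB_cont θ (j + 1) k).tendsto x).mono_left nhdsWithin_le_nhds
    exact ((c k).mul (ih k)).add ((tendsto_const_nhds.sub (c (k + 1))).mul (ih (k + 1)))

open Classical in
lemma delta {θ : ℕ → ℝ} (hθ : Monotone θ) (j k : ℕ) (x : ℝ) :
    Nspl θ (j + 1) k x - M θ (j + 1) k x =
      (if θ k = x ∧ θ (k + j) = x ∧ x < θ (k + j + 1) then 1 else 0)
      - (if θ k < x ∧ θ (k + 1) = x ∧ θ (k + j + 1) = x then 1 else 0) := by
  induction j generalizing k with
  | zero =>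
    have := hθ (show k ≤ k + 1 by omega)
    simp only [Nspl, M, add_zero]
    split_ifs <;> grind
  | succ j ih =>
    have e : Nspl θ (j + 1 + 1) k x - M θ (j + 1 + 1) k x =
      omegaB θ (j + 1) k x * (Nspl θ (j + 1) k x - M θ (j + 1) k x)
      + (1 - omegaB θ (j + 1) (k + 1) x) *
        (Nspl θ (j + 1) (k + 1) x - M θ (j + 1) (k + 1) x) := by
      simp only [Nspl, M]; ring
    rw [e, ih, ih]
    have m1 := hθ (show k ≤ k + 1 by omega)
    have m2 := hθ (show k + 1 ≤ k + 1 + j by omega)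
    have m3 := hθ (show k + 1 + j ≤ k + 1 + j + 1 by omega)
    have m4 := hθ (show k + j ≤ k + 1 + j by omega)
    have m5 := hθ (show k ≤ k + j by omega)
    have m6 := hθ (show k + 1 ≤ k + 1 + 1 by omega)
    have m7 := hθ (show k + 1 + 1 ≤ k + 1 + j + 1 by omega)
    have e1 : k + (j + 1) = k + 1 + j := by omega
    have e2 : k + 1 + (j + 1) = k + 1 + j + 1 := by omega
    have e3 : k + j + 1 = k + 1 + j := by omega
    have p1 : omegaB θ (j + 1) k x * ((if θ k = x ∧ θ (k + j) = x ∧ x < θ (k + j + 1) then 1 else 0)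
      - (if θ k < x ∧ θ (k + 1) = x ∧ θ (k + j + 1) = x then 1 else 0)) =
      - (if θ k < x ∧ θ (k + 1) = x ∧ θ (k + 1 + j) = x then 1 else 0) := by
      rw [e3]
      unfold omegaB
      rw [e1]
      by_cases hk : θ k = x
      · simp [hk]
      · by_cases h2 : θ k < x ∧ θ (k + 1) = x ∧ θ (k + 1 + j) = x
        · obtain ⟨h3, h4, h5⟩ := h2
          have : x - θ k ≠ 0 := by linarith
          simp [hk, h3, h4, h5, this]
        · simp [hk, h2]
    have p2 : (1 - omegaB θ (j + 1) (k + 1) x) *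
      ((if θ (k + 1) = x ∧ θ (k + 1 + j) = x ∧ x < θ (k + 1 + j + 1) then 1 else 0)
      - (if θ (k + 1) < x ∧ θ (k + 1 + 1) = x ∧ θ (k + 1 + j + 1) = x then 1 else 0)) =
      (if θ (k + 1) = x ∧ θ (k + 1 + j) = x ∧ x < θ (k + 1 + j + 1) then 1 else 0) := by
      unfold omegaB
      rw [e2]
      by_cases hk : θ (k + 1) = x
      · simp [hk]
      · by_cases h2 : θ (k + 1) < x ∧ θ (k + 1 + 1) = x ∧ θ (k + 1 + j + 1) = x
        · obtain ⟨h3, h4, h5⟩ := h2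
          have : x - θ (k + 1) ≠ 0 := by linarith
          simp [hk, h3, h4, h5, this]
        · simp [hk, h2]
    rw [p1, p2, e1]
    split_ifs <;> grind

lemma Nspl_cont {θ : ℕ → ℝ} (hθ : Monotone θ) (j k : ℕ) (h1 : θ k < θ (k + j))
    (h2 : θ (k + 1) < θ (k + j + 1)) : Continuous (Nspl θ (j + 1) k) := by
  rw [continuous_iff_continuousAt]
  intro x
  rw [continuousAt_iff_continuous_left'_right']
  refine ⟨?_, ((hasDeriv_right hθ j k x).continuousWithinAt).mono Set.Ioi_subset_Ici_self⟩
  have := delta hθ j k x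
  rw [if_neg (by grind), if_neg (by grind)] at this
  have h3 := left_lim θ j k x
  rw [show M θ (j + 1) k x = Nspl θ (j + 1) k x by linarith] at h3
  exact h3

lemma Nspl_int (θ : ℕ → ℝ) (j k : ℕ) (a b : ℝ) (g : ℝ → ℝ)
    (hg : IntervalIntegrable g volume a b) :
    IntervalIntegrable (fun x => Nspl θ (j + 1) k x * g x) volume a b := by
  induction j generalizing k with
  | zero =>
    have : (fun x => Nspl θ (0 + 1) k x * g x) = (Set.Ico (θ k) (θ (k + 1))).indicator g := by
      funext x
      simp [Nspl, Set.indicator_apply]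
    rw [this]
    rw [intervalIntegrable_iff] at hg ⊢
    exact hg.indicator measurableSet_Ico
  | succ j ih =>
    have h := ((ih k).continuousOn_mul (omegaB_cont θ (j + 1) k).continuousOn).add
      ((ih (k + 1)).continuousOn_mul
        ((continuous_const (y := (1 : ℝ))).sub (omegaB_cont θ (j + 1) (k + 1))).continuousOn)
    convert h using 1
    funext x
    simp only [Nspl, Pi.sub_apply]
    ring

noncomputable def H (θ : ℕ → ℝ) (p : ℕ) : ℕ → ℕ → ℝ → ℝ
  | 0, k, x => Nspl θ p k x
  | r + 1, k, x => ((p + r : ℕ) : ℝ) / (θ (k + (p + r)) - θ k) * H θ p r k x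
      - ((p + r : ℕ) : ℝ) / (θ (k + 1 + (p + r)) - θ (k + 1)) * H θ p r (k + 1) x

lemma H_deriv {θ : ℕ → ℝ} (hθ : Monotone θ) (p r k : ℕ) (x : ℝ) :
    HasDerivWithinAt (H θ (p + 1) r k) (H θ p (r + 1) k x) (Set.Ici x) x := by
  induction r generalizing k with
  | zero =>
    refine (hasDeriv_right hθ p k x).congr_deriv ?_
    simp only [H, G, add_zero]; ring
  | succ r ih =>
    have := ((ih k).const_mul (((p + 1 + r : ℕ) : ℝ) / (θ (k + (p + 1 + r)) - θ k))).sub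
      ((ih (k + 1)).const_mul
        (((p + 1 + r : ℕ) : ℝ) / (θ (k + 1 + (p + 1 + r)) - θ (k + 1))))
    refine this.congr_deriv ?_
    rw [show p + 1 + r = p + (r + 1) by omega]
    conv_rhs => rw [H]

lemma H_cont {θ : ℕ → ℝ} (p r k : ℕ)
    (h : ∀ i, k ≤ i → i ≤ k + r → Continuous (Nspl θ p i)) : Continuous (H θ p r k) := by
  induction r generalizing k with
  | zero => exact h k le_rfl (by omega)
  | succ r ih =>
    exact (continuous_const.mul (ih k fun i h1 h2 => h i h1 (by omega))).sub
      (continuous_const.mul (ih (k + 1) fun i h1 h2 => h i (by omega) (by omega)))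

lemma H_zero {θ : ℕ → ℝ} (p r k : ℕ) (x : ℝ)
    (h : ∀ i, k ≤ i → i ≤ k + r → Nspl θ p i x = 0) : H θ p r k x = 0 := by
  induction r generalizing k with
  | zero => exact h k le_rfl (by omega)
  | succ r ih =>
    rw [H, ih k fun i h1 h2 => h i h1 (by omega),
      ih (k + 1) fun i h1 h2 => h i (by omega) (by omega)]
    simp

lemma H_int (θ : ℕ → ℝ) (p r k : ℕ) (a b : ℝ) :
    IntervalIntegrable (H θ (p + 1) r k) volume a b := by
  induction r generalizing k with
  | zero =>
    simpa [H] using Nspl_int θ p k a b (fun _ => 1) (by simp)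
  | succ r ih =>
    exact ((ih k).const_mul _).sub ((ih (k + 1)).const_mul _)

lemma hasDerivAt_of_right {f f' : ℝ → ℝ} (hf : Continuous f) (hf' : Continuous f')
    (h : ∀ x, HasDerivWithinAt f (f' x) (Set.Ici x) x) (x : ℝ) : HasDerivAt f (f' x) x := by
  have e : f = fun y => f 0 + ∫ t in (0:ℝ)..y, f' t := by
    funext y
    rw [intervalIntegral.integral_eq_sub_of_hasDeriv_right hf.continuousOn
      (fun x _ => (h x).mono Set.Ioi_subset_Ici_self) (hf'.intervalIntegrable _ _)]
    ring
  rw [e]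
  exact (intervalIntegral.integral_hasDerivAt_right (hf'.intervalIntegrable _ _)
    hf'.stronglyMeasurable.stronglyMeasurableAtFilter hf'.continuousAt).const_add _

/-- repeated integration by parts -/
lemma int_parts (f : ℕ → ℝ → ℝ) (a w : ℝ) (m : ℕ)
    (hc : ∀ i, i < m → Continuous (f i)) (h0 : ∀ i, i < m → f i a = 0)
    (hi : ∀ i, i ≤ m → IntervalIntegrable (f i) volume a w)
    (hd : ∀ i, i < m → ∀ x, HasDerivWithinAt (f i) (f (i + 1) x) (Set.Ici x) x)
    (q i : ℕ) (hq : i + q < m) :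
    ∫ x in a..w, (w - x) ^ q * f (i + q + 1) x = q.factorial * f i w := by
  induction q with
  | zero =>
    simp only [pow_zero, one_mul, add_zero, Nat.factorial_zero, Nat.cast_one]
    rw [intervalIntegral.integral_eq_sub_of_hasDeriv_right (hc i (by omega)).continuousOn
      (fun x _ => (hd i (by omega) x).mono Set.Ioi_subset_Ici_self) (hi _ (by omega)),
      h0 i (by omega), sub_zero]
  | succ q ih =>
    have ih := ih (by omega)
    have hcp : ∀ r : ℕ, Continuous fun x : ℝ => (w - x) ^ r := fun r => by fun_prop
    have i1 : IntervalIntegrable (fun x => (w - x) ^ (q + 1) * f (i + (q + 1) + 1) x) volume a w :=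
      (hi _ (by omega)).continuousOn_mul (hcp _).continuousOn
    have i2 : IntervalIntegrable (fun x => (w - x) ^ q * f (i + q + 1) x) volume a w :=
      (hi _ (by omega)).continuousOn_mul (hcp _).continuousOn
    have F := intervalIntegral.integral_eq_sub_of_hasDeriv_right (a := a) (b := w)
      (f := fun x => (w - x) ^ (q + 1) * f (i + (q + 1)) x)
      (f' := fun x => (w - x) ^ (q + 1) * f (i + (q + 1) + 1) x
        - (q + 1 : ℝ) * ((w - x) ^ q * f (i + q + 1) x))
      ((hcp _).mul (hc _ (by omega))).continuousOn
      (fun x _ => by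
        have d1 : HasDerivWithinAt (fun x : ℝ => (w - x) ^ (q + 1))
            (((q + 1 : ℕ) : ℝ) * (w - x) ^ q * (-1)) (Set.Ioi x) x := by
          have := (((hasDerivAt_id x).const_sub w).pow (q + 1)).hasDerivWithinAt (s := Set.Ioi x)
          exact this.congr_deriv (by simp)
        refine (d1.mul ((hd (i + (q + 1)) (by omega) x).mono
          Set.Ioi_subset_Ici_self)).congr_deriv ?_
        push_cast
        rw [show i + q + 1 = i + (q + 1) by omega]
        ring)
      (i1.sub (i2.const_mul _))
    rw [intervalIntegral.integral_sub i1 (i2.const_mul _), intervalIntegral.integral_const_mul,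
      ih] at F
    simp only [sub_self, h0 _ (show i + (q + 1) < m by omega)] at F
    rw [Nat.factorial_succ]
    push_cast
    have : (0 : ℝ) ^ (q + 1) = 0 := by simp
    rw [this] at F
    linarith

end BS

namespace BS

open Polynomial in
noncomputable def P (θ : ℕ → ℝ) (w : ℝ) (j k : ℕ) : ℝ[X] :=
  ∏ i ∈ Finset.Icc (k + 1) (k + j), (X + C (w - θ i))

open Polynomial in
lemma P_top (θ : ℕ → ℝ) (w : ℝ) (j k : ℕ) :
    P θ w (j + 1) k = P θ w j k * (X + C (w - θ (k + (j + 1)))) := by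
  unfold P
  rw [← add_assoc, Finset.prod_Icc_succ_top (by omega)]

open Polynomial in
lemma P_bot (θ : ℕ → ℝ) (w : ℝ) (j k : ℕ) :
    P θ w (j + 1) k = P θ w j (k + 1) * (X + C (w - θ (k + 1))) := by
  unfold P
  rw [show k + (j + 1) = k + 1 + j by omega,
    ← Finset.insert_Icc_add_one_left_eq_Icc (show k + 1 ≤ k + 1 + j by omega),
    Finset.prod_insert (by simp), mul_comm]

open Polynomial in
lemma marsden {θ : ℕ → ℝ} (hθ : Monotone θ) (w x : ℝ) (j r s : ℕ)
    (h1 : θ (r + j) ≤ x) (h2 : x < θ s) :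
    ∑ k ∈ Finset.Ico r s, C (Nspl θ (j + 1) k x) * P θ w j k = (X + C (w - x)) ^ j := by
  induction j generalizing r with
  | zero =>
    have hrs : r < s := by
      by_contra h
      have := hθ (not_lt.1 h)
      simp at h1
      linarith
    simp only [P, pow_zero, Nspl]
    have : ∀ s, r ≤ s → ∑ k ∈ Finset.Ico r s, (if θ k ≤ x ∧ x < θ (k + 1) then (1:ℝ) else 0)
        = if x < θ s then 1 else 0 := by
      intro s hs
      induction s, hs using Nat.le_induction with
      | base => 
        simp at h1 ⊢
        exact h1
      | succ s hs ih =>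
        rw [Finset.sum_Ico_succ_top hs, ih]
        have := hθ (show s ≤ s + 1 by omega)
        split_ifs <;> grind
    have h3 := this s hrs.le
    rw [if_pos h2] at h3
    simp only [add_zero]
    have e : ∀ k, Finset.Icc (k + 1) k = ∅ := fun k => by simp
    simp only [e, Finset.prod_empty, mul_one]
    rw [← map_sum]
    simp only [h3, map_one]
  | succ j ih =>
    have hrs : r < s := by
      by_contra h
      have := hθ (show s ≤ r + (j + 1) by omega)
      linarith
    set A : ℕ → ℝ[X] := fun k => C ((x - θ k) * G θ (j + 1) k x) *
      (P θ w j k * (X + C (w - θ (k + (j + 1))))) with hA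
    set B : ℕ → ℝ[X] := fun k => C ((θ (k + (j + 1)) - x) * G θ (j + 1) k x) *
      (P θ w j k * (X + C (w - θ k))) with hB
    have e1 : ∀ k, C (Nspl θ (j + 1 + 1) k x) * P θ w (j + 1) k = A k + B (k + 1) := by
      intro k
      rw [Nspl_G hθ (by omega), map_add, add_mul]
      congr 1
      · rw [P_top]
      · rw [P_bot]
    have eG : ∀ k, Nspl θ (j + 1) k x = 0 → G θ (j + 1) k x = 0 := fun k h => by simp [G, h]
    have A0 : A r = 0 := by
      simp only [hA]
      rw [eG r (Nspl_supp hθ _ _ _ (by intro h; linarith))]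
      simp
    have B0 : B s = 0 := by
      simp only [hB]
      rw [eG s (Nspl_supp hθ _ _ _ (by intro h; linarith))]
      simp
    have e2 : ∀ k, A k + B k = (X + C (w - x)) * (C (Nspl θ (j + 1) k x) * P θ w j k) := by
      intro k
      rw [← G_mul hθ (j + 1) k x]
      simp only [hA, hB, map_mul, map_sub]
      ring
    rw [Finset.sum_congr rfl fun k _ => e1 k, Finset.sum_add_distrib,
      Finset.sum_eq_sum_Ico_succ_bot hrs, A0, zero_add, Finset.sum_Ico_add' B r s 1,
      Finset.sum_Ico_succ_top (by omega), B0, add_zero, ← Finset.sum_add_distrib,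
      Finset.sum_congr rfl fun k _ => e2 k, ← Finset.mul_sum, ih (r + 1)
        (by rwa [show r + 1 + j = r + (j + 1) by omega]), pow_succ, mul_comm]

lemma P_coeff (θ : ℕ → ℝ) (w : ℝ) (j k ν : ℕ) (h : ν ≤ j) :
    (P θ w j k).coeff ν = esymmF (j - ν) (Finset.Icc (k + 1) (k + j)) (fun i => w - θ i) := by
  unfold P esymmF
  rw [Finset.prod_X_add_C_coeff _ _ (by simp; omega)]
  simp

lemma esymm_zero (θ : ℕ → ℝ) (w : ℝ) (j k ν ℓ : ℕ) (hν : ν ≤ j)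
    (hw : ∀ i, ℓ ≤ i → i ≤ ℓ + ν → θ i = w) (h1 : k + 1 ≤ ℓ) (h2 : ℓ + ν ≤ k + j) :
    esymmF (j - ν) (Finset.Icc (k + 1) (k + j)) (fun i => w - θ i) = 0 := by
  unfold esymmF
  refine Finset.sum_eq_zero fun t ht => ?_
  rw [Finset.mem_powersetCard] at ht
  have : ∃ i ∈ t, i ∈ Finset.Icc ℓ (ℓ + ν) := by
    by_contra hcon
    push Not at hcon
    have hd : Disjoint t (Finset.Icc ℓ (ℓ + ν)) := Finset.disjoint_left.2 hcon
    have hs : t ∪ Finset.Icc ℓ (ℓ + ν) ⊆ Finset.Icc (k + 1) (k + j) :=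
      Finset.union_subset ht.1 (Finset.Icc_subset_Icc h1 h2)
    have := Finset.card_le_card hs
    rw [Finset.card_union_of_disjoint hd, ht.2] at this
    simp at this
    omega
  obtain ⟨i, hi, hi2⟩ := this
  rw [Finset.mem_Icc] at hi2
  exact Finset.prod_eq_zero hi (by rw [hw i hi2.1 hi2.2, sub_self])

lemma csum {θ : ℕ → ℝ} (hθ : Monotone θ) (m n ℓ ν : ℕ) (hm : 1 ≤ m) (hν : ν + 1 ≤ m)
    (hℓ1 : m + 1 ≤ ℓ) (hw : θ (ℓ + ν) = θ ℓ) (x : ℝ)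
    (h1 : θ m ≤ x) (h2 : x < θ (n + 1)) :
    ∑ k : Fin n, cVec θ m n ℓ ν k * Nspl θ m (k.1 + 1) x
      = if x < θ ℓ then (θ ℓ - x) ^ (m - 1 - ν) else 0 := by
  obtain ⟨j, rfl⟩ := Nat.exists_eq_add_of_le' hm
  have hw' : ∀ i, ℓ ≤ i → i ≤ ℓ + ν → θ i = θ ℓ := fun i h h' =>
    le_antisymm ((hθ h').trans hw.le) (hθ h)
  simp only [Nat.add_sub_cancel]
  split_ifs with hx
  · have hterm : ∀ k : Fin n, cVec θ (j + 1) n ℓ ν k * Nspl θ (j + 1) (k.1 + 1) x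
        = (P θ (θ ℓ) j (k.1 + 1)).coeff ν * Nspl θ (j + 1) (k.1 + 1) x / (j.choose ν : ℝ) := by
      intro k
      rw [P_coeff _ _ _ _ _ (by omega)]
      unfold cVec
      simp only [Nat.add_sub_cancel]
      rw [show k.1 + (j + 1) = k.1 + 1 + j by omega]
      split_ifs with hk
      · ring
      · rcases lt_or_ge (k.1 + 1) ℓ with hkl | hkl
        · rw [esymm_zero θ (θ ℓ) j (k.1 + 1) ν ℓ (by omega) hw' (by omega) (by omega)]
          simp
        · rw [Nspl_supp hθ (j + 1) (k.1 + 1) x]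
          · simp
          · rintro ⟨h3, -⟩
            have := hθ hkl
            linarith
    rw [Finset.sum_congr rfl fun k _ => hterm k, ← Finset.sum_div]
    have mm := congrArg (fun p => Polynomial.coeff p ν)
      (marsden hθ (θ ℓ) x j 1 (n + 1) (by rwa [add_comm 1 j]) h2)
    simp only [Polynomial.finsetSum_coeff, Polynomial.coeff_C_mul,
      Polynomial.coeff_X_add_C_pow] at mm
    rw [Finset.sum_Ico_eq_sum_range, Nat.add_sub_cancel, Finset.sum_range] at mm
    have : (j.choose ν : ℝ) ≠ 0 := by
      have := Nat.choose_pos (show ν ≤ j by omega)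
      positivity
    rw [div_eq_iff this, ← mm]
    refine Finset.sum_congr rfl fun k _ => ?_
    rw [add_comm 1 k.1, mul_comm]
  · refine Finset.sum_eq_zero fun k _ => ?_
    unfold cVec
    split_ifs with hk
    · rw [Nspl_supp hθ (j + 1) (k.1 + 1) x]
      · simp
      · rintro ⟨-, h4⟩
        have := hθ (show k.1 + 1 + (j + 1) ≤ ℓ + ν by omega)
        linarith
    · simp

lemma Dmat_mul (θ : ℕ → ℝ) (ord p q : ℕ) (k : Fin p) (hk : k.1 + 1 < q) (V : ℕ → ℝ) :
    ∑ j : Fin q, Dmat θ ord p q k j * V (j.1 + 1) =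
      (ord : ℝ) / (θ (k.1 + 1 + ord) - θ (k.1 + 1)) * V (k.1 + 1)
      - (ord : ℝ) / (θ (k.1 + 1 + 1 + ord) - θ (k.1 + 1 + 1)) * V (k.1 + 1 + 1) := by
  have e : ∀ j : Fin q, Dmat θ ord p q k j * V (j.1 + 1) =
      (if j = ⟨k.1, by omega⟩ then
        (ord : ℝ) / (θ (k.1 + 1 + ord) - θ (k.1 + 1)) * V (k.1 + 1) else 0)
      + (if j = ⟨k.1 + 1, hk⟩ then
        -((ord : ℝ) / (θ (k.1 + 1 + 1 + ord) - θ (k.1 + 1 + 1)) * V (k.1 + 1 + 1)) else 0) := by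
    intro j
    simp only [Dmat, Matrix.of_apply, Fin.ext_iff]
    by_cases h1 : j.1 = k.1
    · simp [h1]
    · by_cases h2 : j.1 = k.1 + 1
      · simp [h2]
      · simp [h1, h2]
  rw [Finset.sum_congr rfl fun j _ => e j, Finset.sum_add_distrib]
  simp
  ring

lemma Dprod_H (θ : ℕ → ℝ) (m n r : ℕ) (k : Fin (n - r - 1)) (x : ℝ) :
    ∑ j : Fin n, Dprod θ m n r k j * Nspl θ m (j.1 + 1) x = H θ m (r + 1) (k.1 + 1) x := by
  induction r with
  | zero =>
    have := k.2
    exact Dmat_mul θ m (n - 1) n k (by omega) (fun i => Nspl θ m i x)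
  | succ r ih =>
    have hk := k.2
    simp only [Dprod, Matrix.mul_apply, Finset.sum_mul]
    rw [Finset.sum_comm]
    simp only [mul_assoc, ← Finset.mul_sum, ih]
    exact Dmat_mul θ (m + r + 1) _ _ k (by omega) (fun i => H θ m (r + 1) i x)

theorem core (a b : ℝ) (m n : ℕ) (hm : 2 ≤ m) 
    (θ : ℕ → ℝ) (hθ : Monotone θ) (h1 : θ 1 = a) (hma : θ m = a) (hb : θ (n + 1) = b)
    (hst : ∀ k, 1 ≤ k → k ≤ n → θ k < θ (k + m))
    (ℓ : ℕ) (hℓ1 : m + 1 ≤ ℓ) (hℓ2 : ℓ ≤ n)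
    (ν : ℕ) (hν : ν + 2 ≤ m) (hw : θ (ℓ + ν) = θ ℓ) :
    Matrix.vecMul (cVec θ m n ℓ ν)
        (Gram θ a b m n * (DprodFull θ m n (by omega))ᵀ)
      = fun k : Fin (n - m) =>
        ((m - 1 - ν).factorial : ℝ) * iteratedDeriv ν (Nspl θ (2 * m) (k.1 + 1)) (θ ℓ) := by
  funext k
  have hk := k.2
  have hal : a ≤ θ ℓ := hma ▸ hθ (by omega)
  have hlb : θ ℓ ≤ b := hb ▸ hθ (by omega)
  -- the derivatives
  set f : ℕ → ℝ → ℝ := fun i => H θ (2 * m - i) i (k.1 + 1) with hf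
  have hNc : ∀ p i, m + 1 ≤ p → 1 ≤ i → i + p ≤ n + m → Continuous (Nspl θ p i) := by
    intro p i hp hi hip
    obtain ⟨q, rfl⟩ := Nat.exists_eq_add_of_le' (show 1 ≤ p by omega)
    refine Nspl_cont hθ q i ((hst i hi (by omega)).trans_le (hθ (by omega)))
      ((hst (i + 1) (by omega) (by omega)).trans_le (hθ (by omega)))
  have hNa : ∀ p i, m + 1 ≤ p → 1 ≤ i → i + p ≤ n + m → Nspl θ p i a = 0 := by
    intro p i hp hi hip
    have hc := (hNc p i hp hi hip).tendsto a
    have h0 : Tendsto (Nspl θ p i) (𝓝[<] a) (𝓝 0) := by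
      refine tendsto_const_nhds.congr' ?_
      filter_upwards [self_mem_nhdsWithin] with y hy
      have hy : y < a := hy
      rw [Nspl_supp hθ]
      rintro ⟨h3, -⟩
      have := hθ hi
      linarith
    exact tendsto_nhds_unique (hc.mono_left nhdsWithin_le_nhds) h0
  have fc : ∀ i, i < m → Continuous (f i) := fun i hi =>
    H_cont _ _ _ fun t ht1 ht2 => hNc _ _ (by omega) (by omega) (by omega)
  have fa : ∀ i, i < m → f i a = 0 := fun i hi =>
    H_zero _ _ _ _ fun t ht1 ht2 => hNa _ _ (by omega) (by omega) (by omega)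
  have fint : ∀ a b i, i ≤ m → IntervalIntegrable (f i) volume a b := by
    intro a b i hi
    have := H_int θ (2 * m - i - 1) i (k.1 + 1) a b
    rwa [show 2 * m - i - 1 + 1 = 2 * m - i by omega] at this
  have fd : ∀ i, i < m → ∀ x, HasDerivWithinAt (f i) (f (i + 1) x) (Set.Ici x) x := by
    intro i hi x
    have := H_deriv hθ (2 * m - (i + 1)) i (k.1 + 1) x
    rwa [show 2 * m - (i + 1) + 1 = 2 * m - i by omega] at this
  have hit : ∀ i, i < m → iteratedDeriv i (Nspl θ (2 * m) (k.1 + 1)) = f i := by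
    intro i
    induction i with
    | zero => intro _; rw [iteratedDeriv_zero]; rfl
    | succ i ih =>
      intro hi
      rw [iteratedDeriv_succ, ih (by omega)]
      funext x
      exact (hasDerivAt_of_right (fc i (by omega)) (fc (i + 1) hi) (fd i (by omega)) x).deriv
  rw [hit ν (by omega), ← int_parts f a (θ ℓ) m fc fa (fint _ _) fd (m - 1 - ν) ν (by omega),
    show ν + (m - 1 - ν) + 1 = m by omega]
  have hfm : ∀ x, f m x = ∑ j : Fin n, DprodFull θ m n (by omega) k j * Nspl θ m (j.1 + 1) x := by
    intro x
    have := Dprod_H θ m n (m - 1) ⟨k.1, by omega⟩ x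
    simp only [hf]
    rw [show 2 * m - m = m by omega]
    rw [show m - 1 + 1 = m by omega] at this
    rw [← this]
    rfl
  have hNint : ∀ i j, IntervalIntegrable (fun x => Nspl θ m i x * Nspl θ m j x) volume a b := by
    intro i j
    obtain ⟨q, rfl⟩ := Nat.exists_eq_add_of_le' (show 1 ≤ m by omega)
    refine Nspl_int θ q i a b _ ?_
    simpa using Nspl_int θ q j a b (fun _ => 1) (by simp)
  have step1 : Matrix.vecMul (cVec θ m n ℓ ν)
        (Gram θ a b m n * (DprodFull θ m n (by omega))ᵀ) k =
      ∫ x in a..b, (∑ i : Fin n, cVec θ m n ℓ ν i * Nspl θ m (i.1 + 1) x) * f m x := by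
    simp only [Matrix.vecMul, dotProduct, Matrix.mul_apply, Matrix.transpose_apply, Gram,
      Matrix.of_apply]
    simp only [hfm, Finset.sum_mul_sum]
    rw [intervalIntegral.integral_finsetSum]
    · refine Finset.sum_congr rfl fun i _ => ?_
      rw [intervalIntegral.integral_finsetSum, Finset.mul_sum]
      · refine Finset.sum_congr rfl fun j _ => ?_
        rw [mul_comm _ (DprodFull θ m n _ k j), ← mul_assoc,
          ← intervalIntegral.integral_const_mul]
        congr 1
        funext x
        ring
      · intro j _
        convert (hNint (i.1 + 1) (j.1 + 1)).const_mul
          (cVec θ m n ℓ ν i * DprodFull θ m n (by omega) k j) using 1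
        funext x
        ring
    · intro i _
      have := IntervalIntegrable.sum (μ := volume) (a := a) (b := b) Finset.univ
        (f := fun (j : Fin n) x => (cVec θ m n ℓ ν i * DprodFull θ m n (by omega) k j) *
          (Nspl θ m (i.1 + 1) x * Nspl θ m (j.1 + 1) x))
        fun j _ => (hNint (i.1 + 1) (j.1 + 1)).const_mul _
      refine IntervalIntegrable.congr (fun x _ => ?_) this
      rw [Finset.sum_apply]
      refine Finset.sum_congr rfl fun j _ => ?_
      ring
  rw [step1]
  have hcs := fun x hx1 hx2 => csum hθ m n ℓ ν (by omega) (by omega) hℓ1 hw x hx1 hx2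
  have e1 : Set.EqOn (fun x => (∑ i : Fin n, cVec θ m n ℓ ν i * Nspl θ m (i.1 + 1) x) * f m x)
      (fun x => (if x < θ ℓ then (θ ℓ - x) ^ (m - 1 - ν) else 0) * f m x) (Set.Ioo a b) := by
    intro x hx
    simp only
    rw [hcs x (hma ▸ hx.1.le) (hb ▸ hx.2)]
  have hpi : IntervalIntegrable (fun x => (θ ℓ - x) ^ (m - 1 - ν) * f m x) volume a (θ ℓ) :=
    (fint a (θ ℓ) m le_rfl).continuousOn_mul (by fun_prop)
  rw [intervalIntegral.integral_of_le (hal.trans hlb), intervalIntegral.integral_of_le hal,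
    integral_Ioc_eq_integral_Ioo, integral_Ioc_eq_integral_Ioo,
    setIntegral_congr_fun measurableSet_Ioo e1]
  have e2 : (fun x => (if x < θ ℓ then (θ ℓ - x) ^ (m - 1 - ν) else 0) * f m x)
      = (Set.Iio (θ ℓ)).indicator (fun x => (θ ℓ - x) ^ (m - 1 - ν) * f m x) := by
    funext x
    simp [Set.indicator_apply]
  rw [e2, setIntegral_indicator measurableSet_Iio, Set.Ioo_inter_Iio, min_eq_right hlb]

end BS

namespace BS

lemma Nspl_congr {θ η : ℕ → ℝ} (j k : ℕ) (h : ∀ i, k ≤ i → i ≤ k + j → θ i = η i) :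
    Nspl θ j k = Nspl η j k := by
  induction j generalizing k with
  | zero => rfl
  | succ j ih =>
    funext x
    rcases Nat.eq_zero_or_pos j with rfl | hj
    · simp only [Nspl, h k le_rfl (by omega), h (k + 1) (by omega) (by omega)]
    · rw [Nspl_succ θ hj, Nspl_succ η hj, ih k fun i h1 h2 => h i h1 (by omega),
        ih (k + 1) fun i h1 h2 => h i (by omega) (by omega)]
      unfold omegaB
      rw [h k le_rfl (by omega), h (k + 1) (by omega) (by omega),
        h (k + j) (by omega) (by omega), h (k + 1 + j) (by omega) (by omega)]

lemma Dmat_congr {θ η : ℕ → ℝ} (ord p q N : ℕ) (h : ∀ i, 1 ≤ i → i ≤ N → θ i = η i)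
    (hp : 0 < p → p + 1 + ord ≤ N) : Dmat θ ord p q = Dmat η ord p q := by
  ext k j
  have := k.2
  have := hp (by omega)
  simp only [Dmat, Matrix.of_apply]
  rw [h _ _ (show k.1 + 1 + ord ≤ N by omega), h _ _ (show k.1 + 1 ≤ N by omega),
    h _ _ (show k.1 + 2 + ord ≤ N by omega), h _ _ (show k.1 + 2 ≤ N by omega)] <;> omega

lemma Dprod_congr {θ η : ℕ → ℝ} (m n r : ℕ) (h : ∀ i, 1 ≤ i → i ≤ n + m → θ i = η i) :
    Dprod θ m n r = Dprod η m n r := by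
  induction r with
  | zero => exact Dmat_congr m (n - 1) n (n + m) h (by omega)
  | succ r ih =>
    simp only [Dprod]
    rw [ih, Dmat_congr (m + r + 1) _ _ (n + m) h (by omega)]

end BS

/-- For an interior knot `θ_ℓ` of multiplicity `μ` with `θ_ℓ > θ_{ℓ-1}`
and `0 ≤ ν ≤ μ-1`, the row vector `c_{ℓ,ν}ᵀ Γ D_mᵀ ⋯ D_{2m-1}ᵀ` equals
`(m-1-ν)! · (N_{2m,k}^{(ν)}(θ_ℓ); 1 ≤ k ≤ n-m)`. -/
theorem stmt1 (a b : ℝ) (hab : a < b) (m n : ℕ) (hm : 2 ≤ m) (hmn : m ≤ n)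
    (θ : ℕ → ℝ) (hθ : IsOpenKnot θ a b m n)
    (ℓ : ℕ) (hℓ1 : m + 1 ≤ ℓ) (hℓ2 : ℓ ≤ n) (hsep : θ (ℓ - 1) < θ ℓ)
    (ν : ℕ) (hν : ν + 1 ≤ knotMult θ (n + m) ℓ) :
    Matrix.vecMul (cVec θ m n ℓ ν)
        (Gram θ a b m n * (DprodFull θ m n (by omega))ᵀ)
      = fun k : Fin (n - m) =>
        ((m - 1 - ν).factorial : ℝ) * iteratedDeriv ν (Nspl θ (2 * m) (k.1 + 1)) (θ ℓ) := by
  have hmono : ∀ i j, 1 ≤ i → i ≤ j → j ≤ n + m → θ i ≤ θ j := by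
    intro i j hi hij
    induction j, hij using Nat.le_induction with
    | base => intro _; exact le_rfl
    | succ j hij ih =>
      intro hj
      exact (ih (by omega)).trans (hθ.mono j (by omega) (by omega))
  have hνm : ν + 2 ≤ m := by
    have := hθ.intMult ℓ hℓ1 hℓ2
    omega
  have hw : θ (ℓ + ν) = θ ℓ := by
    by_contra hne
    have hsub : ((Finset.Icc 1 (n + m)).filter fun i => θ i = θ ℓ) ⊆ Finset.Ico ℓ (ℓ + ν) := by
      intro i hi
      rw [Finset.mem_filter, Finset.mem_Icc] at hi
      obtain ⟨⟨hi1, hi2⟩, hi3⟩ := hi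
      rw [Finset.mem_Ico]
      constructor
      · by_contra hlt
        have := hmono i (ℓ - 1) hi1 (by omega) (by omega)
        linarith
      · by_contra hge
        have h1 := hmono (ℓ + ν) i (by omega) (by omega) (by omega)
        have h2 := hmono ℓ (ℓ + ν) (by omega) (by omega) (by omega)
        exact hne (by linarith)
    have := Finset.card_le_card hsub
    simp only [Nat.card_Ico] at this
    unfold knotMult at hν
    omega
  have hmult : ∀ k t, m + 1 ≤ t → t ≤ n → 1 ≤ k → k ≤ n → k ≤ t → t ≤ k + m →
      θ k < θ (k + m) := by
    intro k t ht1 ht2 hk1 hk2 hkt htk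
    by_contra hge
    have hle := not_lt.1 hge
    have hsub : Finset.Icc k (k + m) ⊆ ((Finset.Icc 1 (n + m)).filter fun i => θ i = θ t) := by
      intro i hi
      rw [Finset.mem_Icc] at hi
      rw [Finset.mem_filter, Finset.mem_Icc]
      refine ⟨⟨by omega, by omega⟩, ?_⟩
      have h1 := hmono k i hk1 hi.1 (by omega)
      have h2 := hmono i (k + m) (by omega) hi.2 (by omega)
      have h3 := hmono k t hk1 hkt (by omega)
      have h4 := hmono t (k + m) (by omega) htk (by omega)
      linarith
    have := Finset.card_le_card hsub
    have h5 := hθ.intMult t ht1 ht2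
    unfold knotMult at h5
    simp only [Nat.card_Icc] at this
    omega
  have hst : ∀ k, 1 ≤ k → k ≤ n → θ k < θ (k + m) := by
    intro k hk1 hk2
    by_cases c1 : k + m ≤ n
    · exact hmult k (k + m) (by omega) c1 hk1 hk2 (by omega) le_rfl
    · by_cases c2 : m + 1 ≤ k
      · exact hmult k k c2 hk2 hk1 hk2 le_rfl (by omega)
      · rw [hθ.left k hk1 (by omega), hθ.right (k + m) (by omega) (by omega)]
        exact hab
  -- clamp the knots
  set η : ℕ → ℝ := fun i => θ (max 1 (min i (n + m))) with hη
  have hηθ : ∀ i, 1 ≤ i → i ≤ n + m → θ i = η i := by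
    intro i h1 h2
    simp only [hη]
    rw [min_eq_left h2, max_eq_right h1]
  have hηm : Monotone η := fun i j hij =>
    hmono _ _ (by omega) (by omega) (by omega)
  have key := BS.core a b m n hm η hηm
    (by rw [← hηθ _ (by omega) (by omega)]; exact hθ.left 1 le_rfl (by omega))
    (by rw [← hηθ _ (by omega) (by omega)]; exact hθ.left m (by omega) le_rfl)
    (by rw [← hηθ _ (by omega) (by omega)]; exact hθ.right (n + 1) (by omega) (by omega))
    (fun k h1 h2 => by
      rw [← hηθ _ (by omega) (by omega), ← hηθ _ (by omega) (by omega)]; exact hst k h1 h2)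
    ℓ hℓ1 hℓ2 ν hνm
    (by rw [← hηθ _ (by omega) (by omega), ← hηθ _ (by omega) (by omega)]; exact hw)
  have g1 : cVec θ m n ℓ ν = cVec η m n ℓ ν := by
    funext k
    have hk := k.2
    simp only [cVec, esymmF]
    split_ifs
    · congr 1
      refine Finset.sum_congr rfl fun t ht => Finset.prod_congr rfl fun i hi => ?_
      have := (Finset.mem_powersetCard.1 ht).1 hi
      rw [Finset.mem_Icc] at this
      rw [← hηθ i (by omega) (by omega), ← hηθ ℓ (by omega) (by omega)]
    · rfl
  have g2 : Gram θ a b m n = Gram η a b m n := by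
    ext i j
    have hi := i.2
    have hj := j.2
    simp only [Gram, Matrix.of_apply]
    rw [BS.Nspl_congr (θ := θ) (η := η) m (i.1 + 1) fun t h1 h2 => hηθ t (by omega) (by omega),
      BS.Nspl_congr (θ := θ) (η := η) m (j.1 + 1) fun t h1 h2 => hηθ t (by omega) (by omega)]
  have g3 : DprodFull θ m n (by omega) = DprodFull η m n (by omega) := by
    simp only [DprodFull]
    rw [BS.Dprod_congr m n (m - 1) hηθ]
  rw [g1, g2, g3, key]
  funext k
  have hk := k.2
  rw [BS.Nspl_congr (θ := θ) (η := η) (2 * m) (k.1 + 1) fun t h1 h2 =>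
    hηθ t (by omega) (by omega), ← hηθ ℓ (by omega) (by omega)]
end

section
/- The matrix A ∈ ℝ^{r̃×(n−m)} has full row rank r̃; in particular r̃ ≤ n−m and A admits a right inverse R ∈ ℝ^{(n−m)×r̃} with A R = I_{r̃}. -/
open scoped BigOperators
open MeasureTheory Matrix

/-- The matrix `A` with rows `a_{j,ν} = (m-1-ν)!·(N_{2m,k}^{(ν)}(θ_{ℓ_j}); 1 ≤ k ≤ n-m)`,
rows indexed by the pairs `(j, ν)` with `0 ≤ ν ≤ μ_j - 1`. -/
noncomputable def Amat (θ : ℕ → ℝ) (m n r : ℕ) (ℓ μ : Fin r → ℕ) :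
    Matrix ((j : Fin r) × Fin (μ j)) (Fin (n - m)) ℝ :=
  Matrix.of fun p k =>
    ((m - 1 - p.2.1).factorial : ℝ) * iteratedDeriv p.2.1 (Nspl θ (2 * m) (k.1 + 1)) (θ (ℓ p.1))


section SplPieces
open Polynomial

noncomputable def splW (T : ℤ → ℝ) (j : ℕ) (k : ℤ) : ℝ[X] :=
  C ((T (k + j) - T k)⁻¹) * (X - C (T k))

noncomputable def splQ (T : ℤ → ℝ) (i : ℤ) : ℕ → ℤ → ℝ[X]
  | 0, k => if k = i then 1 else 0
  | j + 1, k => splW T (j + 1) k * splQ T i j k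
      + (1 - splW T (j + 1) (k + 1)) * splQ T i j (k + 1)

theorem splQ_supp (T : ℤ → ℝ) (i : ℤ) (j : ℕ) : ∀ k : ℤ, ¬ (k ≤ i ∧ i ≤ k + j) →
    splQ T i j k = 0 := by
  induction j with
  | zero => intro k hk; simp only [splQ]; rw [if_neg]; push_cast at hk; omega
  | succ j ih =>
    intro k hk
    push_cast at hk
    simp only [splQ]
    rw [ih k (by omega), ih (k + 1) (by omega)]; simp

theorem splQ_degen (T : ℤ → ℝ) (hT : Monotone T) (i : ℤ) (hi : T i < T (i + 1)) (j : ℕ) (k : ℤ)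
    (h : T (k + j + 1) = T k) : splQ T i j k = 0 := by
  apply splQ_supp
  rintro ⟨h1, h2⟩
  have := hT h1
  have := hT (show i + 1 ≤ k + j + 1 by omega)
  linarith

theorem splHelp (v u w : ℝ) (h1 : v ≠ u) (h2 : v ≠ w) :
    (1 - C ((v - u)⁻¹) * (X - C u)) * C ((v - w)⁻¹)
      = C ((v - u)⁻¹) * (1 - C ((v - w)⁻¹) * (X - C w)) := by
  have e1 : C ((v - u)⁻¹) * (C v - C u) = (1 : ℝ[X]) := by
    rw [← C_sub, ← C_mul, inv_mul_cancel₀ (sub_ne_zero.2 h1), C_1]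
  have e2 : C ((v - w)⁻¹) * (C v - C w) = (1 : ℝ[X]) := by
    rw [← C_sub, ← C_mul, inv_mul_cancel₀ (sub_ne_zero.2 h2), C_1]
  linear_combination -C ((v - w)⁻¹) * e1 + C ((v - u)⁻¹) * e2

theorem splQ_deriv (T : ℤ → ℝ) (hT : Monotone T) (i : ℤ) (hi : T i < T (i + 1)) (j : ℕ) :
    ∀ k : ℤ, derivative (splQ T i (j + 1) k) = C ((j : ℝ) + 1) *
      (C ((T (k + (j + 1 : ℕ)) - T k)⁻¹) * splQ T i j k
        - C ((T (k + 1 + (j + 1 : ℕ)) - T (k + 1))⁻¹) * splQ T i j (k + 1)) := by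
  induction j with
  | zero =>
    intro k
    have h0 : ∀ k, derivative (splQ T i 0 k) = 0 := by
      intro k; simp only [splQ]; split_ifs <;> simp
    rw [show splQ T i (0+1) k = splW T (0 + 1) k * splQ T i 0 k
      + (1 - splW T (0 + 1) (k + 1)) * splQ T i 0 (k + 1) from rfl]
    simp only [derivative_add, derivative_mul, h0, splW, derivative_sub, derivative_C, derivative_X,
      derivative_one]
    simp
    ring
  | succ j ih =>
    intro k
    rw [splQ]
    simp only [derivative_add, derivative_mul, ih, splW, derivative_sub, derivative_C, derivative_X,
      derivative_one]
    rw [show splQ T i (j+1) k = splW T (j + 1) k * splQ T i j k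
      + (1 - splW T (j + 1) (k + 1)) * splQ T i j (k + 1) from rfl,
      show splQ T i (j+1) (k+1) = splW T (j + 1) (k+1) * splQ T i j (k+1)
      + (1 - splW T (j + 1) (k + 1 + 1)) * splQ T i j (k + 1 + 1) from rfl]
    simp only [splW]
    have a1 : k + 1 + ((j + 1 : ℕ) : ℤ) = k + ((j + 1 + 1 : ℕ) : ℤ) := by push_cast; ring
    have a2 : k + 1 + 1 + ((j + 1 : ℕ) : ℤ) = k + 1 + ((j + 1 + 1 : ℕ) : ℤ) := by push_cast; ring
    rw [a1, a2]
    have c1 : ((1 - C ((T (k + ((j + 1 + 1 : ℕ) : ℤ)) - T k)⁻¹) * (X - C (T k))) *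
          C ((T (k + ((j + 1 + 1 : ℕ) : ℤ)) - T (k+1))⁻¹)
        - C ((T (k + ((j + 1 + 1 : ℕ) : ℤ)) - T k)⁻¹) *
          (1 - C ((T (k + ((j + 1 + 1 : ℕ) : ℤ)) - T (k+1))⁻¹) * (X - C (T (k+1)))))
          * splQ T i j (k+1) = 0 := by
      by_cases h : T (k + ((j + 1 + 1 : ℕ) : ℤ)) = T (k+1)
      · rw [splQ_degen T hT i hi j (k+1), mul_zero]
        rw [← h]; congr 1; push_cast; ring
      · rw [splHelp _ _ _ _ h, sub_self, zero_mul]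
        have h1 := hT (show k ≤ k+1 by omega)
        have h2 := hT (show k+1 ≤ k + ((j + 1 + 1 : ℕ) : ℤ) by push_cast; omega)
        have := lt_of_le_of_ne h2 (Ne.symm h)
        linarith
    have c2 : ((1 - C ((T (k + 1 + ((j + 1 + 1 : ℕ) : ℤ)) - T (k + 1))⁻¹) * (X - C (T (k + 1)))) *
          C ((T (k + 1 + ((j + 1 + 1 : ℕ) : ℤ)) - T (k+1+1))⁻¹)
        - C ((T (k + 1 + ((j + 1 + 1 : ℕ) : ℤ)) - T (k+1))⁻¹) *
          (1 - C ((T (k + 1 + ((j + 1 + 1 : ℕ) : ℤ)) - T (k+1+1))⁻¹) * (X - C (T (k+1+1)))))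
          * splQ T i j (k+1+1) = 0 := by
      by_cases h : T (k + 1 + ((j + 1 + 1 : ℕ) : ℤ)) = T (k+1+1)
      · rw [splQ_degen T hT i hi j (k+1+1), mul_zero]
        rw [← h]; congr 1; push_cast; ring
      · rw [splHelp _ _ _ _ h, sub_self, zero_mul]
        have h1 := hT (show k + 1 ≤ k+1+1 by omega)
        have h2 := hT (show k+1+1 ≤ k + 1 + ((j + 1 + 1 : ℕ) : ℤ) by push_cast; omega)
        have := lt_of_le_of_ne h2 (Ne.symm h)
        linarith
    have e : (C (((j + 1 : ℕ) : ℝ) + 1) : ℝ[X]) = C ((j : ℝ) + 1) + 1 := by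
      rw [← C_1, ← C_add]; push_cast; rfl
    rw [e]
    linear_combination C ((j : ℝ) + 1) * c1 - C ((j : ℝ) + 1) * c2

theorem splQ_top (T : ℤ → ℝ) (hT : Monotone T) (i : ℤ) (hi : T i < T (i + 1)) (j : ℕ) :
    ∀ k : ℤ, derivative^[j + 1] (splQ T i j k) = 0 := by
  induction j with
  | zero => intro k; simp only [splQ]; split_ifs <;> simp
  | succ j ih =>
    intro k
    rw [Function.iterate_succ_apply, splQ_deriv T hT i hi]
    rw [iterate_derivative_C_mul, iterate_derivative_sub, iterate_derivative_C_mul,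
      iterate_derivative_C_mul, ih, ih]
    simp

structure SplBlock (T : ℤ → ℝ) (L : ℤ) (q : ℕ) (ξ : ℝ) : Prop where
  pos : 1 ≤ q
  eq : ∀ t, L < t → t ≤ L + q → T t = ξ
  lt : T L < ξ
  gt : ξ < T (L + q + 1)

theorem SplBlock.ndL {T : ℤ → ℝ} {L : ℤ} {q : ℕ} {ξ : ℝ} (h : SplBlock T L q ξ) :
    T L < T (L + 1) := by
  have := h.pos
  rw [h.eq (L + 1) (by omega) (by omega)]; exact h.lt

theorem SplBlock.ndR {T : ℤ → ℝ} {L : ℤ} {q : ℕ} {ξ : ℝ} (h : SplBlock T L q ξ) :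
    T (L + q) < T (L + q + 1) := by
  have := h.pos
  rw [h.eq (L + q) (by omega) (by omega)]; exact h.gt

theorem splQ_valR {T : ℤ → ℝ} {L : ℤ} {q : ℕ} {ξ : ℝ} (h : SplBlock T L q ξ) (j : ℕ) :
    j ≤ q → ∀ k, (splQ T (L + q) j k).eval ξ = if k = L + q - j then 1 else 0 := by
  induction j with
  | zero => intro _ k; simp only [splQ]; push_cast; rw [sub_zero]; split_ifs <;> simp
  | succ j ih =>
    intro hj k
    simp only [splQ, eval_add, eval_mul, eval_sub, eval_one, ih (by omega), splW, eval_C, eval_X]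
    have e : T (L + q - j) = ξ := h.eq _ (by omega) (by omega)
    by_cases h1 : k = L + q - j
    · rw [if_pos h1, if_neg (by omega), if_neg (by push_cast; omega), h1, e]; simp
    · rw [if_neg h1]
      by_cases h2 : k + 1 = L + q - j
      · rw [if_pos h2, if_pos (by push_cast; omega), h2, e]; simp
      · rw [if_neg h2, if_neg (by push_cast; omega)]; simp

theorem splQ_valL {T : ℤ → ℝ} {L : ℤ} {q : ℕ} {ξ : ℝ} (h : SplBlock T L q ξ) (j : ℕ) :
    j ≤ q → ∀ k, (splQ T L j k).eval ξ = if k = L then 1 else 0 := by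
  induction j with
  | zero => intro _ k; simp only [splQ]; split_ifs <;> simp
  | succ j ih =>
    intro hj k
    simp only [splQ, eval_add, eval_mul, eval_sub, eval_one, ih (by omega), splW, eval_C, eval_X]
    have e : T (L + (j + 1 : ℕ)) = ξ := h.eq _ (by push_cast; omega) (by push_cast; omega)
    have e2 : (ξ - T L)⁻¹ * (ξ - T L) = 1 := inv_mul_cancel₀ (sub_ne_zero.2 h.lt.ne')
    by_cases h1 : k = L
    · rw [if_pos h1, if_neg (by omega), h1, e, e2]; simp
    · rw [if_neg h1]
      by_cases h2 : k + 1 = L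
      · rw [if_pos h2, h2, e, e2]; simp
      · rw [if_neg h2]; simp

theorem splQ_cont {T : ℤ → ℝ} {L : ℤ} {q : ℕ} {ξ : ℝ} (h : SplBlock T L q ξ) (j : ℕ) (hj : q ≤ j) :
    ∀ k, (splQ T (L + q) j k).eval ξ = (splQ T L j k).eval ξ := by
  induction j, hj using Nat.le_induction with
  | base => intro k; rw [splQ_valR h q le_rfl, splQ_valL h q le_rfl]; simp
  | succ j hj ih =>
    intro k
    simp only [splQ, eval_add, eval_mul, ih]

theorem splQ_smooth {T : ℤ → ℝ} (hT : Monotone T) {L : ℤ} {q : ℕ} {ξ : ℝ} (h : SplBlock T L q ξ)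
    (ν : ℕ) : ∀ j, ν + q ≤ j → ∀ k, (derivative^[ν] (splQ T (L + q) j k)).eval ξ
      = (derivative^[ν] (splQ T L j k)).eval ξ := by
  induction ν with
  | zero => intro j hj k; exact splQ_cont h j (by omega) k
  | succ ν ih =>
    intro j hj k
    obtain ⟨j, rfl⟩ : ∃ j', j = j' + 1 := ⟨j - 1, by omega⟩
    rw [Function.iterate_succ_apply, Function.iterate_succ_apply, splQ_deriv T hT _ h.ndR,
      splQ_deriv T hT _ h.ndL]
    simp only [iterate_derivative_C_mul, iterate_derivative_sub, eval_mul, eval_sub]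
    rw [ih j (by omega), ih j (by omega)]

/-- summation by parts -/
theorem splSum (i : ℤ) (j : ℕ) (c : ℤ → ℝ[X]) (F G : ℤ → ℝ[X]) (hF : F (i - (j + 1 : ℕ)) = 0)
    (hG : G (i + 1) = 0) :
    ∑ t ∈ Finset.range (j + 2), c (i - t) * (F (i - t) + G (i - t + 1))
      = ∑ t ∈ Finset.range (j + 1), (c (i - t) * F (i - t) + c (i - t - 1) * G (i - t)) := by
  simp only [mul_add, Finset.sum_add_distrib]
  rw [Finset.sum_range_succ, hF, mul_zero, add_zero]
  congr 1
  rw [Finset.sum_range_succ']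
  simp only [Nat.cast_zero, sub_zero, hG, mul_zero, add_zero]
  apply Finset.sum_congr rfl
  intro t _
  rw [show i - ((t + 1 : ℕ) : ℤ) + 1 = i - t by push_cast; ring,
    show i - ((t + 1 : ℕ) : ℤ) = i - t - 1 by push_cast; ring]

theorem splQ_unity (T : ℤ → ℝ) (i : ℤ) (j : ℕ) :
    ∑ t ∈ Finset.range (j + 1), splQ T i j (i - t) = 1 := by
  induction j with
  | zero => simp [splQ]
  | succ j ih =>
    have := splSum i j (fun _ => 1) (fun k => splW T (j + 1) k * splQ T i j k)
      (fun k => (1 - splW T (j + 1) k) * splQ T i j k)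
      (by rw [splQ_supp _ _ _ _ (by push_cast; omega), mul_zero])
      (by rw [splQ_supp _ _ _ _ (by push_cast; omega), mul_zero])
    simp only [one_mul] at this
    simp only [splQ]
    refine this.trans (Eq.trans ?_ ih)
    apply Finset.sum_congr rfl
    intro t _
    ring

theorem splQ_li (T : ℤ → ℝ) (hT : Monotone T) (i : ℤ) (hi : T i < T (i + 1)) (j : ℕ) :
    ∀ c : ℤ → ℝ, ∑ t ∈ Finset.range (j + 1), C (c (i - t)) * splQ T i j (i - t) = 0 →
      ∀ t ∈ Finset.range (j + 1), c (i - t) = 0 := by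
  induction j with
  | zero =>
    intro c h t ht
    have : t = 0 := by simpa using ht
    subst this
    simpa [splQ] using h
  | succ j ih =>
    intro c h t ht
    have h' := congrArg derivative h
    simp only [derivative_sum, derivative_mul, derivative_C, zero_mul, zero_add, derivative_zero,
      splQ_deriv T hT i hi] at h'
    have hs := splSum i j (fun k => C (c k) * C ((j : ℝ) + 1))
      (fun k => C ((T (k + (j + 1 : ℕ)) - T k)⁻¹) * splQ T i j k)
      (fun k => - (C ((T (k + (j + 1 : ℕ)) - T k)⁻¹) * splQ T i j k))
      (by rw [splQ_supp _ _ _ _ (by push_cast; omega), mul_zero])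
      (by rw [splQ_supp _ _ _ _ (by push_cast; omega), mul_zero, neg_zero])
    have h2 := ih (fun k => (c k - c (k - 1)) * (((j : ℝ) + 1) * (T (k + (j + 1 : ℕ)) - T k)⁻¹)) (by
      rw [← h']
      simp only [← sub_eq_add_neg, mul_assoc] at hs
      rw [hs]
      apply Finset.sum_congr rfl
      intro t _
      simp only [C_mul, C_sub]
      ring)
    have h3 : ∀ t : ℕ, t < j + 2 → c (i - t) = c i := by
      intro t
      induction t with
      | zero => intro _; simp
      | succ t iht =>
        intro ht
        have h4 := h2 t (by simp; omega)
        simp only [mul_eq_zero, inv_eq_zero] at h4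
        have m1 := hT (show i - t ≤ i by omega)
        have m2 := hT (show i + 1 ≤ i - t + (j + 1 : ℕ) by push_cast; omega)
        have h5 : c (i - t) - c (i - t - 1) = 0 := by
          rcases h4 with h4 | h4 | h4
          · exact h4
          · have : (0:ℝ) < (j:ℝ) + 1 := by positivity
            exfalso; linarith
          · exfalso; linarith
        rw [← iht (by omega), show i - ((t + 1 : ℕ) : ℤ) = i - t - 1 by push_cast; ring]
        linarith
    have h6 : C (c i) = (0 : ℝ[X]) := by
      rw [← h]
      rw [Finset.sum_congr rfl (fun t ht => by rw [h3 t (Finset.mem_range.1 ht)]), ← Finset.mul_sum,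
        splQ_unity, mul_one]
    rw [h3 t (Finset.mem_range.1 ht)]
    simpa using h6

end SplPieces

section SplCore
open Polynomial

noncomputable def splB (m : ℕ) (p : ℝ[X]) : ℝ[X] :=
  (-1) ^ (m + 1) * ∑ ν ∈ Finset.range m,
    (-1) ^ ν * (derivative^[ν] p * derivative^[2 * m - 1 - ν] p)

theorem splB_deriv (m : ℕ) (p : ℝ[X]) (hp : derivative^[2 * m] p = 0) :
    derivative (splB m p) = (derivative^[m] p) ^ 2 := by
  have hone : ∀ k : ℕ, ((-1 : ℝ[X]) ^ k) = C ((-1) ^ k) := by intro k; simp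
  have key : derivative (∑ ν ∈ Finset.range m,
      (-1 : ℝ[X]) ^ ν * (derivative^[ν] p * derivative^[2 * m - 1 - ν] p))
      = (-1) ^ 0 * (derivative^[0] p * derivative^[2 * m - 0] p)
        - (-1) ^ m * (derivative^[m] p * derivative^[2 * m - m] p) := by
    rw [← Finset.sum_range_sub' (fun ν => (-1 : ℝ[X]) ^ ν *
      (derivative^[ν] p * derivative^[2 * m - ν] p)), derivative_sum]
    apply Finset.sum_congr rfl
    intro ν hν
    have hν := Finset.mem_range.1 hν
    rw [hone, derivative_C_mul, derivative_mul, ← Function.iterate_succ_apply' derivative,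
      ← Function.iterate_succ_apply' derivative, ← hone,
      show (2 * m - 1 - ν).succ = 2 * m - ν by omega,
      show 2 * m - (ν + 1) = 2 * m - 1 - ν by omega, pow_succ]
    ring
  rw [splB, hone, derivative_C_mul, key, ← hone, show 2 * m - m = m by omega, Nat.sub_zero, hp]
  have : ((-1 : ℝ[X]) ^ m) * (-1) ^ m = 1 := by rw [← mul_pow]; simp
  rw [pow_succ]
  linear_combination (derivative^[m] p) ^ 2 * this

theorem splMono (B g : ℝ[X]) (h : derivative B = g ^ 2) (u v : ℝ) (huv : u < v) :
    B.eval u ≤ B.eval v ∧ (B.eval u = B.eval v → g = 0) := by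
  have hm : Monotone (fun x => B.eval x) := by
    apply monotone_of_deriv_nonneg B.differentiable
    intro x
    rw [Polynomial.deriv, h, eval_pow]
    positivity
  refine ⟨hm huv.le, fun he => ?_⟩
  have : B = C (B.eval u) := by
    apply Polynomial.eq_of_infinite_eval_eq
    apply (Set.Icc_infinite huv).mono
    intro x hx
    simp only [Set.mem_ofPred_eq, eval_C]
    have h1 := hm hx.1
    have h2 := hm hx.2
    simp only at h1 h2
    linarith
  rw [this, derivative_C] at h
  exact pow_eq_zero_iff (two_ne_zero) |>.1 h.symm

theorem splZero (ξ : ℝ) (m : ℕ) : ∀ p : ℝ[X], derivative^[m] p = 0 →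
    (∀ ν < m, (derivative^[ν] p).eval ξ = 0) → p = 0 := by
  induction m with
  | zero => intro p h _; simpa using h
  | succ m ih =>
    intro p h h2
    have h3 : derivative p = 0 := by
      apply ih
      · rw [← Function.iterate_succ_apply]; exact h
      · intro ν hν
        rw [← Function.iterate_succ_apply]; exact h2 (ν + 1) (by omega)
    have h4 := derivative_eq_zero.1 h3
    rw [eq_C_of_natDegree_eq_zero h4] at h2 ⊢
    have := h2 0 (by omega)
    simp only [Function.iterate_zero, id, eval_C] at this
    rw [this, C_0]

theorem splBlock_left (T : ℤ → ℝ) (hT : Monotone T) (h0 : T 0 < T 1) (R : ℤ) (hR : 1 ≤ R)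
    (hn : T R < T (R + 1)) : ∃ (L : ℤ) (q : ℕ), 0 ≤ L ∧ L + q = R ∧ SplBlock T L q (T R) := by
  have hb : ∀ z, T z < T R → z < R := by
    intro z hz
    by_contra hc
    have := hT (not_lt.1 hc)
    linarith
  have hP0 : T 0 < T R := lt_of_lt_of_le h0 (hT hR)
  obtain ⟨L, hL, hmax⟩ := Int.exists_greatest_of_bdd (P := fun z => T z < T R)
    ⟨R, fun z hz => (hb z hz).le⟩ ⟨0, hP0⟩
  have hLR := hb L hL
  have hL0 := hmax 0 hP0
  refine ⟨L, (R - L).toNat, hL0, by omega, by omega, ?_, hL, ?_⟩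
  · intro t h1 h2
    have h3 : ¬ T t < T R := fun h => by have := hmax t h; omega
    have h4 := hT (show t ≤ R by omega)
    linarith
  · rw [show L + ((R - L).toNat : ℤ) + 1 = R + 1 by omega]; exact hn

theorem splBlock_right (T : ℤ → ℝ) (hT : Monotone T) (E : ℤ) (L : ℤ)
    (hn : T L < T (L + 1)) (hE : T (L + 1) < T (E + 1)) :
    ∃ q : ℕ, L + q ≤ E ∧ SplBlock T L q (T (L + 1)) := by
  have hb : ∀ z, T z ≤ T (L + 1) → z ≤ E := by
    intro z hz
    by_contra hc
    have := hT (show E + 1 ≤ z by omega)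
    linarith
  obtain ⟨R, hR, hmax⟩ := Int.exists_greatest_of_bdd (P := fun z => T z ≤ T (L + 1))
    ⟨E, hb⟩ ⟨L + 1, le_rfl⟩
  have h1 := hmax (L + 1) le_rfl
  have h2 := hb R hR
  refine ⟨(R - L).toNat, by omega, by omega, ?_, hn, ?_⟩
  · intro t h3 h4
    have h5 := hT (show L + 1 ≤ t by omega)
    have h6 := hT (show t ≤ R by omega)
    linarith
  · by_contra hc
    have := hmax _ (not_lt.1 hc)
    omega

theorem splCore (T : ℤ → ℝ) (hT : Monotone T) (m : ℕ) (E : ℕ) (s : ℤ → ℝ[X])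
    (h0 : T 0 < T 1) (hE : T E < T (E + 1)) (hs0 : s 0 = 0) (hsE : s E = 0)
    (htop : ∀ i, T i < T (i + 1) → derivative^[2 * m] (s i) = 0)
    (hq : ∀ (L : ℤ) (q : ℕ) (ξ : ℝ), 0 ≤ L → L + (q : ℤ) ≤ E → SplBlock T L q ξ → q ≤ m)
    (hsm : ∀ (L : ℤ) (q : ℕ) (ξ : ℝ), 0 ≤ L → L + (q : ℤ) ≤ E → SplBlock T L q ξ → ∀ ν : ℕ, ν + q < 2 * m →
      (derivative^[ν] (s (L + q))).eval ξ = (derivative^[ν] (s L)).eval ξ)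
    (hv : ∀ (L : ℤ) (q : ℕ) (ξ : ℝ), 0 ≤ L → L + (q : ℤ) ≤ E → SplBlock T L q ξ → ∀ ν : ℕ, ν < q →
      (derivative^[ν] (s (L + q))).eval ξ = 0) :
    ∀ i : ℕ, i ≤ E → T i < T (i + 1) → s i = 0 := by
  have hB : ∀ i, T i < T (i + 1) → (splB m (s i)).eval (T i) ≤ (splB m (s i)).eval (T (i + 1)) ∧
      ((splB m (s i)).eval (T i) = (splB m (s i)).eval (T (i + 1)) → derivative^[m] (s i) = 0) :=
    fun i hi => splMono _ _ (splB_deriv m _ (htop i hi)) _ _ hi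
  have hjump : ∀ (L : ℤ) (q : ℕ) (ξ : ℝ), 0 ≤ L → L + (q : ℤ) ≤ E → SplBlock T L q ξ →
      (splB m (s (L + q))).eval ξ = (splB m (s L)).eval ξ := by
    intro L q ξ h1 h2 h3
    have h4 := hq L q ξ h1 h2 h3
    simp only [splB, eval_mul, eval_finsetSum]
    congr 1
    apply Finset.sum_congr rfl
    intro ν hν
    have hν := Finset.mem_range.1 hν
    congr 1
    by_cases h5 : ν < q
    · have a1 := hv L q ξ h1 h2 h3 ν h5
      have a2 := hsm L q ξ h1 h2 h3 ν (by omega)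
      rw [← a2, a1]; simp
    · rw [hsm L q ξ h1 h2 h3 ν (by omega), hsm L q ξ h1 h2 h3 (2 * m - 1 - ν) (by omega)]
  -- monotonicity of the end values
  have hmon : ∀ i' : ℕ, i' ≤ E → T i' < T (i' + 1) → ∀ i : ℕ, i ≤ i' → T i < T (i + 1) →
      (splB m (s i)).eval (T (i + 1)) ≤ (splB m (s i')).eval (T (i' + 1)) := by
    intro i'
    induction i' using Nat.strong_induction_on with
    | _ R ih =>
      intro hRE hRn i hi hin
      rcases eq_or_lt_of_le hi with rfl | hi
      · exact le_rfl
      obtain ⟨L, q, hL0, hLq, hbl⟩ := splBlock_left T hT h0 R (by omega) hRn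
      obtain ⟨L, rfl⟩ := Int.eq_ofNat_of_zero_le hL0
      have hpos := hbl.pos
      have hiL : i ≤ L := by
        by_contra hc
        have e1 := hbl.eq i (by omega) (by omega)
        have e2 := hbl.eq (i + 1) (by omega) (by omega)
        linarith
      have a1 := ih L (by omega) (by omega) hbl.ndL i hiL hin
      have a2 := hjump _ q _ hL0 (by omega) hbl
      have a3 := (hB R hRn).1
      have a4 := hbl.eq (L + 1) (by omega) (by omega)
      rw [hLq] at a2
      rw [a4] at a1
      linarith
  have hder : ∀ i : ℕ, i ≤ E → T i < T (i + 1) → derivative^[m] (s i) = 0 := by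
    intro R hRE hRn
    rcases Nat.eq_zero_or_pos R with rfl | hR
    · simp [hs0]
    obtain ⟨L, q, hL0, hLq, hbl⟩ := splBlock_left T hT h0 R (by omega) hRn
    obtain ⟨L, rfl⟩ := Int.eq_ofNat_of_zero_le hL0
    have hpos := hbl.pos
    apply (hB R hRn).2
    have a0 := hmon L (by omega) hbl.ndL 0 (by omega) (by simpa using h0)
    have a1 := hmon E le_rfl hE R hRE hRn
    have a2 := hjump _ q _ hL0 (by omega) hbl
    have a3 := (hB R hRn).1
    have a4 := hbl.eq (L + 1) (by omega) (by omega)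
    rw [hLq] at a2
    rw [hsE] at a1
    have z : splB m (0 : ℝ[X]) = 0 := by simp [splB]
    simp only [Nat.cast_zero, hs0, z, eval_zero] at a0 a1
    rw [a4] at a0
    linarith
  intro i
  induction i using Nat.strong_induction_on with
  | _ R ih =>
    intro hRE hRn
    rcases Nat.eq_zero_or_pos R with rfl | hR
    · simpa using hs0
    obtain ⟨L, q, hL0, hLq, hbl⟩ := splBlock_left T hT h0 R (by omega) hRn
    obtain ⟨L, rfl⟩ := Int.eq_ofNat_of_zero_le hL0
    have hpos := hbl.pos
    have hqm := hq _ q _ hL0 (by omega) hbl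
    apply splZero (T R) m _ (hder R hRE hRn)
    intro ν hν
    have := hsm _ q _ hL0 (by omega) hbl ν (by omega)
    rw [hLq, ih L (by omega) (by omega) hbl.ndL] at this
    simpa using this

open Topology Filter in
theorem splIter (ξ : ℝ) (ν : ℕ) : ∀ (L R : ℝ[X]) (f : ℝ → ℝ),
    (∀ u ≤ ν, (derivative^[u] R).eval ξ = (derivative^[u] L).eval ξ) →
    f =ᶠ[𝓝 ξ] (fun x => if x < ξ then L.eval x else R.eval x) →
    iteratedDeriv ν f ξ = (derivative^[ν] R).eval ξ := by
  induction ν with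
  | zero =>
    intro L R f _ hf
    have := hf.eq_of_nhds
    simpa using this
  | succ ν ih =>
    intro L R f h hf
    rw [iteratedDeriv_succ', Function.iterate_succ_apply]
    apply ih (derivative L)
    · intro u hu
      rw [← Function.iterate_succ_apply, ← Function.iterate_succ_apply]
      exact h (u + 1) (by omega)
    · refine hf.deriv.trans (Filter.Eventually.of_forall fun x => ?_)
      have e0 := h 0 (by omega)
      have e1 := h 1 (by omega)
      simp only [Function.iterate_zero, id, Function.iterate_one] at e0 e1
      simp only
      rcases lt_trichotomy x ξ with hx | hx | hx
      · rw [if_pos hx, ← Polynomial.deriv]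
        apply Filter.EventuallyEq.deriv_eq
        filter_upwards [Iio_mem_nhds hx] with y hy
        exact if_pos hy
      · subst hx
        rw [if_neg (lt_irrefl _)]
        apply HasDerivAt.deriv
        rw [← hasDerivWithinAt_univ, ← Set.Iic_union_Ici (a := x)]
        apply HasDerivWithinAt.union
        · rw [e1]
          apply (L.hasDerivAt x).hasDerivWithinAt.congr
          · intro y hy
            rcases lt_or_eq_of_le (Set.mem_Iic.1 hy) with hy | rfl
            · exact if_pos hy
            · rw [if_neg (lt_irrefl _), e0]
          · rw [if_neg (lt_irrefl _), e0]
        · apply (R.hasDerivAt x).hasDerivWithinAt.congr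
          · intro y hy
            exact if_neg (not_lt.2 (Set.mem_Ici.1 hy))
          · rw [if_neg (lt_irrefl _)]
      · rw [if_neg (not_lt.2 hx.le), ← Polynomial.deriv]
        apply Filter.EventuallyEq.deriv_eq
        filter_upwards [Ioi_mem_nhds hx] with y hy
        exact if_neg (not_lt.2 (le_of_lt hy))

end SplCore

section SplAssemble
open Polynomial

noncomputable def splT (θ : ℕ → ℝ) (a b : ℝ) (N : ℕ) : ℤ → ℝ := fun i =>
  if i ≤ 0 then a - 1 else if i ≤ N then θ i.toNat else b + 1

theorem splT_nat (θ : ℕ → ℝ) (a b : ℝ) (N : ℕ) (k : ℕ) (h1 : 1 ≤ k) (h2 : k ≤ N) :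
    splT θ a b N k = θ k := by
  rw [splT, if_neg (by omega), if_pos (by omega), Int.toNat_natCast]

theorem knot_mono {θ : ℕ → ℝ} {a b : ℝ} {m n : ℕ} (hθ : IsOpenKnot θ a b m n) (i j : ℕ)
    (h1 : 1 ≤ i) (h2 : i ≤ j) (h3 : j ≤ n + m) : θ i ≤ θ j := by
  induction j, h2 using Nat.le_induction with
  | base => exact le_rfl
  | succ j hj ih => exact (ih (by omega)).trans (hθ.mono j (by omega) (by omega))

theorem knot_bd {θ : ℕ → ℝ} {a b : ℝ} {m n : ℕ} (hθ : IsOpenKnot θ a b m n) (hm : 2 ≤ m) (i : ℕ)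
    (h1 : 1 ≤ i) (h3 : i ≤ n + m) : a ≤ θ i ∧ θ i ≤ b := by
  constructor
  · rw [← hθ.left 1 le_rfl (by omega)]; exact knot_mono hθ _ _ le_rfl h1 h3
  · rw [← hθ.right (n + m) (by omega) le_rfl]; exact knot_mono hθ _ _ h1 h3 le_rfl

theorem knot_int {θ : ℕ → ℝ} {a b : ℝ} {m n : ℕ} (hθ : IsOpenKnot θ a b m n) (hm : 2 ≤ m) (k : ℕ)
    (h1 : m + 1 ≤ k) (h3 : k ≤ n) : a < θ k ∧ θ k < b := by
  have hb := knot_bd hθ hm k (by omega) (by omega)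
  have hk := hθ.intMult k h1 h3
  unfold knotMult at hk
  constructor
  · refine lt_of_le_of_ne hb.1 fun h => ?_
    have : (Finset.Icc 1 m).card ≤ ((Finset.Icc 1 (n + m)).filter fun i => θ i = θ k).card := by
      apply Finset.card_le_card
      intro i hi
      simp only [Finset.mem_Icc, Finset.mem_filter] at hi ⊢
      exact ⟨by omega, by rw [hθ.left i hi.1 hi.2, h]⟩
    rw [Nat.card_Icc] at this
    omega
  · refine lt_of_le_of_ne hb.2 fun h => ?_
    have : (Finset.Icc (n + 1) (n + m)).card ≤
        ((Finset.Icc 1 (n + m)).filter fun i => θ i = θ k).card := by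
      apply Finset.card_le_card
      intro i hi
      simp only [Finset.mem_Icc, Finset.mem_filter] at hi ⊢
      exact ⟨by omega, by rw [hθ.right i hi.1 hi.2, h]⟩
    rw [Nat.card_Icc] at this
    omega

theorem splT_mono {θ : ℕ → ℝ} {a b : ℝ} {m n : ℕ} (hθ : IsOpenKnot θ a b m n) (hm : 2 ≤ m)
    (hab : a < b) : Monotone (splT θ a b (n + m)) := by
  intro i j hij
  unfold splT
  have hbd := fun i => knot_bd hθ hm i
  split_ifs with h1 h2 h3 h4 h5 h6
  · exact le_rfl
  · have := (hbd j.toNat (by omega) (by omega)).1; linarith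
  · linarith
  · omega
  · exact knot_mono hθ _ _ (by omega) (by omega) (by omega)
  · have := (hbd i.toNat (by omega) (by omega)).2; linarith
  · omega
  · omega
  · exact le_rfl

theorem omegaB_eq {θ : ℕ → ℝ} {a b : ℝ} {m n : ℕ} (hθ : IsOpenKnot θ a b m n)
    (j k : ℕ) (hk : 1 ≤ k) (hkj : k + j ≤ n + m) (x : ℝ) :
    omegaB θ j k x = (splW (splT θ a b (n + m)) j k).eval x := by
  rw [splW, ← Nat.cast_add, splT_nat _ _ _ _ _ hk (by omega), splT_nat _ _ _ _ _ (by omega) hkj]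
  simp only [eval_mul, eval_C, eval_sub, eval_X]
  unfold omegaB
  split_ifs with h
  · rw [div_eq_inv_mul]
  · have := knot_mono hθ k (k + j) hk (by omega) hkj
    rw [le_antisymm this (not_lt.1 h)]; simp

theorem Nspl_eq {θ : ℕ → ℝ} {a b : ℝ} {m n : ℕ} (hθ : IsOpenKnot θ a b m n) (hm : 2 ≤ m)
    (hab : a < b) (i : ℤ) (x : ℝ) (h1 : splT θ a b (n + m) i ≤ x)
    (h2 : x < splT θ a b (n + m) (i + 1)) (j : ℕ) :
    ∀ k : ℕ, 1 ≤ k → k + j + 1 ≤ n + m →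
      Nspl θ (j + 1) k x = (splQ (splT θ a b (n + m)) i j k).eval x := by
  have hT := splT_mono hθ hm hab
  induction j with
  | zero =>
    intro k hk hk2
    rw [zero_add, Nspl, splQ]
    have e1 := splT_nat θ a b (n + m) k hk (by omega)
    have e2 := splT_nat θ a b (n + m) (k + 1) (by omega) (by omega)
    rw [← e1, ← e2]
    by_cases h : (k : ℤ) = i
    · subst h
      rw [if_pos rfl, if_pos ⟨h1, by push_cast; exact h2⟩]; simp
    · rw [if_neg h, if_neg]
      · simp
      · rintro ⟨h3, h4⟩
        rcases lt_or_gt_of_ne h with h | h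
        · have := hT (show ((k + 1 : ℕ) : ℤ) ≤ i by push_cast; omega)
          linarith
        · have := hT (show i + 1 ≤ (k : ℤ) by omega)
          linarith
  | succ j ih =>
    intro k hk hk2
    rw [Nspl, splQ, omegaB_eq hθ _ _ hk (by omega), omegaB_eq hθ _ _ (by omega) (by omega),
      ih k hk (by omega), ih (k + 1) (by omega) (by omega)]
    simp

theorem block_card {θ : ℕ → ℝ} {a b : ℝ} {m n : ℕ} (hθ : IsOpenKnot θ a b m n) (hm : 2 ≤ m)
    (hab : a < b) (L q : ℕ) (ξ : ℝ) (h2 : L + q ≤ n + m)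
    (hB : SplBlock (splT θ a b (n + m)) L q ξ) (S : ℕ) (hS : S ≤ n + m) (hS2 : L + 1 ≤ S)
    (hS3 : S ≤ L + q) :
    ((Finset.Icc 1 S).filter fun i => θ i = ξ) = Finset.Icc (L + 1) S := by
  have hT := splT_mono hθ hm hab
  ext i
  simp only [Finset.mem_filter, Finset.mem_Icc]
  constructor
  · rintro ⟨⟨h3, h4⟩, h5⟩
    refine ⟨?_, h4⟩
    by_contra hc
    have e := hT (show (i : ℤ) ≤ L by omega)
    rw [splT_nat _ _ _ _ _ h3 (by omega)] at e
    have := hB.lt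
    linarith
  · rintro ⟨h3, h4⟩
    refine ⟨by omega, ?_⟩
    rw [← splT_nat θ a b (n + m) i (by omega) (by omega)]
    exact hB.eq _ (by omega) (by omega)

theorem block_mult {θ : ℕ → ℝ} {a b : ℝ} {m n : ℕ} (hθ : IsOpenKnot θ a b m n) (hm : 2 ≤ m)
    (hab : a < b) (L q : ℕ) (ξ : ℝ) (h2 : L + q ≤ n + m)
    (hB : SplBlock (splT θ a b (n + m)) L q ξ) : knotMult θ (n + m) (L + 1) = q := by
  have hpos := hB.pos
  have hT := splT_mono hθ hm hab
  have e : θ (L + 1) = ξ := by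
    rw [← splT_nat θ a b (n + m) (L + 1) (by omega) (by omega)]
    exact hB.eq _ (by push_cast; omega) (by push_cast; omega)
  unfold knotMult
  rw [e]
  have hsub : ((Finset.Icc 1 (n + m)).filter fun i => θ i = ξ)
      = ((Finset.Icc 1 (L + q)).filter fun i => θ i = ξ) := by
    ext i
    simp only [Finset.mem_filter, Finset.mem_Icc]
    constructor
    · rintro ⟨⟨h3, h4⟩, h5⟩
      refine ⟨⟨h3, ?_⟩, h5⟩
      by_contra hc
      have e := hT (show (L : ℤ) + q + 1 ≤ i by omega)
      rw [splT_nat _ _ _ _ _ h3 (by omega)] at e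
      have := hB.gt
      linarith
    · rintro ⟨⟨h3, h4⟩, h5⟩
      exact ⟨by omega, h5⟩
  rw [hsub, block_card hθ hm hab L q ξ h2 hB (L + q) h2 (by omega) le_rfl, Nat.card_Icc]
  omega

theorem block_cases {θ : ℕ → ℝ} {a b : ℝ} {m n : ℕ} (hθ : IsOpenKnot θ a b m n) (hm : 2 ≤ m)
    (hmn : m ≤ n)
    (hab : a < b) (L q : ℕ) (ξ : ℝ) (h2 : L + q ≤ n + m)
    (hB : SplBlock (splT θ a b (n + m)) L q ξ) :
    q ≤ m ∧ (L = 0 ∨ L + q = n + m ∨ (m ≤ L ∧ L + q ≤ n ∧ q ≤ m - 1)) := by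
  have hpos := hB.pos
  have hnat := splT_nat θ a b (n + m)
  have hL := hB.lt
  have hval : ∀ t : ℕ, L < t → t ≤ L + q → θ t = ξ := by
    intro t h3 h4
    rw [← hnat t (by omega) (by omega)]
    exact hB.eq _ (by omega) (by omega)
  rcases Nat.eq_zero_or_pos L with rfl | hLp
  · refine ⟨?_, Or.inl rfl⟩
    by_contra hc
    have e1 := hval 1 (by omega) (by omega)
    have e2 := hval (m + 1) (by omega) (by omega)
    rw [hθ.left 1 le_rfl (by omega)] at e1
    rcases Nat.lt_or_ge m n with h | h
    · have := (knot_int hθ hm (m + 1) le_rfl h).1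
      linarith
    · rw [hθ.right (m + 1) (by omega) (by omega)] at e2
      linarith
  · have e1 := hval (L + 1) (by omega) (by omega)
    rw [hnat L hLp (by omega)] at hL
    have hmL : m ≤ L := by
      by_contra hc
      rw [hθ.left L hLp (by omega)] at hL
      rw [hθ.left (L + 1) (by omega) (by omega)] at e1
      linarith
    rcases Nat.eq_or_lt_of_le h2 with h3 | h3
    · refine ⟨?_, Or.inr (Or.inl h3)⟩
      by_contra hc
      have e2 := hval (n + m) (by omega) (by omega)
      rw [hθ.right (n + m) (by omega) le_rfl] at e2
      have := (knot_int hθ hm (L + 1) (by omega) (by omega)).2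
      linarith
    · have hn : L + q ≤ n := by
        by_contra hc
        have e2 := hval (L + q) (by omega) (by omega)
        have e3 := hB.gt
        rw [show ((L : ℤ) + q + 1) = ((L + q + 1 : ℕ) : ℤ) by push_cast; ring,
          hnat (L + q + 1) (by omega) (by omega), hθ.right (L + q + 1) (by omega) (by omega)] at e3
        rw [hθ.right (L + q) (by omega) (by omega)] at e2
        linarith
      have h5 := hθ.intMult (L + 1) (by omega) (by omega)
      rw [block_mult hθ hm hab L q ξ h2 hB] at h5
      exact ⟨by omega, Or.inr (Or.inr ⟨hmL, hn, h5⟩)⟩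

open Topology Filter in
theorem Nspl_iter {θ : ℕ → ℝ} {a b : ℝ} {m n : ℕ} (hθ : IsOpenKnot θ a b m n) (hm : 2 ≤ m)
    (hab : a < b) (L q : ℕ) (ξ : ℝ) (hqm : q ≤ m - 1)
    (hB : SplBlock (splT θ a b (n + m)) L q ξ) (ν : ℕ) (hν : ν < q) (k : ℕ) (hk : k + m < n) :
    iteratedDeriv ν (Nspl θ (2 * m) (k + 1)) ξ =
      (derivative^[ν] (splQ (splT θ a b (n + m)) (L + q) (2 * m - 1) (k + 1))).eval ξ := by
  have hT := splT_mono hθ hm hab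
  have hpos := hB.pos
  apply splIter ξ ν (splQ (splT θ a b (n + m)) L (2 * m - 1) (k + 1))
  · intro u hu
    exact splQ_smooth hT hB u _ (by omega) _
  · filter_upwards [Ioo_mem_nhds hB.lt hB.gt] with x hx
    have e : 2 * m = 2 * m - 1 + 1 := by omega
    have e2 : ((k : ℤ) + 1) = ((k + 1 : ℕ) : ℤ) := by push_cast; ring
    rw [e2]
    split_ifs with h
    · conv_lhs => rw [e]
      apply Nspl_eq hθ hm hab _ _ hx.1.le _ _ _ (by omega) (by omega)
      rw [hB.eq (L + 1) (by omega) (by omega)]; exact h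
    · conv_lhs => rw [e]
      apply Nspl_eq hθ hm hab _ _ _ hx.2 _ _ (by omega) (by omega)
      rw [hB.eq (L + q) (by omega) (by omega)]; exact not_lt.1 h

noncomputable def splNu (θ : ℕ → ℝ) (K : ℕ) : ℕ := ((Finset.Icc 1 K).filter fun i => θ i = θ K).card - 1

theorem splNu_eq {θ : ℕ → ℝ} {a b : ℝ} {m n : ℕ} (hθ : IsOpenKnot θ a b m n) (hm : 2 ≤ m)
    (hab : a < b) (L q : ℕ) (ξ : ℝ) (h2 : L + q ≤ n + m)
    (hB : SplBlock (splT θ a b (n + m)) L q ξ) (ν : ℕ) (hν : ν < q) :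
    θ (L + 1 + ν) = ξ ∧ splNu θ (L + 1 + ν) = ν := by
  have e : θ (L + 1 + ν) = ξ := by
    rw [← splT_nat θ a b (n + m) (L + 1 + ν) (by omega) (by omega)]
    exact hB.eq _ (by push_cast; omega) (by push_cast; omega)
  refine ⟨e, ?_⟩
  unfold splNu
  rw [e, block_card hθ hm hab L q ξ h2 hB _ (by omega) (by omega) (by omega), Nat.card_Icc]
  omega

noncomputable def splM (θ : ℕ → ℝ) (m n : ℕ) : Matrix (Fin (n - m)) (Fin (n - m)) ℝ :=
  Matrix.of fun κ k =>
    iteratedDeriv (splNu θ (m + 1 + κ.1)) (Nspl θ (2 * m) (k.1 + 1)) (θ (m + 1 + κ.1))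

theorem iter_sum {ι : Type*} (s : Finset ι) (c : ι → ℝ) (f : ι → ℝ[X]) (ν : ℕ) :
    derivative^[ν] (∑ k ∈ s, C (c k) * f k) = ∑ k ∈ s, C (c k) * derivative^[ν] (f k) := by
  rw [iterate_derivative_sum]
  apply Finset.sum_congr rfl
  intro k _
  rw [iterate_derivative_C_mul]

theorem splM_inj {θ : ℕ → ℝ} {a b : ℝ} {m n : ℕ} (hθ : IsOpenKnot θ a b m n) (hm : 2 ≤ m)
    (hmn : m ≤ n) (hab : a < b) (c : Fin (n - m) → ℝ) (hc : splM θ m n *ᵥ c = 0) : c = 0 := by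
  have hT := splT_mono hθ hm hab
  set T := splT θ a b (n + m) with hTdef
  set s : ℤ → ℝ[X] := fun i => ∑ k : Fin (n - m), C (c k) * splQ T i (2 * m - 1) ((k.1 : ℤ) + 1)
    with hs
  have hnat := splT_nat θ a b (n + m)
  have hT0 : T 0 = a - 1 := by simp [hTdef, splT]
  have hT1 : T 1 = a := by
    have := hnat 1 le_rfl (by omega)
    rw [hθ.left 1 le_rfl (by omega)] at this
    simpa using this
  have hTE : T ((n + m : ℕ) : ℤ) = b := by
    rw [hTdef, hnat (n + m) (by omega) le_rfl, hθ.right (n + m) (by omega) le_rfl]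
  have hTE1 : T (((n + m : ℕ) : ℤ) + 1) = b + 1 := by
    rw [hTdef, splT, if_neg (by omega), if_neg (by omega)]
  have hs0 : s 0 = 0 := by
    simp only [hs]
    apply Finset.sum_eq_zero
    intro k _
    rw [splQ_supp _ _ _ _ (by omega), mul_zero]
  have hsE : s ((n + m : ℕ) : ℤ) = 0 := by
    simp only [hs]
    apply Finset.sum_eq_zero
    intro k _
    have := k.2
    rw [splQ_supp _ _ _ _ (by omega), mul_zero]
  have hsm : ∀ (L : ℤ) (q : ℕ) (ξ : ℝ), 0 ≤ L → L + (q : ℤ) ≤ (n + m : ℕ) → SplBlock T L q ξ →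
      ∀ ν : ℕ, ν + q < 2 * m →
      (derivative^[ν] (s (L + q))).eval ξ = (derivative^[ν] (s L)).eval ξ := by
    intro L q ξ _ _ hB ν hν
    simp only [hs, iter_sum, eval_finsetSum, eval_mul, eval_C]
    apply Finset.sum_congr rfl
    intro k _
    rw [splQ_smooth hT hB ν _ (by omega)]
  have hcore := splCore T hT m (n + m) s (by rw [hT0, hT1]; linarith) (by rw [hTE, hTE1]; linarith)
    hs0 hsE
    (by
      intro i hi
      simp only [hs, iter_sum]
      apply Finset.sum_eq_zero
      intro k _
      have := splQ_top T hT i hi (2 * m - 1) ((k.1 : ℤ) + 1)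
      rw [show 2 * m - 1 + 1 = 2 * m by omega] at this
      rw [this, mul_zero])
    (by
      intro L q ξ hL hq hB
      obtain ⟨L, rfl⟩ := Int.eq_ofNat_of_zero_le hL
      exact (block_cases hθ hm hmn hab L q ξ (by omega) hB).1)
    hsm
    (by
      intro L q ξ hL hq hB ν hν
      obtain ⟨L, rfl⟩ := Int.eq_ofNat_of_zero_le hL
      obtain ⟨hqm, h | h | ⟨h1, h2, h3⟩⟩ := block_cases hθ hm hmn hab L q ξ (by omega) hB
      · rw [hsm _ q ξ hL hq hB ν (by omega), h]
        simp only [Nat.cast_zero, hs0, iterate_derivative_zero, eval_zero]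
      · rw [show ((L : ℤ) + q) = ((n + m : ℕ) : ℤ) by omega, hsE]
        simp only [iterate_derivative_zero, eval_zero]
      · have hrow := congrFun hc ⟨L + ν - m, by omega⟩
        obtain ⟨e1, e2⟩ := splNu_eq hθ hm hab L q ξ (by omega) hB ν hν
        simp only [Matrix.mulVec, dotProduct, splM, Matrix.of_apply, Pi.zero_apply] at hrow
        rw [show m + 1 + (L + ν - m) = L + 1 + ν by omega, e1, e2] at hrow
        rw [← hrow]
        simp only [hs, iter_sum, eval_finsetSum, eval_mul, eval_C]
        apply Finset.sum_congr rfl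
        intro k _
        have := k.2
        rw [Nspl_iter hθ hm hab L q ξ h3 hB ν hν k.1 (by omega), mul_comm])
  funext k0
  have hk0 := k0.2
  -- a nondegenerate interval
  obtain ⟨i, hi1, hi2, hi3⟩ : ∃ i : ℕ, k0.1 + 1 ≤ i ∧ i < k0.1 + 1 + m ∧ θ i < θ (i + 1) := by
    by_contra hcon
    push Not at hcon
    have hall : ∀ t : ℕ, t ≤ m → θ (k0.1 + 1 + t) ≤ θ (k0.1 + 1) := by
      intro t
      induction t with
      | zero => intro _; simp
      | succ t ih =>
        intro ht
        exact (hcon (k0.1 + 1 + t) (by omega) (by omega)).trans (ih (by omega))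
    have h5 := hθ.intMult (k0.1 + 1 + m) (by omega) (by omega)
    unfold knotMult at h5
    have : (Finset.Icc (k0.1 + 1) (k0.1 + 1 + m)).card ≤
        ((Finset.Icc 1 (n + m)).filter fun i => θ i = θ (k0.1 + 1 + m)).card := by
      apply Finset.card_le_card
      intro i hi
      simp only [Finset.mem_Icc, Finset.mem_filter] at hi ⊢
      refine ⟨by omega, le_antisymm ?_ ?_⟩
      · exact knot_mono hθ _ _ (by omega) hi.2 (by omega)
      · exact (hall m le_rfl).trans (knot_mono hθ _ _ (by omega) hi.1 (by omega))
    rw [Nat.card_Icc] at this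
    omega
  have hnd : T i < T (i + 1) := by
    have e := hnat (i + 1) (by omega) (by omega)
    push_cast at e
    rw [hTdef, hnat i (by omega) (by omega), e]
    exact hi3
  have hsi := hcore i (by omega) hnd
  set c' : ℤ → ℝ := fun z => if h : (z - 1).toNat < n - m then
    (if 1 ≤ z then c ⟨(z - 1).toNat, h⟩ else 0) else 0 with hc'
  have hcc : ∀ k : Fin (n - m), c' ((k.1 : ℤ) + 1) = c k := by
    intro k
    have e : ((k.1 : ℤ) + 1 - 1).toNat = k.1 := by omega
    simp only [hc']
    rw [dif_pos (by rw [e]; exact k.2), if_pos (by omega)]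
    congr 1
    exact Fin.ext e
  have hsum : ∑ t ∈ Finset.range (2 * m - 1 + 1), C (c' (i - t)) * splQ T i (2 * m - 1) (i - t)
      = s i := by
    classical
    set f : ℤ → ℝ[X] := fun z => C (c' z) * splQ T i (2 * m - 1) z with hf
    set U : Finset ℤ := (Finset.univ.image fun k : Fin (n - m) => (k.1 : ℤ) + 1) ∪
      ((Finset.range (2 * m - 1 + 1)).image fun t : ℕ => (i : ℤ) - t) with hU
    have g1 : ∑ t ∈ Finset.range (2 * m - 1 + 1), f (i - t) = ∑ z ∈ U, f z := by
      rw [← Finset.sum_image (f := f) (g := fun t : ℕ => (i : ℤ) - t)]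
      · apply Finset.sum_subset Finset.subset_union_right
        intro z _ hz
        simp only [hf]
        rw [splQ_supp, mul_zero]
        rintro ⟨z1, z2⟩
        apply hz
        simp only [Finset.mem_image, Finset.mem_range]
        exact ⟨(i - z).toNat, by omega, by omega⟩
      · intro x _ y _ hxy
        simp only at hxy
        omega
    have g2 : ∑ k : Fin (n - m), f ((k.1 : ℤ) + 1) = ∑ z ∈ U, f z := by
      rw [← Finset.sum_image (f := f) (g := fun k : Fin (n - m) => (k.1 : ℤ) + 1)]
      · apply Finset.sum_subset Finset.subset_union_left
        intro z _ hz
        have : c' z = 0 := by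
          simp only [hc']
          split_ifs with z1 z2
          · exfalso
            apply hz
            simp only [Finset.mem_image, Finset.mem_univ, true_and]
            exact ⟨⟨(z - 1).toNat, z1⟩, by simp only; omega⟩
          · rfl
          · rfl
        simp only [hf, this, C_0, zero_mul]
      · intro x _ y _ hxy
        simp only at hxy
        exact Fin.ext (by omega)
    refine g1.trans (g2.symm.trans ?_)
    simp only [hf, hs, hcc]
  have hfin := splQ_li T hT i hnd (2 * m - 1) c' (hsum.trans hsi) (i - (k0.1 + 1))
    (by simp only [Finset.mem_range]; omega)
  rw [show (i : ℤ) - ((i - (k0.1 + 1) : ℕ) : ℤ) = (k0.1 : ℤ) + 1 by omega, hcc] at hfin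
  exact hfin

end SplAssemble

/-- The matrix `A ∈ ℝ^{r̃×(n-m)}` has full row rank `r̃`; in particular
`r̃ ≤ n-m` and `A` admits a right inverse. -/
theorem stmt4 (a b : ℝ) (hab : a < b) (m n : ℕ) (hm : 2 ≤ m) (hmn : m ≤ n)
    (θ : ℕ → ℝ) (hθ : IsOpenKnot θ a b m n)
    (r : ℕ) (ℓ μ : Fin r → ℕ) (hmono : StrictMono ℓ)
    (hlb : ∀ j, m + 1 ≤ ℓ j) (hub : ∀ j, ℓ j ≤ n)
    (hfirst : ∀ j, θ (ℓ j - 1) < θ (ℓ j))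
    (hμ1 : ∀ j, 1 ≤ μ j) (hμ2 : ∀ j, μ j ≤ knotMult θ (n + m) (ℓ j)) :
    (Amat θ m n r ℓ μ).rank = Fintype.card ((j : Fin r) × Fin (μ j))
    ∧ Fintype.card ((j : Fin r) × Fin (μ j)) ≤ n - m
    ∧ ∃ R : Matrix (Fin (n - m)) ((j : Fin r) × Fin (μ j)) ℝ,
        Amat θ m n r ℓ μ * R = 1 := by
  classical
  have hT := splT_mono hθ hm hab
  have hnat := splT_nat θ a b (n + m)
  have hblock : ∀ p : (j : Fin r) × Fin (μ j), ℓ p.1 + p.2.1 ≤ n ∧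
      θ (ℓ p.1 + p.2.1) = θ (ℓ p.1) ∧ splNu θ (ℓ p.1 + p.2.1) = p.2.1 := by
    rintro ⟨j, ν⟩
    simp only
    have h1 := hlb j
    have h2 := hub j
    have e1 : splT θ a b (n + m) ((ℓ j - 1 : ℕ) : ℤ) = θ (ℓ j - 1) := hnat _ (by omega) (by omega)
    have e2 : splT θ a b (n + m) (((ℓ j - 1 : ℕ) : ℤ) + 1) = θ (ℓ j) := by
      rw [← hnat (ℓ j) (by omega) (by omega)]; congr 1; omega
    have h3 := knot_int hθ hm (ℓ j) h1 h2
    obtain ⟨q, hq, hB⟩ := splBlock_right (splT θ a b (n + m)) hT ((n + m : ℕ) : ℤ)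
      ((ℓ j - 1 : ℕ) : ℤ) (by rw [e1, e2]; exact hfirst j) (by
        rw [e2]
        have : splT θ a b (n + m) (((n + m : ℕ) : ℤ) + 1) = b + 1 := by
          rw [splT, if_neg (by omega), if_neg (by omega)]
        rw [this]; linarith)
    rw [e2] at hB
    have hq' : ℓ j - 1 + q ≤ n + m := by omega
    have hmu := block_mult hθ hm hab _ q _ hq' hB
    rw [show ℓ j - 1 + 1 = ℓ j by omega] at hmu
    have h4 := hμ2 j
    have hν := ν.2
    have hc := block_cases hθ hm hmn hab _ q _ hq' hB
    have hv := splNu_eq hθ hm hab _ q _ hq' hB ν.1 (by omega)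
    rw [show ℓ j - 1 + 1 = ℓ j by omega] at hv
    refine ⟨?_, hv⟩
    rcases hc.2 with h | h | h
    · omega
    · exfalso
      have := hB.eq ((n + m : ℕ) : ℤ) (by omega) (by omega)
      rw [hnat _ (by omega) le_rfl, hθ.right _ (by omega) le_rfl] at this
      linarith
    · omega
  have hlt : ∀ j j', j < j' → θ (ℓ j) < θ (ℓ j') := by
    intro j j' h
    have h1 := hmono h
    have h2 := hlb j
    have h3 := hub j'
    exact lt_of_le_of_lt (knot_mono hθ _ _ (by omega) (by omega) (by omega)) (hfirst j')
  let e : ((j : Fin r) × Fin (μ j)) → Fin (n - m) := fun p => ⟨ℓ p.1 + p.2.1 - (m + 1), by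
    have := (hblock p).1
    have := hlb p.1
    omega⟩
  have he : Function.Injective e := by
    intro p p' h
    have h1 := hlb p.1
    have h2 := hlb p'.1
    have h3 : ℓ p.1 + p.2.1 = ℓ p'.1 + p'.2.1 := by
      have := congrArg Fin.val h
      simp only [e] at this
      omega
    obtain ⟨-, a1, a2⟩ := hblock p
    obtain ⟨-, b1, b2⟩ := hblock p'
    rw [h3] at a1 a2
    have h4 : p.1 = p'.1 := by
      rcases lt_trichotomy p.1 p'.1 with h | h | h
      · have := hlt _ _ h; linarith
      · exact h
      · have := hlt _ _ h; linarith
    have h5 : p.2.1 = p'.2.1 := by omega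
    obtain ⟨j, ν⟩ := p
    obtain ⟨j', ν'⟩ := p'
    simp only at h4 h5
    subst h4
    rw [Fin.ext h5]
  have hsurjM : Function.Surjective (splM θ m n).mulVecLin := by
    rw [← LinearMap.injective_iff_surjective, injective_iff_map_eq_zero]
    intro c hc
    exact splM_inj hθ hm hmn hab c hc
  have hsurj : Function.Surjective (Amat θ m n r ℓ μ).mulVec := by
    intro y
    obtain ⟨c, hc⟩ := hsurjM
      (Function.extend e (fun p => y p / ((m - 1 - p.2.1).factorial : ℝ)) 0)
    refine ⟨c, ?_⟩
    funext p
    have h1 := congrFun hc (e p)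
    rw [he.extend_apply] at h1
    obtain ⟨-, a1, a2⟩ := hblock p
    have hl := hlb p.1
    have e3 : m + 1 + (e p).1 = ℓ p.1 + p.2.1 := by simp only [e]; omega
    simp only [Matrix.mulVecLin_apply, Matrix.mulVec, dotProduct, splM, Matrix.of_apply, e3, a1,
      a2] at h1
    simp only [Matrix.mulVec, dotProduct, Amat, Matrix.of_apply, mul_assoc]
    rw [← Finset.mul_sum, h1, mul_div_cancel₀]
    positivity
  obtain ⟨R, hR⟩ := Matrix.mulVec_surjective_iff_exists_right_inverse.1 hsurj
  have hrank : (Amat θ m n r ℓ μ).rank = Fintype.card ((j : Fin r) × Fin (μ j)) := by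
    apply le_antisymm (Matrix.rank_le_card_height _)
    have := Matrix.rank_mul_le_left (Amat θ m n r ℓ μ) R
    rw [hR, Matrix.rank_one] at this
    exact this
  refine ⟨hrank, ?_, R, hR⟩
  rw [← hrank]
  exact (Matrix.rank_le_card_width _).trans (by simp)
end

section
/- For each 1 ≤ j ≤ r, the set K_j = {ℓ_j−m, ℓ_j−m+1, …, ℓ_j−m+μ_j−1} is a subset of {1,…,n−m} of cardinality μ_j; the sets K_1,…,K_r are pairwise disjoint; and, writing K = {k_1 < k_2 < ⋯ < k_{r̃}} for their union, the r̃×r̃ submatrix A_0 of A formed by the columns with indices k_1,…,k_{r̃} satisfies det A_0 > 0. -/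
open scoped BigOperators
open MeasureTheory Matrix

/-! ### Blossoms -/

noncomputable def omz (τ : ℤ → ℝ) (j : ℕ) (k : ℤ) (z : ℝ) : ℝ := (z - τ k) / (τ (k + j) - τ k)

noncomputable def Bl (τ : ℤ → ℝ) (p : ℤ) : List ℝ → ℤ → ℝ
  | [], k => if k = p then 1 else 0
  | z :: L, k => omz τ (L.length + 1) k z * Bl τ p L k
      + (1 - omz τ (L.length + 1) (k + 1) z) * Bl τ p L (k + 1)

lemma Bl_cons (τ : ℤ → ℝ) (p : ℤ) (z : ℝ) (L : List ℝ) (k : ℤ) :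
    Bl τ p (z :: L) k = omz τ (L.length + 1) k z * Bl τ p L k
      + (1 - omz τ (L.length + 1) (k + 1) z) * Bl τ p L (k + 1) := rfl

lemma Bl_supp (τ : ℤ → ℝ) (p : ℤ) (L : List ℝ) : ∀ k : ℤ, (k < p - L.length ∨ p < k) →
    Bl τ p L k = 0 := by
  induction L with
  | nil => intro k hk; simp only [Bl]; rw [if_neg]; simp at hk; omega
  | cons z L ih =>
    intro k hk
    simp only [List.length_cons] at hk
    push_cast at hk
    rw [Bl_cons, ih k (by omega), ih (k + 1) (by omega)]
    ring

lemma Bl_swap (τ : ℤ → ℝ) (hτ : Monotone τ) (p : ℤ) (hp : τ p < τ (p + 1)) (y z : ℝ) (L : List ℝ)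
    (k : ℤ) : Bl τ p (y :: z :: L) k = Bl τ p (z :: y :: L) k := by
  have nd : ∀ (i : ℤ) (j : ℕ), L.length + 1 ≤ j → Bl τ p L i ≠ 0 → τ i < τ (i + j) := by
    intro i j hj hi
    by_contra h
    apply hi
    apply Bl_supp
    by_contra h2
    push Not at h2
    apply h
    calc τ i ≤ τ p := hτ h2.2
      _ < τ (p + 1) := hp
      _ ≤ τ (i + j) := hτ (by omega)
  simp only [Bl_cons, List.length_cons]
  unfold omz
  have h0 : ∀ c : ℤ, k + c + 1 = k + (c + 1) := fun c => by ring
  generalize hj : L.length = j at *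
  have e1 : k + 1 + ((j + 1 : ℕ) : ℤ) = k + ((j + 1 + 1 : ℕ) : ℤ) := by push_cast; ring
  have e2 : k + 1 + ((j + 1 + 1 : ℕ) : ℤ) = k + 1 + 1 + ((j + 1 : ℕ) : ℤ) := by push_cast; ring
  have n0 := nd k (j + 1 + 1) (by omega)
  have n1 := nd (k + 1) (j + 1) (by omega)
  have n1' := nd (k + 1) (j + 1 + 1) (by omega)
  have n2 := nd (k + 1 + 1) (j + 1) (by omega)
  have m0 : τ k ≤ τ (k + 1) := hτ (by omega)
  have m1 : τ (k + 1) ≤ τ (k + 1 + 1) := hτ (by omega)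
  rw [e1] at n1 ⊢
  rw [e2] at n1' ⊢
  generalize Bl τ p L k = B0 at *
  generalize Bl τ p L (k + 1) = B1 at *
  generalize Bl τ p L (k + 1 + 1) = B2 at *
  generalize τ (k + ((j + 1 : ℕ) : ℤ)) = D at *
  generalize τ (k + ((j + 1 + 1 : ℕ) : ℤ)) = E at *
  generalize τ (k + 1 + 1 + ((j + 1 : ℕ) : ℤ)) = F at *
  generalize τ (k + 1 + 1) = c at *
  generalize τ (k + 1) = b at *
  generalize τ k = a at *
  have c1 : ((y - a) / (E - a) * (1 - (z - b) / (E - b)) + (1 - (y - b) / (F - b)) * ((z - b) / (E - b))) * B1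
     = ((z - a) / (E - a) * (1 - (y - b) / (E - b)) + (1 - (z - b) / (F - b)) * ((y - b) / (E - b))) * B1 := by
    by_cases hB : B1 = 0
    · simp [hB]
    · have q1 := n1 hB
      have q2 := n1' hB
      have : E - b ≠ 0 := by linarith
      have : E - a ≠ 0 := by linarith
      have : F - b ≠ 0 := by linarith
      congr 1
      field_simp
      ring
  have c2 : ((1 - (y - b) / (F - b)) * (1 - (z - c) / (F - c))) * B2
     = ((1 - (z - b) / (F - b)) * (1 - (y - c) / (F - c))) * B2 := by
    by_cases hB : B2 = 0
    · simp [hB]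
    · have q1 := n2 hB
      have : F - b ≠ 0 := by linarith
      have : F - c ≠ 0 := by linarith
      congr 1
      field_simp
      ring
  have c0 : (y - a) / (E - a) * ((z - a) / (D - a)) * B0
     = (z - a) / (E - a) * ((y - a) / (D - a)) * B0 := by ring
  linear_combination c0 + c1 + c2

lemma Bl_perm (τ : ℤ → ℝ) (hτ : Monotone τ) (p : ℤ) (hp : τ p < τ (p + 1)) {L L' : List ℝ}
    (h : L.Perm L') : ∀ k, Bl τ p L k = Bl τ p L' k := by
  induction h with
  | nil => intro k; rfl
  | cons x h ih => intro k; rw [Bl_cons, Bl_cons, ih, ih, h.length_eq]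
  | swap x y l => intro k; exact Bl_swap τ hτ p hp _ _ _ _
  | trans _ _ h1 h2 => intro k; rw [h1, h2]

lemma Bl_affine (τ : ℤ → ℝ) (p : ℤ) (x y h : ℝ) (L : List ℝ) (k : ℤ) :
    Bl τ p (((1 - h) * x + h * y) :: L) k = (1 - h) * Bl τ p (x :: L) k + h * Bl τ p (y :: L) k := by
  simp only [Bl_cons, omz]
  ring

lemma Bl_append_congr (τ : ℤ → ℝ) (p p' : ℤ) (L R : List ℝ)
    (h : ∀ k, Bl τ p R k = Bl τ p' R k) : ∀ k, Bl τ p (L ++ R) k = Bl τ p' (L ++ R) k := by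
  induction L with
  | nil => simpa using h
  | cons z L ih => intro k; simp only [List.cons_append, Bl_cons, ih]

/-- left piece -/
lemma Bl_left (τ : ℤ → ℝ) (F : ℤ) (s : ℕ) (x : ℝ) (h1 : τ (F - 1) < x)
    (h2 : ∀ i : ℕ, i < s → τ (F + i) = x) : ∀ j ≤ s, ∀ k,
    Bl τ (F - 1) (List.replicate j x) k = if k = F - 1 then 1 else 0 := by
  intro j
  induction j with
  | zero => intro _ k; simp [Bl]
  | succ j ih =>
    intro hj k
    rw [List.replicate_succ, Bl_cons, ih (by omega), ih (by omega), List.length_replicate]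
    have w : omz τ (j + 1) (F - 1) x = 1 := by
      unfold omz
      have : F - 1 + ((j + 1 : ℕ) : ℤ) = F + j := by push_cast; ring
      rw [this, h2 j (by omega)]
      exact div_self (by linarith)
    by_cases hk : k = F - 1
    · subst hk; simp [w]; intro h; omega
    · by_cases hk' : k + 1 = F - 1
      · rw [hk', w]; simp [hk]
      · simp [hk, hk']

lemma Bl_right (τ : ℤ → ℝ) (F : ℤ) (s : ℕ) (x : ℝ)
    (h2 : ∀ i : ℕ, i < s → τ (F + i) = x) : ∀ j ≤ s, ∀ k,
    Bl τ (F - 1 + s) (List.replicate j x) k = if k = F - 1 + s - j then 1 else 0 := by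
  intro j
  induction j with
  | zero => intro _ k; simp [Bl]
  | succ j ih =>
    intro hj k
    rw [List.replicate_succ, Bl_cons, ih (by omega), ih (by omega), List.length_replicate]
    have w : omz τ (j + 1) (F - 1 + s - j) x = 0 := by
      unfold omz
      have : F - 1 + s - j = F + ((s - 1 - j : ℕ) : ℤ) := by omega
      rw [this, h2 _ (by omega)]
      simp
    by_cases hk : k = F - 1 + s - j
    · rw [hk, w]; simp
    · by_cases hk' : k + 1 = F - 1 + s - j
      · rw [hk', w]
        have : k = F - 1 + s - ((j + 1 : ℕ) : ℤ) := by push_cast; omega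
        simp [this]
      · have : ¬ k = F - 1 + s - ((j + 1 : ℕ) : ℤ) := by push_cast; omega
        simp only [hk, hk', this]; simp

lemma Bl_agree (τ : ℤ → ℝ) (F : ℤ) (s : ℕ) (x : ℝ) (h1 : τ (F - 1) < x)
    (h2 : ∀ i : ℕ, i < s → τ (F + i) = x) (L : List ℝ) (w : ℕ) (hw : s ≤ w) (k : ℤ) :
    Bl τ (F - 1) (L ++ List.replicate w x) k = Bl τ (F - 1 + s) (L ++ List.replicate w x) k := by
  obtain ⟨d, rfl⟩ := Nat.exists_eq_add_of_le hw
  have : L ++ List.replicate (s + d) x = (L ++ List.replicate d x) ++ List.replicate s x := by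
    rw [List.append_assoc, List.replicate_append_replicate, add_comm s d]
  rw [this]
  apply Bl_append_congr
  intro k
  rw [Bl_left τ F s x h1 h2 s le_rfl, Bl_right τ F s x h2 s le_rfl]
  simp

/-- window of `t` following index `i` -/
def Win (M : ℕ) (t : ℤ → ℝ) (i : ℤ) : List ℝ := (List.range M).map fun u : ℕ => t (i + 1 + u)

lemma Bl_up (τ : ℤ → ℝ) (hτ : Monotone τ) (p : ℤ) (hp : τ p < τ (p + 1)) (u : ℕ) : ∀ k,
    Bl τ p (((List.range u).map fun v : ℕ => τ (p + 1 + v)).reverse) k = if k = p then 1 else 0 := by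
  induction u with
  | zero => intro k; simp [Bl]
  | succ u ih =>
    intro k
    rw [List.range_succ, List.map_append, List.reverse_append]
    simp only [List.map_cons, List.map_nil, List.reverse_cons, List.reverse_nil, List.nil_append,
      List.cons_append]
    rw [Bl_cons, ih, ih]
    simp only [List.length_reverse, List.length_map, List.length_range]
    have w : omz τ (u + 1) p (τ (p + 1 + u)) = 1 := by
      unfold omz
      have : p + ((u + 1 : ℕ) : ℤ) = p + 1 + u := by push_cast; ring
      rw [this]
      apply div_self
      have : τ (p + 1) ≤ τ (p + 1 + u) := hτ (by omega)
      linarith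
    by_cases hk : k = p
    · subst hk; simp [w]
    · by_cases hk' : k + 1 = p
      · rw [hk', w]; simp [hk]
      · simp [hk, hk']

lemma Bl_down (τ : ℤ → ℝ) (hτ : Monotone τ) (p : ℤ) (hp : τ p < τ (p + 1)) (u w : ℕ) : ∀ k,
    Bl τ p (((List.range w).map fun v : ℕ => τ (p - v)).reverse ++
      ((List.range u).map fun v : ℕ => τ (p + 1 + v)).reverse) k = if k = p - w then 1 else 0 := by
  induction w with
  | zero => intro k; simpa using Bl_up τ hτ p hp u k
  | succ w ih =>
    intro k
    rw [List.range_succ, List.map_append, List.reverse_append]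
    simp only [List.map_cons, List.map_nil, List.reverse_cons, List.reverse_nil, List.nil_append,
      List.cons_append]
    rw [Bl_cons, ih, ih]
    have w0 : ∀ j, omz τ j (p - w) (τ (p - w)) = 0 := by
      intro j; unfold omz; simp
    by_cases hk : k = p - w
    · rw [hk, w0]; simp
    · by_cases hk' : k + 1 = p - w
      · rw [hk', w0]
        have : k = p - ((w + 1 : ℕ) : ℤ) := by push_cast; omega
        simp [this]
      · have : ¬ k = p - ((w + 1 : ℕ) : ℤ) := by push_cast; omega
        simp only [hk, hk', this]; simp

lemma Bl_dual (τ : ℤ → ℝ) (hτ : Monotone τ) (p : ℤ) (hp : τ p < τ (p + 1)) (M : ℕ) (i : ℤ)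
    (h1 : i ≤ p) (h2 : p ≤ i + M) (k : ℤ) :
    Bl τ p (Win M τ i) k = if k = i then 1 else 0 := by
  obtain ⟨w, hw⟩ := Int.eq_ofNat_of_zero_le (sub_nonneg.2 h1)
  obtain ⟨u, hu⟩ := Int.eq_ofNat_of_zero_le (sub_nonneg.2 h2)
  have hM : M = w + u := by omega
  have := Bl_down τ hτ p hp u w k
  have hi : p - w = i := by omega
  rw [hi] at this
  rw [← this]
  apply Bl_perm τ hτ p hp
  unfold Win
  rw [hM, List.range_add, List.map_append]
  apply List.Perm.append
  · have : ((List.range w).map fun v : ℕ => τ (p - v)).reverse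
        = (List.range w).map fun v : ℕ => τ (i + 1 + v) := by
      apply List.ext_getElem
      · simp
      · intro n h1 h2
        simp at h1 h2 ⊢
        congr 1
        omega
    rw [this]
  · rw [List.map_map]
    have : ((fun v : ℕ => τ (i + 1 + v)) ∘ fun x => w + x) = fun v : ℕ => τ (p + 1 + v) := by
      funext v
      simp only [Function.comp]
      congr 1
      push_cast
      omega
    rw [this]
    exact (List.reverse_perm _).symm

/-! ### Total positivity under knot insertion -/

def Compat {ι : Type*} (K I : ι → ℤ) : Prop := ∀ ρ ρ', K ρ < K ρ' → I ρ < I ρ'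

def TPK {ι : Type*} [Fintype ι] [DecidableEq ι] (K : ι → ℤ) (b : ℤ → ι → ℝ) : Prop :=
  ∀ I : ι → ℤ, Compat K I → 0 ≤ Matrix.det (Matrix.of fun ρ => b (I ρ))

def stepRow {ι : Type*} (α : ℤ → ℝ) (b : ℤ → ι → ℝ) (i : ℤ) : ι → ℝ :=
  α i • b i + (1 - α i) • b (i - 1)

lemma det_step {ι : Type*} [Fintype ι] [DecidableEq ι] (b : ℤ → ι → ℝ) (α : ℤ → ℝ) (I : ι → ℤ) :
    Matrix.det (Matrix.of fun ρ => stepRow α b (I ρ)) =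
      ∑ s : Finset ι, (∏ ρ, if ρ ∈ s then α (I ρ) else 1 - α (I ρ)) *
        Matrix.det (Matrix.of fun ρ => b (if ρ ∈ s then I ρ else I ρ - 1)) := by
  have h := (Matrix.detRowAlternating (n := ι) (R := ℝ)).toMultilinearMap.map_add_univ
    (fun ρ => α (I ρ) • b (I ρ)) (fun ρ => (1 - α (I ρ)) • b (I ρ - 1))
  have h1 : Matrix.det (Matrix.of fun ρ => stepRow α b (I ρ)) =
    (Matrix.detRowAlternating (n := ι) (R := ℝ)).toMultilinearMap
     ((fun ρ => α (I ρ) • b (I ρ)) + (fun ρ => (1 - α (I ρ)) • b (I ρ - 1))) := rfl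
  rw [h1, h]
  apply Finset.sum_congr rfl
  intro s _
  have h2 := (Matrix.detRowAlternating (n := ι) (R := ℝ)).toMultilinearMap.map_smul_univ
    (fun ρ => if ρ ∈ s then α (I ρ) else 1 - α (I ρ))
    (fun ρ => b (if ρ ∈ s then I ρ else I ρ - 1))
  rw [smul_eq_mul] at h2
  have h3 : Matrix.det (Matrix.of fun ρ => b (if ρ ∈ s then I ρ else I ρ - 1)) =
    (Matrix.detRowAlternating (n := ι) (R := ℝ)).toMultilinearMap
      (fun ρ => b (if ρ ∈ s then I ρ else I ρ - 1)) := rfl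
  rw [h3, ← h2]
  congr 1
  funext ρ
  by_cases hρ : ρ ∈ s <;> simp [Finset.piecewise, hρ]

lemma term_nonneg {ι : Type*} [Fintype ι] [DecidableEq ι] (K : ι → ℤ) (b : ℤ → ι → ℝ)
    (hb : TPK K b) (I : ι → ℤ) (hI : Compat K I) (s : Finset ι) :
    0 ≤ Matrix.det (Matrix.of fun ρ => b (if ρ ∈ s then I ρ else I ρ - 1)) := by
  by_cases h : Compat K (fun ρ => if ρ ∈ s then I ρ else I ρ - 1)
  · exact hb _ h
  · unfold Compat at h
    push Not at h
    obtain ⟨ρ, ρ', h1, h2⟩ := h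
    have h3 := hI ρ ρ' h1
    have h4 : (if ρ ∈ s then I ρ else I ρ - 1) = (if ρ' ∈ s then I ρ' else I ρ' - 1) := by
      split_ifs at h2 ⊢ <;> omega
    apply le_of_eq
    symm
    apply Matrix.det_zero_of_row_eq (i := ρ) (j := ρ')
    · rintro rfl; omega
    · change b (if ρ ∈ s then I ρ else I ρ - 1) = b (if ρ' ∈ s then I ρ' else I ρ' - 1)
      rw [h4]

lemma TPK_step {ι : Type*} [Fintype ι] [DecidableEq ι] (K : ι → ℤ) (b : ℤ → ι → ℝ)
    (hb : TPK K b) (α : ℤ → ℝ) (h0 : ∀ i, 0 ≤ α i) (h1 : ∀ i, α i ≤ 1) :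
    TPK K (stepRow α b) := by
  intro I hI
  rw [det_step]
  apply Finset.sum_nonneg
  intro s _
  apply mul_nonneg
  · apply Finset.prod_nonneg
    intro ρ _
    have := h0 (I ρ)
    have := h1 (I ρ)
    split_ifs <;> linarith
  · exact term_nonneg K b hb I hI s

lemma det_pos_step {ι : Type*} [Fintype ι] [DecidableEq ι] (K : ι → ℤ) (b : ℤ → ι → ℝ)
    (hb : TPK K b) (α : ℤ → ℝ) (h0 : ∀ i, 0 ≤ α i) (h1 : ∀ i, α i ≤ 1) (I J : ι → ℤ)
    (hJ : Compat K J) (hpos : 0 < Matrix.det (Matrix.of fun ρ => b (I ρ)))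
    (hIJ : ∀ ρ, (J ρ = I ρ ∧ 0 < α (I ρ)) ∨ (J ρ = I ρ + 1 ∧ α (I ρ + 1) < 1)) :
    0 < Matrix.det (Matrix.of fun ρ => stepRow α b (J ρ)) := by
  rw [det_step]
  apply Finset.sum_pos'
  · intro s _
    apply mul_nonneg
    · apply Finset.prod_nonneg
      intro ρ _
      have := h0 (J ρ)
      have := h1 (J ρ)
      split_ifs <;> linarith
    · exact term_nonneg K b hb J hJ s
  · refine ⟨Finset.univ.filter (fun ρ => J ρ = I ρ), Finset.mem_univ _, ?_⟩
    apply mul_pos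
    · apply Finset.prod_pos
      intro ρ _
      rcases hIJ ρ with h | h
      · simp [h.1, h.2]
      · have : ¬ J ρ = I ρ := by omega
        simp [this]
        rw [h.1]; exact h.2
    · refine lt_of_lt_of_eq hpos ?_
      congr 2
      funext ρ
      congr 1
      rcases hIJ ρ with h | h
      · simp [h.1]
      · have : ¬ J ρ = I ρ := by omega
        simp [this]; omega

lemma det_delta {ι : Type*} [Fintype ι] [DecidableEq ι] (K : ι → ℤ) (hK : Function.Injective K) :
    TPK K (fun i ρ => if K ρ = i then 1 else 0) := by
  intro I hI
  by_cases h : ∀ ρ, ∃ ρ', K ρ' = I ρ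
  · have : I = K := by
      let _ : LinearOrder ι := LinearOrder.lift' K hK
      have hKm : StrictMono K := fun a b h => h
      have hIm : StrictMono I := fun a b h => hI a b h
      rw [← hIm.range_inj hKm]
      choose f hf using h
      have hfi : Function.Injective f := by
        intro a b hab
        apply hIm.injective
        rw [← hf, ← hf, hab]
      have hfs := Finite.surjective_of_injective hfi
      ext z
      constructor
      · rintro ⟨a, rfl⟩; exact ⟨f a, hf a⟩
      · rintro ⟨a, rfl⟩
        obtain ⟨c, rfl⟩ := hfs a
        exact ⟨c, (hf c).symm⟩
    have h1 : (Matrix.of fun ρ => (fun (i : ℤ) (ρ : ι) => if K ρ = i then (1:ℝ) else 0) (I ρ)) = 1 := by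
      ext ρ ρ'
      simp only [Matrix.of_apply, this, Matrix.one_apply]
      by_cases h : ρ = ρ'
      · simp [h]
      · have : K ρ' ≠ K ρ := fun h' => h (hK h'.symm)
        simp [h, this]
    rw [h1, Matrix.det_one]
    exact zero_le_one
  · push Not at h
    obtain ⟨ρ, hρ⟩ := h
    apply le_of_eq
    symm
    apply Matrix.det_eq_zero_of_row_eq_zero ρ
    intro ρ'
    simp [hρ ρ']

lemma det_delta_self {ι : Type*} [Fintype ι] [DecidableEq ι] (K : ι → ℤ)
    (hK : Function.Injective K) :
    0 < Matrix.det (Matrix.of fun ρ => (fun (i : ℤ) (ρ : ι) => if K ρ = i then (1:ℝ) else 0) (K ρ)) := by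
  have h1 : (Matrix.of fun ρ => (fun (i : ℤ) (ρ : ι) => if K ρ = i then (1:ℝ) else 0) (K ρ)) = 1 := by
    ext ρ ρ'
    simp only [Matrix.of_apply, Matrix.one_apply]
    by_cases h : ρ = ρ'
    · simp [h]
    · have : K ρ' ≠ K ρ := fun h' => h (hK h'.symm)
      simp [h, this]
  rw [h1, Matrix.det_one]
  exact zero_lt_one

/-! ### Inserting one knot -/

/-- insert `v` so that it becomes entry `P` -/
def insK (t : ℤ → ℝ) (P : ℤ) (v : ℝ) (i : ℤ) : ℝ :=
  if i < P then t i else if i = P then v else t (i - 1)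

noncomputable def insA (M : ℕ) (t : ℤ → ℝ) (P : ℤ) (v : ℝ) (i : ℤ) : ℝ :=
  if i + M < P then 1 else if P ≤ i then 0 else (v - t i) / (t (i + M) - t i)

lemma insK_mono (t : ℤ → ℝ) (ht : Monotone t) (P : ℤ) (v : ℝ) (h1 : t (P - 1) ≤ v) (h2 : v ≤ t P) :
    Monotone (insK t P v) := by
  intro i j hij
  unfold insK
  have A : ∀ i, i < P → t i ≤ v := fun i hi => (ht (by omega)).trans h1
  have B : ∀ i, P ≤ i → v ≤ t i := fun i hi => h2.trans (ht hi)
  split_ifs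
  · exact ht hij
  · exact A _ ‹_›
  · exact ht (by omega)
  · omega
  · exact le_rfl
  · exact B _ (by omega)
  · omega
  · omega
  · exact ht (by omega)

lemma insA_nonneg (M : ℕ) (t : ℤ → ℝ) (ht : Monotone t) (P : ℤ) (v : ℝ) (h1 : t (P - 1) ≤ v) (i : ℤ) :
    0 ≤ insA M t P v i := by
  unfold insA
  split_ifs
  · exact zero_le_one
  · exact le_rfl
  · apply div_nonneg
    · have : t i ≤ t (P - 1) := ht (by omega)
      linarith
    · have : t i ≤ t (i + M) := ht (by omega)
      linarith

lemma insA_le_one (M : ℕ) (t : ℤ → ℝ) (ht : Monotone t) (P : ℤ) (v : ℝ) (h2 : v ≤ t P) (i : ℤ) :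
    insA M t P v i ≤ 1 := by
  unfold insA
  split_ifs
  · exact le_rfl
  · exact zero_le_one
  · apply div_le_one_of_le₀
    · have : t P ≤ t (i + M) := ht (by omega)
      linarith
    · have : t i ≤ t (i + M) := ht (by omega)
      linarith

lemma insA_pos (M : ℕ) (t : ℤ → ℝ) (ht : Monotone t) (P : ℤ) (v : ℝ) (h2 : v ≤ t P) (i : ℤ)
    (hi : t i < v) : 0 < insA M t P v i := by
  have : i < P := by
    by_contra h
    have : t P ≤ t i := ht (by omega)
    linarith
  unfold insA
  split_ifs
  · exact zero_lt_one
  · omega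
  · apply div_pos
    · linarith
    · have : t P ≤ t (i + M) := ht (by omega)
      linarith

lemma insA_lt_one (M : ℕ) (t : ℤ → ℝ) (ht : Monotone t) (P : ℤ) (v : ℝ) (h1 : t (P - 1) ≤ v) (i : ℤ)
    (hi : v < t (i + M)) : insA M t P v i < 1 := by
  have : P ≤ i + M := by
    by_contra h
    have : t (i + M) ≤ t (P - 1) := ht (by omega)
    linarith
  unfold insA
  split_ifs
  · omega
  · exact zero_lt_one
  · have : t i ≤ t (P - 1) := ht (by omega)
    rw [div_lt_one (by linarith)]
    linarith

lemma range_ins (f : ℕ → ℝ) (v : ℝ) (c n : ℕ) (hc : c ≤ n) :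
    ((List.range (n + 1)).map fun u => if u < c then f u else if u = c then v else f (u - 1)).Perm
      (v :: (List.range n).map f) := by
  induction n with
  | zero =>
    have : c = 0 := by omega
    subst this
    simp
  | succ n ih =>
    rw [List.range_succ, List.map_append]
    by_cases h : c ≤ n
    · refine (List.Perm.append_right _ (ih h)).trans ?_
      have h1 : ¬ (n + 1 < c) := by omega
      have h2 : ¬ (n + 1 = c) := by omega
      simp [List.range_succ, h1, h2]
    · have hc' : c = n + 1 := by omega
      subst hc'
      have : ((List.range (n + 1)).map fun u => if u < n + 1 then f u else if u = n + 1 then v else f (u - 1))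
          = (List.range (n + 1)).map f := by
        apply List.map_congr_left
        intro u hu
        rw [List.mem_range] at hu
        simp [hu]
      rw [this]
      simp only [List.map_cons, List.map_nil, lt_irrefl, if_false, if_true]
      exact List.perm_append_singleton _ _

/-- The rows `b i` are blossoms (w.r.t. the coarse knots `τ`) at the windows of the fine knots `t`. -/
def Valid {ι : Type*} (τ : ℤ → ℝ) (M : ℕ) (K : ι → ℤ) (t : ℤ → ℝ) (b : ℤ → ι → ℝ) : Prop :=
  ∀ i p, τ p < τ (p + 1) → t i < τ (p + 1) → τ p < t (i + (M + 1)) → t i < t (i + (M + 1)) →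
    ∀ ρ, b i ρ = Bl τ p (Win M t i) (K ρ)

lemma Valid_base {ι : Type*} (τ : ℤ → ℝ) (hτ : Monotone τ) (M : ℕ) (K : ι → ℤ) :
    Valid τ M K τ (fun i ρ => if K ρ = i then 1 else 0) := by
  intro i p h1 h2 h3 _ ρ
  rw [Bl_dual τ hτ p h1]
  · have := hτ.reflect_lt h2; omega
  · have := hτ.reflect_lt h3; omega

lemma Valid_step {ι : Type*} (τ : ℤ → ℝ) (hτ : Monotone τ) (M : ℕ) (hM : 1 ≤ M) (K : ι → ℤ) (t : ℤ → ℝ)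
    (ht : Monotone t) (b : ℤ → ι → ℝ) (hb : Valid τ M K t b) (P : ℤ) (v : ℝ)
    (hv1 : t (P - 1) ≤ v) (hv2 : v ≤ t P) :
    Valid τ M K (insK t P v) (stepRow (insA M t P v) b) := by
  intro i p h1 h2 h3 h4 ρ
  have eta : ∀ ρ, stepRow (insA M t P v) b i ρ
    = insA M t P v i * b i ρ + (1 - insA M t P v i) * b (i - 1) ρ := fun ρ => by simp [stepRow]
  rw [eta]
  rcases lt_or_ge (i + M) P with hc | hc
  · -- window before P
    have e1 : insA M t P v i = 1 := by unfold insA; rw [if_pos hc]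
    have e2 : Win M (insK t P v) i = Win M t i := by
      unfold Win
      apply List.map_congr_left
      intro u hu
      rw [List.mem_range] at hu
      unfold insK
      rw [if_pos (by omega)]
    have e3 : insK t P v i = t i := by unfold insK; rw [if_pos (by omega)]
    have e4 : insK t P v (i + (M + 1)) ≤ t (i + (M + 1)) := by
      unfold insK
      split_ifs
      · exact le_rfl
      · exact hv2.trans (ht (by omega))
      · exact ht (by omega)
    rw [e3] at h2 h4
    rw [e1, e2, ← hb i p h1 h2 (by linarith) (by linarith) ρ]
    ring
  rcases le_or_gt P i with hd | hd
  · have e1 : insA M t P v i = 0 := by unfold insA; rw [if_neg (by omega), if_pos hd]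
    have e2 : Win M (insK t P v) i = Win M t (i - 1) := by
      unfold Win
      apply List.map_congr_left
      intro u hu
      unfold insK
      rw [if_neg (by omega), if_neg (by omega)]
      congr 1
      ring
    have e3 : insK t P v (i + (M + 1)) = t (i - 1 + (M + 1)) := by
      unfold insK; rw [if_neg (by omega), if_neg (by omega)]; congr 1; ring
    have e4 : t (i - 1) ≤ insK t P v i := by
      unfold insK
      split_ifs
      · omega
      · exact (ht (by omega)).trans hv1
      · exact ht (by omega)
    rw [e3] at h3 h4
    rw [e1, e2, ← hb (i - 1) p h1 (by linarith) h3 (by linarith) ρ]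
    ring
  · -- the middle case
    have e3 : insK t P v i = t i := by unfold insK; rw [if_pos (by omega)]
    have e5 : insK t P v (i + (M + 1)) = t (i + M) := by
      unfold insK; rw [if_neg (by omega), if_neg (by omega)]; congr 1; ring
    rw [e3] at h2 h4
    rw [e5] at h3 h4
    have e1 : insA M t P v i = (v - t i) / (t (i + M) - t i) := by
      unfold insA; rw [if_neg (by omega), if_neg (by omega)]
    have m1 : t (i + M) ≤ t (i + (M + 1)) := ht (by omega)
    have m2 : t (i - 1) ≤ t i := ht (by omega)
    have e6 : i - 1 + ((M : ℤ) + 1) = i + M := by ring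
    have v1 := hb i p h1 h2 (by linarith) (by linarith) ρ
    have v2 := hb (i - 1) p h1 (by linarith) (by rw [e6]; exact h3) (by rw [e6]; linarith) ρ
    obtain ⟨m, rfl⟩ : ∃ m, M = m + 1 := ⟨M - 1, by omega⟩
    set rest := (List.range m).map fun u : ℕ => t (i + 1 + u) with hrest
    have w1 : (Win (m + 1) t i).Perm (t (i + ((m + 1 : ℕ) : ℤ)) :: rest) := by
      unfold Win
      rw [List.range_succ, List.map_append]
      have : i + ((m + 1 : ℕ) : ℤ) = i + 1 + m := by push_cast; ring
      rw [this]
      exact List.perm_append_singleton _ _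
    have w2 : (Win (m + 1) t (i - 1)).Perm (t i :: rest) := by
      unfold Win
      rw [List.range_succ_eq_map, List.map_cons, List.map_map]
      have a1 : i - 1 + 1 + ((0 : ℕ) : ℤ) = i := by simp
      have a2 : ((fun u : ℕ => t (i - 1 + 1 + u)) ∘ Nat.succ) = fun u : ℕ => t (i + 1 + u) := by
        funext u
        simp only [Function.comp]
        congr 1
        push_cast
        ring
      rw [a1, a2]
    have w3 : (Win (m + 1) (insK t P v) i).Perm (v :: rest) := by
      obtain ⟨c, hc'⟩ := Int.eq_ofNat_of_zero_le (show 0 ≤ P - (i + 1) by omega)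
      refine List.Perm.trans (List.Perm.of_eq ?_)
        (range_ins (fun u : ℕ => t (i + 1 + u)) v c m (by omega))
      unfold Win
      apply List.map_congr_left
      intro u hu
      unfold insK
      by_cases q1 : u < c
      · rw [if_pos q1, if_pos (by omega)]
      · by_cases q2 : u = c
        · rw [if_neg q1, if_neg (by omega), if_pos q2, if_pos (by omega)]
        · rw [if_neg q1, if_neg (by omega), if_neg q2, if_neg (by omega)]
          congr 1
          omega
    rw [Bl_perm τ hτ p h1 w1] at v1
    rw [Bl_perm τ hτ p h1 w2] at v2
    rw [Bl_perm τ hτ p h1 w3, v1, v2, e1]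
    set h := (v - t i) / (t (i + ((m + 1 : ℕ) : ℤ)) - t i) with hh
    have hv : v = (1 - h) * t i + h * t (i + ((m + 1 : ℕ) : ℤ)) := by
      have : t (i + ((m + 1 : ℕ) : ℤ)) - t i ≠ 0 := by linarith
      rw [hh]
      field_simp
      ring
    conv_rhs => rw [hv]
    rw [Bl_affine]
    ring

/-! ### Inserting all the knots -/

def offs (m S : ℕ) : ℤ := max (-(m : ℤ)) ((S : ℤ) - 2 * m)

def St {r : ℕ} {μ : Fin r → ℕ} (τ : ℤ → ℝ) (m : ℕ) (x : Fin r → ℝ)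
    (K : ((j : Fin r) × Fin (μ j)) → ℤ) (S : Fin r → ℕ) : Prop :=
  ∃ (t : ℤ → ℝ) (b : ℤ → ((j : Fin r) × Fin (μ j)) → ℝ) (F : Fin r → ℤ),
    Monotone t ∧ Valid τ (2 * m - 1) K t b ∧ TPK K b ∧ (∀ j, t (F j - 1) < x j) ∧
    (∀ j, ∀ i : ℕ, i < S j → t (F j + i) = x j) ∧ (∀ j, x j < t (F j + S j)) ∧
    0 < Matrix.det (Matrix.of fun ρ : (j : Fin r) × Fin (μ j) =>
      b (F ρ.1 + offs m (S ρ.1) + ρ.2.1))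

lemma St_step {r : ℕ} {μ : Fin r → ℕ} (τ : ℤ → ℝ) (hτ : Monotone τ) (m : ℕ) (hm : 2 ≤ m)
    (x : Fin r → ℝ) (hx : StrictMono x) (K : ((j : Fin r) × Fin (μ j)) → ℤ)
    (hK : ∀ ρ ρ', K ρ < K ρ' → ρ.1 < ρ'.1 ∨ (ρ.1 = ρ'.1 ∧ ρ.2.1 < ρ'.2.1))
    (hμ1 : ∀ j, 1 ≤ μ j) (hμm : ∀ j, μ j < m)
    (S : Fin r → ℕ) (hS1 : ∀ j, μ j ≤ S j) (hS2 : ∀ j, S j ≤ 2 * m - 1) (j0 : Fin r)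
    (hj0 : S j0 < 2 * m - 1) (h : St τ m x K S) :
    St τ m x K (Function.update S j0 (S j0 + 1)) := by
  obtain ⟨t, b, F, ht, hV, hTP, hF1, hF2, hF3, hdet⟩ := h
  have hF0 : ∀ j, t (F j) = x j := by
    intro j
    have := hF2 j 0 (by have := hS1 j; have := hμ1 j; omega)
    simpa using this
  have v1 : t (F j0 - 1) ≤ x j0 := (hF1 j0).le
  have v2 : x j0 ≤ t (F j0) := (hF0 j0).ge
  have ht' := insK_mono t ht (F j0) (x j0) v1 v2
  have hgt : ∀ j j', j < j' → F j + S j ≤ F j' := by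
    intro j j' hj
    have a1 := hx hj
    have a2 := hF2 j (S j - 1) (by have := hS1 j; have := hμ1 j; omega)
    rw [← a2, ← hF0 j'] at a1
    have := ht.reflect_lt a1
    have := hS1 j; have := hμ1 j
    omega
  have Sne : ∀ j, j ≠ j0 → Function.update S j0 (S j0 + 1) j = S j := fun j hj => by
    rw [Function.update_of_ne hj]
  have Seq : Function.update S j0 (S j0 + 1) j0 = S j0 + 1 := by simp
  set S' := Function.update S j0 (S j0 + 1) with hS'
  set F' : Fin r → ℤ := fun j => if j0 < j then F j + 1 else F j with hF'
  set t' := insK t (F j0) (x j0) with htt'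
  have g1 : ∀ j, t' (F' j - 1) < x j := by
    intro j
    rcases lt_trichotomy j j0 with hj | hj | hj
    · have : F' j = F j := by simp only [hF']; rw [if_neg (by exact not_lt.2 hj.le)]
      have q := hgt j j0 hj
      rw [this, htt']; unfold insK
      rw [if_pos (by omega)]; exact hF1 j
    · subst hj
      have : F' j = F j := by simp only [hF']; rw [if_neg (lt_irrefl _)]
      rw [this, htt']; unfold insK
      rw [if_pos (by omega)]; exact hF1 j
    · have : F' j = F j + 1 := by simp only [hF']; rw [if_pos hj]
      have q := hgt j0 j hj
      have := hS1 j0; have := hμ1 j0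
      have e : F' j - 1 - 1 = F j - 1 := by omega
      rw [htt']; unfold insK
      rw [if_neg (by omega), if_neg (by omega), e]; exact hF1 j
  have g2 : ∀ j, ∀ i : ℕ, i < S' j → t' (F' j + i) = x j := by
    intro j i hi
    rcases lt_trichotomy j j0 with hj | hj | hj
    · have : F' j = F j := by simp only [hF']; rw [if_neg (by exact not_lt.2 hj.le)]
      have q := hgt j j0 hj
      rw [Sne j hj.ne] at hi
      rw [this, htt']; unfold insK
      rw [if_pos (by omega)]; exact hF2 j i hi
    · subst hj
      have : F' j = F j := by simp only [hF']; rw [if_neg (lt_irrefl _)]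
      rw [Seq] at hi
      rw [this, htt']; unfold insK
      rw [if_neg (by omega)]
      by_cases h0 : i = 0
      · rw [if_pos (by omega)]
      · rw [if_neg (by omega)]
        have e : F j + (i : ℤ) - 1 = F j + ((i - 1 : ℕ) : ℤ) := by omega
        rw [e]; exact hF2 j _ (by omega)
    · have : F' j = F j + 1 := by simp only [hF']; rw [if_pos hj]
      have q := hgt j0 j hj
      have := hS1 j0; have := hμ1 j0
      rw [Sne j hj.ne'] at hi
      have e : F' j + (i : ℤ) - 1 = F j + i := by omega
      rw [htt']; unfold insK
      rw [if_neg (by omega), if_neg (by omega), e]; exact hF2 j i hi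
  have g3 : ∀ j, x j < t' (F' j + S' j) := by
    intro j
    rcases lt_trichotomy j j0 with hj | hj | hj
    · have : F' j = F j := by simp only [hF']; rw [if_neg (by exact not_lt.2 hj.le)]
      have q := hgt j j0 hj
      rw [Sne j hj.ne, this, htt']; unfold insK
      by_cases h0 : F j + (S j : ℤ) < F j0
      · rw [if_pos h0]; exact hF3 j
      · rw [if_neg h0, if_pos (by omega)]; exact hx hj
    · subst hj
      have : F' j = F j := by simp only [hF']; rw [if_neg (lt_irrefl _)]
      rw [Seq, this, htt']; unfold insK
      have e : F j + ((S j + 1 : ℕ) : ℤ) - 1 = F j + S j := by push_cast; ring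
      rw [if_neg (by omega), if_neg (by omega), e]; exact hF3 j
    · have : F' j = F j + 1 := by simp only [hF']; rw [if_pos hj]
      have q := hgt j0 j hj
      have := hS1 j0; have := hμ1 j0
      rw [Sne j hj.ne']
      have e : F' j + (S j : ℤ) - 1 = F j + S j := by omega
      rw [htt']; unfold insK
      rw [if_neg (by omega), if_neg (by omega), e]; exact hF3 j
  have hS1' : ∀ j, μ j ≤ S' j := by
    intro j
    by_cases hj : j = j0
    · subst hj; rw [Seq]; have := hS1 j; omega
    · rw [Sne j hj]; exact hS1 j
  have hgt' : ∀ j j', j < j' → F' j + S' j ≤ F' j' := by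
    intro j j' hj
    have a1 := hx hj
    have a0 := hS1' j; have a00 := hμ1 j
    have a2 := g2 j (S' j - 1) (by omega)
    have a3 := g2 j' 0 (by have := hS1' j'; have := hμ1 j'; omega)
    rw [← a2, ← a3] at a1
    have := ht'.reflect_lt a1
    omega
  refine ⟨t', stepRow (insA (2 * m - 1) t (F j0) (x j0)) b, F', ht',
    Valid_step τ hτ _ (by omega) K t ht b hV _ _ v1 v2,
    TPK_step K b hTP _ (insA_nonneg _ t ht _ _ v1) (insA_le_one _ t ht _ _ v2), g1, g2, g3, ?_⟩
  refine det_pos_step K b hTP _ (insA_nonneg _ t ht _ _ v1) (insA_le_one _ t ht _ _ v2)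
    (fun ρ => F ρ.1 + offs m (S ρ.1) + ρ.2.1) (fun ρ => F' ρ.1 + offs m (S' ρ.1) + ρ.2.1) ?_ hdet ?_
  · intro ρ ρ' hρ
    rcases hK ρ ρ' hρ with h | ⟨h, h'⟩
    · have q := hgt' _ _ h
      have q1 := hS1' ρ.1
      have q2 := hμm ρ.1
      have q3 := ρ.2.2
      dsimp only
      unfold offs
      omega
    · have k1 : F' ρ.1 = F' ρ'.1 := congrArg F' h
      have k2 : offs m (S' ρ.1) = offs m (S' ρ'.1) := congrArg (fun j => offs m (S' j)) h
      dsimp only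
      omega
  · intro ρ
    have q1 := hS1 ρ.1
    have q2 := hμm ρ.1
    have q3 := ρ.2.2
    have q4 := hS2 ρ.1
    rcases lt_trichotomy ρ.1 j0 with hj | hj | hj
    · have e : F' ρ.1 = F ρ.1 := by simp only [hF']; rw [if_neg (by exact not_lt.2 hj.le)]
      left
      rw [Sne _ hj.ne, e]
      refine ⟨rfl, insA_pos _ t ht _ _ v2 _ ?_⟩
      refine lt_of_le_of_lt ?_ (hx hj)
      rw [← hF0]
      have : 0 ≤ S ρ.1 := by omega
      have e2 := hF2 ρ.1 (ρ.2.1) (by omega)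
      rw [hF0, ← e2]
      apply ht
      unfold offs
      omega
    · have e : F' ρ.1 = F ρ.1 := by simp only [hF', hj]; rw [if_neg (lt_irrefl _)]
      rw [← hj] at Seq hj0 v1 v2
      rw [e, Seq, ← hj]
      by_cases hc : S ρ.1 < m
      · left
        refine ⟨by unfold offs; omega, insA_pos _ t ht _ _ v2 _ ?_⟩
        refine lt_of_le_of_lt (ht ?_) (hF1 ρ.1)
        unfold offs
        omega
      · right
        refine ⟨by unfold offs; omega, insA_lt_one _ t ht _ _ v1 _ ?_⟩
        refine lt_of_lt_of_le (hF3 ρ.1) (ht ?_)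
        unfold offs
        omega
    · have e : F' ρ.1 = F ρ.1 + 1 := by simp only [hF']; rw [if_pos hj]
      right
      rw [Sne _ hj.ne', e]
      refine ⟨by ring, insA_lt_one _ t ht _ _ v1 _ ?_⟩
      refine lt_of_lt_of_le (hx hj) ?_
      rw [← hF0]
      apply ht
      unfold offs
      omega

lemma St_final {r : ℕ} {μ : Fin r → ℕ} (τ : ℤ → ℝ) (hτ : Monotone τ) (m : ℕ) (hm : 2 ≤ m)
    (x : Fin r → ℝ) (hx : StrictMono x) (K : ((j : Fin r) × Fin (μ j)) → ℤ)
    (hK : ∀ ρ ρ', K ρ < K ρ' → ρ.1 < ρ'.1 ∨ (ρ.1 = ρ'.1 ∧ ρ.2.1 < ρ'.2.1))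
    (hμ1 : ∀ j, 1 ≤ μ j) (hμm : ∀ j, μ j < m) (d : ℕ) :
    ∀ (S : Fin r → ℕ), (∀ j, μ j ≤ S j) → (∀ j, S j ≤ 2 * m - 1) →
    ∑ j, (2 * m - 1 - S j) = d → St τ m x K S → St τ m x K (fun _ => 2 * m - 1) := by
  induction d with
  | zero =>
    intro S _ h2 h3 h
    rw [Finset.sum_eq_zero_iff] at h3
    have : S = fun _ => 2 * m - 1 := by
      funext j
      have := h3 j (Finset.mem_univ _)
      have := h2 j
      omega
    rwa [this] at h
  | succ d ih =>
    intro S h1 h2 h3 h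
    have : ∃ j0, S j0 < 2 * m - 1 := by
      by_contra hc
      push Not at hc
      have : ∑ j, (2 * m - 1 - S j) = 0 := by
        apply Finset.sum_eq_zero
        intro j _
        have := hc j
        omega
      omega
    obtain ⟨j0, hj0⟩ := this
    have step := St_step τ hτ m hm x hx K hK hμ1 hμm S h1 h2 j0 hj0 h
    refine ih _ ?_ ?_ ?_ step
    · intro j
      by_cases hj : j = j0
      · subst hj; have := h1 j; simp; omega
      · rw [Function.update_of_ne hj]; exact h1 j
    · intro j
      by_cases hj : j = j0
      · subst hj; simp; omega
      · rw [Function.update_of_ne hj]; exact h2 j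
    · rw [← Finset.add_sum_erase _ _ (Finset.mem_univ j0)] at h3 ⊢
      have : ∑ j ∈ Finset.univ.erase j0, (2 * m - 1 - Function.update S j0 (S j0 + 1) j)
          = ∑ j ∈ Finset.univ.erase j0, (2 * m - 1 - S j) := by
        apply Finset.sum_congr rfl
        intro j hj
        rw [Function.update_of_ne (Finset.ne_of_mem_erase hj)]
      rw [this]
      simp
      omega

/-! ### Polynomial pieces -/

noncomputable def bb (τ : ℤ → ℝ) (p : ℤ) (M : ℕ) (x : ℝ) (k : ℤ) (i : ℕ) : ℝ :=
  Bl τ p (List.replicate i (x + 1) ++ List.replicate (M - i) x) k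

noncomputable def linP (x z : ℝ) : Polynomial ℝ :=
  Polynomial.C (z - x) * Polynomial.X + Polynomial.C (1 - (z - x))

lemma Bl_expand (τ : ℤ → ℝ) (hτ : Monotone τ) (p : ℤ) (hp : τ p < τ (p + 1)) (M : ℕ) (x : ℝ) (k : ℤ)
    (L : List ℝ) : ∀ w v : ℕ, L.length + w + v = M →
    Bl τ p (L ++ (List.replicate w (x + 1) ++ List.replicate v x)) k =
      ∑ i ∈ Finset.range (M + 1),
        ((L.map (linP x)).prod * Polynomial.X ^ w).coeff i * bb τ p M x k i := by
  induction L with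
  | nil =>
    intro w v hM
    simp only [List.length_nil] at hM
    simp only [List.map_nil, List.prod_nil, one_mul, Polynomial.coeff_X_pow, ite_mul, zero_mul,
      List.nil_append]
    rw [Finset.sum_ite_eq' , if_pos (by simp; omega)]
    unfold bb
    have : M - w = v := by omega
    rw [this]
  | cons z L ih =>
    intro w v hM
    simp only [List.length_cons] at hM
    have hz : z = (1 - (z - x)) * x + (z - x) * (x + 1) := by ring
    have h1 := ih w (v + 1) (by omega)
    have h2 := ih (w + 1) v (by omega)
    have p1 : (x :: (L ++ (List.replicate w (x + 1) ++ List.replicate v x))).Perm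
        (L ++ (List.replicate w (x + 1) ++ List.replicate (v + 1) x)) := by
      rw [List.replicate_succ]
      rw [← List.append_assoc, ← List.append_assoc]
      exact List.perm_middle.symm
    have p2 : ((x + 1) :: (L ++ (List.replicate w (x + 1) ++ List.replicate v x))).Perm
        (L ++ (List.replicate (w + 1) (x + 1) ++ List.replicate v x)) := by
      rw [List.replicate_succ]
      exact List.perm_middle.symm
    rw [List.cons_append]
    conv_lhs => rw [hz]
    rw [Bl_affine, Bl_perm τ hτ p hp p1, Bl_perm τ hτ p hp p2, h1, h2, Finset.mul_sum,
      Finset.mul_sum, ← Finset.sum_add_distrib]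
    apply Finset.sum_congr rfl
    intro i _
    have : ((z :: L).map (linP x)).prod * Polynomial.X ^ w
        = Polynomial.C (1 - (z - x)) * ((L.map (linP x)).prod * Polynomial.X ^ w)
        + Polynomial.C (z - x) * ((L.map (linP x)).prod * Polynomial.X ^ (w + 1)) := by
      rw [List.map_cons, List.prod_cons]
      unfold linP
      ring
    rw [this, Polynomial.coeff_add, Polynomial.coeff_C_mul, Polynomial.coeff_C_mul]
    ring

lemma tri_coeff (x : ℝ) (L : List ℝ) (hL : ∀ z ∈ L, x < z) :
    0 < ((L.map (linP x)).prod).coeff L.length ∧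
    ∀ i, L.length < i → ((L.map (linP x)).prod).coeff i = 0 := by
  have hd : ∀ P ∈ L.map (linP x), P.natDegree ≤ 1 := by
    intro P hP
    obtain ⟨z, _, rfl⟩ := List.mem_map.1 hP
    exact Polynomial.natDegree_linear_le
  constructor
  · have := Polynomial.coeff_list_prod_of_natDegree_le _ 1 hd
    rw [List.length_map, mul_one] at this
    rw [this]
    apply List.prod_pos
    intro c hc
    rw [List.map_map] at hc
    obtain ⟨z, hz, rfl⟩ := List.mem_map.1 hc
    have := hL z hz
    simp [linP, Polynomial.coeff_one, Polynomial.coeff_C]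
    exact this
  · intro i hi
    apply Polynomial.coeff_eq_zero_of_natDegree_lt
    refine lt_of_le_of_lt (Polynomial.natDegree_list_prod_le _) (lt_of_le_of_lt ?_ hi)
    refine (List.sum_le_card_nsmul _ 1 ?_).trans ?_
    · intro c hc
      obtain ⟨P, hP, rfl⟩ := List.mem_map.1 hc
      exact hd P hP
    · simp

/-- rows at windows `zs ++ x^(M-ν)` are triangular combinations of the `bb`'s -/
lemma tri_rows (τ : ℤ → ℝ) (hτ : Monotone τ) (p : ℤ) (hp : τ p < τ (p + 1)) (M : ℕ) (x : ℝ)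
    (L : List ℝ) (hL : ∀ z ∈ L, x < z) (hLM : L.length ≤ M) :
    ∃ c : ℕ → ℝ, 0 < c L.length ∧ ∀ k, Bl τ p (L ++ List.replicate (M - L.length) x) k =
      ∑ i ∈ Finset.range (L.length + 1), c i * bb τ p M x k i := by
  obtain ⟨h1, h2⟩ := tri_coeff x L hL
  refine ⟨fun i => ((L.map (linP x)).prod).coeff i, h1, ?_⟩
  intro k
  have := Bl_expand τ hτ p hp M x k L 0 (M - L.length) (by omega)
  simp only [List.replicate_zero, List.nil_append, pow_zero, mul_one] at this
  rw [this]
  symm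
  apply Finset.sum_subset
  · intro i; simp only [Finset.mem_range]; omega
  · intro i _ hi
    dsimp only
    rw [h2 i (by simpa using hi), zero_mul]

noncomputable def pieceP (τ : ℤ → ℝ) (p : ℤ) (M : ℕ) (x : ℝ) (k : ℤ) : Polynomial ℝ :=
  ∑ i ∈ Finset.range (M + 1), Polynomial.C (bb τ p M x k i) * bernsteinPolynomial ℝ M i

lemma pieceP_eval (τ : ℤ → ℝ) (hτ : Monotone τ) (p : ℤ) (hp : τ p < τ (p + 1)) (M : ℕ) (x : ℝ)
    (k : ℤ) (z : ℝ) :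
    Bl τ p (List.replicate M z) k = (pieceP τ p M x k).eval (z - x) := by
  have := Bl_expand τ hτ p hp M x k (List.replicate M z) 0 0 (by simp)
  simp only [List.replicate_zero, List.append_nil, pow_zero, mul_one, List.map_replicate,
    List.prod_replicate] at this
  rw [this]
  unfold pieceP
  rw [Polynomial.eval_finsetSum]
  apply Finset.sum_congr rfl
  intro i hi
  have hi' : i < M + 1 := Finset.mem_range.1 hi
  rw [Polynomial.eval_mul, Polynomial.eval_C, mul_comm]
  congr 1
  unfold linP bernsteinPolynomial
  rw [add_pow, Polynomial.finsetSum_coeff]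
  rw [Finset.sum_eq_single i]
  · have : (Polynomial.C (z - x) * Polynomial.X) ^ i * Polynomial.C (1 - (z - x)) ^ (M - i)
        * ((M.choose i : ℕ) : Polynomial ℝ)
        = Polynomial.C ((z - x) ^ i * (1 - (z - x)) ^ (M - i) * (M.choose i : ℝ)) * Polynomial.X ^ i := by
      simp only [map_mul, map_pow, map_natCast]
      ring
    rw [this, Polynomial.coeff_C_mul, Polynomial.coeff_X_pow]
    simp
    ring
  · intro j _ hj
    have : (Polynomial.C (z - x) * Polynomial.X) ^ j * Polynomial.C (1 - (z - x)) ^ (M - j)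
        * ((M.choose j : ℕ) : Polynomial ℝ)
        = Polynomial.C ((z - x) ^ j * (1 - (z - x)) ^ (M - j) * (M.choose j : ℝ)) * Polynomial.X ^ j := by
      simp only [map_mul, map_pow, map_natCast]
      ring
    rw [this, Polynomial.coeff_C_mul, Polynomial.coeff_X_pow, if_neg (by omega), mul_zero]
  · intro h; exact absurd hi h

noncomputable def cB (M ν i : ℕ) : ℝ :=
  ((⇑Polynomial.derivative)^[ν] (bernsteinPolynomial ℝ M i)).eval 0

lemma cB_pos (M ν : ℕ) (h : ν ≤ M) : 0 < cB M ν ν := by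
  unfold cB
  rw [bernsteinPolynomial.iterate_derivative_at_0]
  rcases Nat.eq_zero_or_pos ν with h0 | h0
  · subst h0; simp
  · apply ascPochhammer_pos
    have : 0 < M - (ν - 1) := by omega
    exact_mod_cast this

lemma pieceP_deriv (τ : ℤ → ℝ) (p : ℤ) (M : ℕ) (x : ℝ) (k : ℤ) (ν : ℕ) (hν : ν ≤ M) :
    ((⇑Polynomial.derivative)^[ν] (pieceP τ p M x k)).eval 0 =
      ∑ i ∈ Finset.range (ν + 1), cB M ν i * bb τ p M x k i := by
  unfold pieceP
  rw [Polynomial.iterate_derivative_sum, Polynomial.eval_finsetSum]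
  symm
  have : ∀ i, ((⇑Polynomial.derivative)^[ν] (Polynomial.C (bb τ p M x k i) *
      bernsteinPolynomial ℝ M i)).eval 0 = cB M ν i * bb τ p M x k i := by
    intro i
    rw [Polynomial.iterate_derivative_C_mul, Polynomial.eval_mul, Polynomial.eval_C, mul_comm]
    rfl
  simp only [this]
  apply Finset.sum_subset
  · intro i; simp only [Finset.mem_range]; omega
  · intro i _ hi
    have : cB M ν i = 0 := by
      unfold cB
      apply bernsteinPolynomial.iterate_derivative_at_0_eq_zero_of_lt
      simp at hi; omega
    rw [this, zero_mul]

lemma piecewise_deriv (ν : ℕ) : ∀ (f : ℝ → ℝ) (Ql Qr : Polynomial ℝ) (x l u : ℝ), l < x → x < u →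
    (∀ z, x ≤ z → z < u → f z = Qr.eval (z - x)) → (∀ z, l < z → z < x → f z = Ql.eval (z - x)) →
    (∀ i ≤ ν, ((⇑Polynomial.derivative)^[i] Ql).eval 0 = ((⇑Polynomial.derivative)^[i] Qr).eval 0) →
    iteratedDeriv ν f x = ((⇑Polynomial.derivative)^[ν] Qr).eval 0 := by
  induction ν with
  | zero =>
    intro f Ql Qr x l u hl hu hr _ _
    simp [hr x le_rfl hu]
  | succ ν ih =>
    intro f Ql Qr x l u hl hu hfr hfl h
    rw [iteratedDeriv_succ', Function.iterate_succ_apply]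
    have hd : ∀ (Q : Polynomial ℝ) (z : ℝ), HasDerivAt (fun z => Q.eval (z - x)) ((Polynomial.derivative Q).eval (z - x)) z := by
      intro Q z
      exact HasDerivAt.comp_sub_const z x (Q.hasDerivAt (z - x))
    have h0 := h 0 (by omega)
    have h1 := h 1 (by omega)
    simp only [Function.iterate_zero, id, Function.iterate_one] at h0 h1
    refine ih (deriv f) (Polynomial.derivative Ql) (Polynomial.derivative Qr) x l u hl hu ?_ ?_ ?_
    · intro z hz1 hz2
      rcases hz1.eq_or_lt with hz | hz
      · subst hz
        apply HasDerivAt.deriv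
        have A : HasDerivWithinAt f ((Polynomial.derivative Qr).eval (x - x)) (Set.Ici x) x := by
          refine ((hd Qr x).hasDerivWithinAt (s := Set.Ici x)).congr_of_eventuallyEq ?_ (hfr x le_rfl hz2)
          filter_upwards [self_mem_nhdsWithin, mem_nhdsWithin_of_mem_nhds (Iio_mem_nhds hz2)] with w hw1 hw2
          exact hfr w hw1 hw2
        have B : HasDerivWithinAt f ((Polynomial.derivative Qr).eval (x - x)) (Set.Iic x) x := by
          have e : (Polynomial.derivative Qr).eval (x - x) = (Polynomial.derivative Ql).eval (x - x) := by
            rw [sub_self, h1]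
          rw [e]
          have ex : f x = Ql.eval (x - x) := by
            rw [hfr x le_rfl hz2, sub_self, h0]
          refine ((hd Ql x).hasDerivWithinAt (s := Set.Iic x)).congr_of_eventuallyEq ?_ ex
          filter_upwards [self_mem_nhdsWithin, mem_nhdsWithin_of_mem_nhds (Ioi_mem_nhds hl)] with w hw1 hw2
          rcases (show w ≤ x from hw1).eq_or_lt with hw | hw
          · rw [hw]; exact ex
          · exact hfl w hw2 hw
        have := B.union A
        rw [Set.Iic_union_Ici] at this
        exact hasDerivWithinAt_univ.1 this
      · apply HasDerivAt.deriv
        refine (hd Qr z).congr_of_eventuallyEq ?_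
        filter_upwards [Ioo_mem_nhds hz hz2] with w hw
        exact hfr w hw.1.le hw.2
    · intro z hz1 hz2
      apply HasDerivAt.deriv
      refine (hd Ql z).congr_of_eventuallyEq ?_
      filter_upwards [Ioo_mem_nhds hz1 hz2] with w hw
      exact hfl w hw.1 hw.2
    · intro i hi
      have := h (i + 1) (by omega)
      rwa [Function.iterate_succ_apply, Function.iterate_succ_apply] at this

lemma det_tri {r : ℕ} {μ : Fin r → ℕ} (K : ((j : Fin r) × Fin (μ j)) → ℤ)
    (hKi : Function.Injective K)
    (hK : ∀ ρ ρ', K ρ < K ρ' → ρ.1 < ρ'.1 ∨ (ρ.1 = ρ'.1 ∧ ρ.2.1 < ρ'.2.1))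
    (A : Matrix ((j : Fin r) × Fin (μ j)) ((j : Fin r) × Fin (μ j)) ℝ)
    (b : Fin r → ℕ → ((j : Fin r) × Fin (μ j)) → ℝ)
    (c : ((j : Fin r) × Fin (μ j)) → ℕ → ℝ) (hc : ∀ ρ, 0 < c ρ ρ.2.1)
    (hA : ∀ ρ κ, A ρ κ = ∑ i ∈ Finset.range (ρ.2.1 + 1), c ρ i * b ρ.1 i κ) :
    ∃ D : ℝ, 0 < D ∧ A.det = D * Matrix.det (Matrix.of fun ρ κ => b ρ.1 ρ.2.1 κ) := by
  classical
  let L : Matrix ((j : Fin r) × Fin (μ j)) ((j : Fin r) × Fin (μ j)) ℝ :=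
    Matrix.of fun ρ σ => if ρ.1 = σ.1 ∧ σ.2.1 ≤ ρ.2.1 then c ρ σ.2.1 else 0
  have hL : L.det = ∏ ρ, L ρ ρ := by
    have : ∀ {ι : Type} [Fintype ι] [DecidableEq ι] (K : ι → ℤ) (_ : Function.Injective K)
        (L : Matrix ι ι ℝ) (_ : ∀ ρ ρ', K ρ < K ρ' → L ρ ρ' = 0), L.det = ∏ ρ, L ρ ρ := by
      intro ι _ _ K hK L hL
      let _ : LinearOrder ι := LinearOrder.lift' K hK
      apply Matrix.det_of_isLowerTriangular
      intro i j hij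
      exact hL i j hij
    apply this K hKi
    intro ρ ρ' h
    simp only [L, Matrix.of_apply]
    rw [if_neg]
    rintro ⟨h1, h2⟩
    rcases hK ρ ρ' h with h3 | h3
    · exact absurd h1 h3.ne
    · omega
  have hmul : A = L * Matrix.of fun ρ κ => b ρ.1 ρ.2.1 κ := by
    ext ρ κ
    rw [hA, Matrix.mul_apply, Fintype.sum_sigma, Finset.sum_eq_single ρ.1]
    · simp only [L, Matrix.of_apply, true_and, ite_mul, zero_mul]
      rw [Fin.sum_univ_eq_sum_range (fun i => if i ≤ ρ.2.1 then c ρ i * b ρ.1 i κ else 0) (μ ρ.1),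
        ← Finset.sum_filter]
      apply Finset.sum_congr _ (fun _ _ => rfl)
      ext i
      have := ρ.2.2
      simp only [Finset.mem_range, Finset.mem_filter]
      omega
    · intro j _ hj
      apply Finset.sum_eq_zero
      intro i _
      simp only [L, Matrix.of_apply]
      rw [if_neg, zero_mul]
      exact fun h => hj h.1.symm
    · intro h; exact absurd (Finset.mem_univ _) h
  refine ⟨L.det, ?_, ?_⟩
  · rw [hL]
    apply Finset.prod_pos
    intro ρ _
    simp only [L, Matrix.of_apply, le_refl, and_self, if_true]
    exact hc ρ
  · conv_lhs => rw [hmul]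
    exact Matrix.det_mul _ _

/-! ### Link with `Nspl` -/

lemma Nspl_eq_s5 (θ : ℕ → ℝ) (τ : ℤ → ℝ) (hτ : Monotone τ) (N : ℕ)
    (hag : ∀ k : ℕ, 1 ≤ k → k ≤ N → τ k = θ k) (p : ℤ) (z : ℝ) (h1 : τ p ≤ z) (h2 : z < τ (p + 1))
    (j : ℕ) : ∀ k : ℕ, 1 ≤ k → k + j + 1 ≤ N →
    Nspl θ (j + 1) k z = Bl τ p (List.replicate j z) k := by
  induction j with
  | zero =>
    intro k hk1 hk2
    simp only [Nspl, List.replicate_zero, Bl]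
    have e1 := hag k hk1 (by omega)
    have e2 := hag (k + 1) (by omega) (by omega)
    push_cast at e2
    rw [← e1, ← e2]
    by_cases hk : (k : ℤ) = p
    · rw [if_pos hk, if_pos]; rw [hk]; exact ⟨h1, h2⟩
    · rw [if_neg hk, if_neg]
      rintro ⟨h3, h4⟩
      have := hτ.reflect_lt (lt_of_le_of_lt h3 h2)
      have := hτ.reflect_lt (lt_of_le_of_lt h1 h4)
      omega
  | succ j ih =>
    intro k hk1 hk2
    have hom : ∀ k : ℕ, 1 ≤ k → k + (j + 1) ≤ N → omegaB θ (j + 1) k z = omz τ (j + 1) k z := by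
      intro k hk1 hk2
      have e1 := hag k hk1 (by omega)
      have e2 := hag (k + (j + 1)) (by omega) (by omega)
      have m : τ k ≤ τ ((k + (j + 1) : ℕ) : ℤ) := hτ (by omega)
      unfold omegaB omz
      have e3 : (k : ℤ) + ((j + 1 : ℕ) : ℤ) = ((k + (j + 1) : ℕ) : ℤ) := by push_cast; ring
      rw [e3, ← e1, ← e2]
      split_ifs with h
      · rfl
      · have : τ ((k + (j + 1) : ℕ) : ℤ) - τ k = 0 := by linarith
        rw [this, div_zero]
    have e : Nspl θ (j + 1 + 1) k z = omegaB θ (j + 1) k z * Nspl θ (j + 1) k z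
        + (1 - omegaB θ (j + 1) (k + 1) z) * Nspl θ (j + 1) (k + 1) z := by
      rw [Nspl]
    rw [e, List.replicate_succ, Bl_cons, List.length_replicate, ih k hk1 (by omega),
      ih (k + 1) (by omega) (by omega), hom k hk1 (by omega), hom (k + 1) (by omega) (by omega)]
    push_cast
    rfl

noncomputable def extK (θ : ℕ → ℝ) (a b : ℝ) (N : ℕ) (i : ℤ) : ℝ :=
  if i < 1 then a + (i - 1) else if i ≤ N then θ i.toNat else b + (i - N)

lemma extK_eq (θ : ℕ → ℝ) (a b : ℝ) (N : ℕ) (k : ℕ) (h1 : 1 ≤ k) (h2 : k ≤ N) :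
    extK θ a b N k = θ k := by
  unfold extK
  rw [if_neg (by omega), if_pos (by omega)]
  simp

lemma extK_mono (θ : ℕ → ℝ) (a b : ℝ) (m n : ℕ) (hm : 2 ≤ m) (hθ : IsOpenKnot θ a b m n) :
    Monotone (extK θ a b (n + m)) := by
  apply monotone_int_of_le_succ
  intro i
  rcases lt_or_ge i 0 with h | h
  · unfold extK
    rw [if_pos (by omega), if_pos (by omega)]
    push_cast
    linarith
  obtain ⟨k, rfl⟩ := Int.eq_ofNat_of_zero_le h
  have e : (k : ℤ) + 1 = ((k + 1 : ℕ) : ℤ) := by push_cast; ring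
  rw [e]
  rcases Nat.eq_zero_or_pos k with h0 | h0
  · subst h0
    rw [extK_eq _ _ _ _ (0 + 1) (by omega) (by omega), hθ.left 1 (by omega) (by omega)]
    unfold extK
    simp
  rcases lt_trichotomy k (n + m) with h1 | h1 | h1
  · rw [extK_eq _ _ _ _ k (by omega) (by omega), extK_eq _ _ _ _ (k + 1) (by omega) (by omega)]
    exact hθ.mono k (by omega) h1
  · rw [extK_eq _ _ _ _ k (by omega) (by omega), hθ.right k (by omega) (by omega)]
    unfold extK
    rw [if_neg (by omega), if_neg (by omega)]
    subst h1
    push_cast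
    linarith
  · unfold extK
    rw [if_neg (by omega), if_neg (by omega), if_neg (by omega), if_neg (by omega)]
    push_cast
    linarith

lemma knot_facts (θ : ℕ → ℝ) (a b : ℝ) (m n : ℕ) (hm : 2 ≤ m) (hθ : IsOpenKnot θ a b m n) (ℓ : ℕ)
    (hmono : ∀ i k, 1 ≤ i → i ≤ k → k ≤ n + m → θ i ≤ θ k)
    (h1 : m + 1 ≤ ℓ) (h2 : ℓ ≤ n) (h3 : θ (ℓ - 1) < θ ℓ) :
    (∀ i, i < knotMult θ (n + m) ℓ → θ (ℓ + i) = θ ℓ) ∧ θ ℓ < θ (ℓ + knotMult θ (n + m) ℓ) ∧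
      ℓ + knotMult θ (n + m) ℓ ≤ n + 1 ∧ knotMult θ (n + m) ℓ < m := by
  have hs := hθ.intMult ℓ h1 h2
  have hb : θ ℓ < θ (n + 1) := by
    by_contra hc
    have : Finset.Icc (n + 1) (n + m) ⊆ (Finset.Icc 1 (n + m)).filter fun i => θ i = θ ℓ := by
      intro i hi
      rw [Finset.mem_Icc] at hi
      rw [Finset.mem_filter, Finset.mem_Icc]
      refine ⟨by omega, ?_⟩
      have q1 := hmono ℓ (n + 1) (by omega) (by omega) (by omega)
      rw [hθ.right i hi.1 hi.2, ← hθ.right (n + 1) (by omega) (by omega)]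
      linarith
    have := Finset.card_le_card this
    rw [Nat.card_Icc] at this
    unfold knotMult at hs
    omega
  classical
  have hex : ∃ e, ℓ < e ∧ θ ℓ < θ e := ⟨n + 1, by omega, hb⟩
  set e := Nat.find hex with he
  obtain ⟨he1, he2⟩ := Nat.find_spec hex
  rw [← he] at he1 he2
  have he3 : e ≤ n + 1 := Nat.find_min' hex ⟨by omega, hb⟩
  have he4 : ∀ i, ℓ ≤ i → i < e → θ i = θ ℓ := by
    intro i hi1 hi2
    rcases hi1.eq_or_lt with h | h
    · rw [h]
    · have := Nat.find_min hex hi2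
      push Not at this
      exact le_antisymm (this h) (hmono ℓ i (by omega) hi1 (by omega))
  have hset : ((Finset.Icc 1 (n + m)).filter fun i => θ i = θ ℓ) = Finset.Ico ℓ e := by
    ext i
    rw [Finset.mem_filter, Finset.mem_Icc, Finset.mem_Ico]
    constructor
    · rintro ⟨⟨q1, q2⟩, q3⟩
      constructor
      · by_contra hc
        have := hmono i (ℓ - 1) q1 (by omega) (by omega)
        linarith
      · by_contra hc
        have := hmono e i (by omega) (by omega) q2
        linarith
    · rintro ⟨q1, q2⟩
      exact ⟨by omega, he4 i q1 q2⟩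
  have hcard : knotMult θ (n + m) ℓ = e - ℓ := by
    unfold knotMult; rw [hset, Nat.card_Ico]
  rw [hcard] at hs ⊢
  refine ⟨fun i hi => he4 _ (by omega) (by omega), ?_, by omega, by omega⟩
  have : ℓ + (e - ℓ) = e := by omega
  rw [this]; exact he2

/-- The sets `K_j = {ℓ_j-m, …, ℓ_j-m+μ_j-1}` are subsets of `{1,…,n-m}` of
cardinality `μ_j`, pairwise disjoint, and the square submatrix `A₀` of `A` formed by the
columns indexed by their union `K` (with the natural order-preserving correspondence between
the row pairs `(j,ν)` and the columns `ℓ_j - m + ν` of `K`) has positive determinant. -/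
theorem stmt5 (a b : ℝ) (hab : a < b) (m n : ℕ) (hm : 2 ≤ m) (hmn : m ≤ n)
    (θ : ℕ → ℝ) (hθ : IsOpenKnot θ a b m n)
    (r : ℕ) (ℓ μ : Fin r → ℕ) (hmono : StrictMono ℓ)
    (hlb : ∀ j, m + 1 ≤ ℓ j) (hub : ∀ j, ℓ j ≤ n)
    (hfirst : ∀ j, θ (ℓ j - 1) < θ (ℓ j))
    (hμ1 : ∀ j, 1 ≤ μ j) (hμ2 : ∀ j, μ j ≤ knotMult θ (n + m) (ℓ j)) :
    (∀ j : Fin r, Finset.Ico (ℓ j - m) (ℓ j - m + μ j) ⊆ Finset.Icc 1 (n - m)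
        ∧ (Finset.Ico (ℓ j - m) (ℓ j - m + μ j)).card = μ j)
    ∧ (∀ j j' : Fin r, j ≠ j' →
        Disjoint (Finset.Ico (ℓ j - m) (ℓ j - m + μ j))
          (Finset.Ico (ℓ j' - m) (ℓ j' - m + μ j')))
    ∧ 0 < Matrix.det (Matrix.of fun p q : (j : Fin r) × Fin (μ j) =>
        if h : ℓ q.1 - m + q.2.1 - 1 < n - m then
          Amat θ m n r ℓ μ p ⟨ℓ q.1 - m + q.2.1 - 1, h⟩
        else 0) := by
  set τ := extK θ a b (n + m) with hτdef
  have hτ : Monotone τ := extK_mono θ a b m n hm hθ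
  have hag : ∀ k : ℕ, 1 ≤ k → k ≤ n + m → τ k = θ k := fun k h1 h2 => extK_eq θ a b (n + m) k h1 h2
  have hθm : ∀ i k, 1 ≤ i → i ≤ k → k ≤ n + m → θ i ≤ θ k := by
    intro i k h1 h2 h3
    rw [← hag i h1 (by omega), ← hag k (by omega) h3]
    exact hτ (by omega)
  set s : Fin r → ℕ := fun j => knotMult θ (n + m) (ℓ j) with hs
  have kf : ∀ j, (∀ i, i < s j → θ (ℓ j + i) = θ (ℓ j)) ∧ θ (ℓ j) < θ (ℓ j + s j) ∧
      ℓ j + s j ≤ n + 1 ∧ s j < m := fun j =>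
    knot_facts θ a b m n hm hθ (ℓ j) hθm (hlb j) (hub j) (hfirst j)
  have hμs : ∀ j, μ j ≤ s j := hμ2
  have hgap : ∀ j j', j < j' → ℓ j + s j ≤ ℓ j' := by
    intro j j' h
    have h1 := hmono h
    by_contra hc
    push Not at hc
    have e1 := (kf j).1 (ℓ j' - ℓ j) (by omega)
    have e2 := (kf j).1 (ℓ j' - 1 - ℓ j) (by omega)
    have e3 : ℓ j + (ℓ j' - ℓ j) = ℓ j' := by omega
    have e4 : ℓ j + (ℓ j' - 1 - ℓ j) = ℓ j' - 1 := by omega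
    rw [e3] at e1
    rw [e4] at e2
    have := hfirst j'
    linarith
  refine ⟨?_, ?_, ?_⟩
  · intro j
    have := kf j; have := hlb j; have := hμs j
    constructor
    · intro i hi
      rw [Finset.mem_Ico] at hi
      rw [Finset.mem_Icc]
      omega
    · rw [Nat.card_Ico]; omega
  · have key : ∀ j j' : Fin r, j < j' → Disjoint (Finset.Ico (ℓ j - m) (ℓ j - m + μ j))
          (Finset.Ico (ℓ j' - m) (ℓ j' - m + μ j')) := by
      intro j j' h
      rw [Finset.disjoint_left]
      intro i hi hi'
      rw [Finset.mem_Ico] at hi hi'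
      have := hgap j j' h; have := hlb j; have := hlb j'; have := hμs j
      omega
    intro j j' h
    rcases lt_or_gt_of_ne h with h | h
    · exact key _ _ h
    · exact (key _ _ h).symm
  -- the determinant
  set x : Fin r → ℝ := fun j => θ (ℓ j) with hx
  have hxm : StrictMono x := by
    intro j j' h
    have := hgap j j' h
    have h2 := (kf j).2.1
    have h3 := hθm (ℓ j + s j) (ℓ j') (by have := hlb j; omega) this (by have := hub j'; omega)
    exact lt_of_lt_of_le h2 h3
  set K : ((j : Fin r) × Fin (μ j)) → ℤ := fun ρ => (ℓ ρ.1 : ℤ) - m + ρ.2.1 with hKdef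
  have hK : ∀ ρ ρ', K ρ < K ρ' → ρ.1 < ρ'.1 ∨ (ρ.1 = ρ'.1 ∧ ρ.2.1 < ρ'.2.1) := by
    intro ρ ρ' h
    simp only [hKdef] at h
    rcases lt_trichotomy ρ.1 ρ'.1 with h1 | h1 | h1
    · exact Or.inl h1
    · right
      have : ℓ ρ.1 = ℓ ρ'.1 := congrArg ℓ h1
      exact ⟨h1, by omega⟩
    · exfalso
      have := hgap _ _ h1
      have := ρ'.2.2
      have := hμs ρ'.1
      omega
  have hKi : Function.Injective K := by
    intro ρ ρ' h
    simp only [hKdef] at h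
    rcases lt_trichotomy ρ.1 ρ'.1 with h1 | h1 | h1
    · exfalso
      have := hgap _ _ h1
      have := ρ.2.2
      have := hμs ρ.1
      omega
    · obtain ⟨j, i⟩ := ρ
      obtain ⟨j', i'⟩ := ρ'
      dsimp only at h1 h
      subst h1
      have : i = i' := by apply Fin.ext; omega
      rw [this]
    · exfalso
      have := hgap _ _ h1
      have := ρ'.2.2
      have := hμs ρ'.1
      omega
  have hμm : ∀ j, μ j < m := fun j => by have := kf j; have := hμs j; omega
  have t1 : ∀ j, τ ((ℓ j : ℤ) - 1) < x j := by
    intro j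
    have e : ((ℓ j : ℤ) - 1) = ((ℓ j - 1 : ℕ) : ℤ) := by have := hlb j; omega
    rw [e, hag _ (by have := hlb j; omega) (by have := hub j; omega)]
    exact hfirst j
  have t2 : ∀ j, ∀ i : ℕ, i < s j → τ ((ℓ j : ℤ) + i) = x j := by
    intro j i hi
    have e : ((ℓ j : ℤ) + i) = ((ℓ j + i : ℕ) : ℤ) := by push_cast; ring
    rw [e, hag _ (by have := hlb j; omega) (by have := kf j; omega)]
    exact (kf j).1 i hi
  have t3 : ∀ j, x j < τ ((ℓ j : ℤ) + s j) := by
    intro j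
    have e : ((ℓ j : ℤ) + s j) = ((ℓ j + s j : ℕ) : ℤ) := by push_cast; ring
    rw [e, hag _ (by have := hlb j; omega) (by have := kf j; omega)]
    exact (kf j).2.1
  have hst0 : St τ m x K s := by
    refine ⟨τ, fun i ρ => if K ρ = i then 1 else 0, fun j => ℓ j, hτ, Valid_base τ hτ _ K,
      det_delta K hKi, t1, t2, t3, ?_⟩
    have : ∀ ρ : (j : Fin r) × Fin (μ j), (ℓ ρ.1 : ℤ) + offs m (s ρ.1) + ρ.2.1 = K ρ := by
      intro ρ
      have := kf ρ.1
      simp only [hKdef, offs]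
      omega
    simp only [this]
    exact det_delta_self K hKi
  obtain ⟨t, β, F, ht, hV, -, f1, f2, f3, hdet⟩ :=
    St_final τ hτ m hm x hxm K hK hμ1 hμm _ s hμs (fun j => by have := kf j; omega) rfl hst0
  beta_reduce at f2 f3 hdet
  -- the last coarse index at x j
  set p : Fin r → ℤ := fun j => (ℓ j : ℤ) - 1 + s j with hp
  have hpx : ∀ j, τ (p j) = x j := by
    intro j
    have h1 := hμs j; have h2 := hμ1 j
    rw [← t2 j (s j - 1) (by omega)]
    congr 1
    simp only [hp]
    omega
  have hp1 : ∀ j, x j < τ (p j + 1) := by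
    intro j
    have e : p j + 1 = (ℓ j : ℤ) + s j := by simp only [hp]; ring
    rw [e]; exact t3 j
  have hpp : ∀ j, τ (p j) < τ (p j + 1) := fun j => by rw [hpx]; exact hp1 j
  set M := 2 * m - 1 with hM
  set bv : Fin r → ℕ → ((j : Fin r) × Fin (μ j)) → ℝ := fun j i κ => bb τ (p j) M (x j) (K κ) i
    with hbv
  have hβ : ∀ ρ : (j : Fin r) × Fin (μ j), ∃ c : ℕ → ℝ, 0 < c ρ.2.1 ∧
      ∀ κ, β (F ρ.1 + offs m M + ρ.2.1) κ = ∑ i ∈ Finset.range (ρ.2.1 + 1), c i * bv ρ.1 i κ := by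
    intro ρ
    obtain ⟨j, ν, hν⟩ := ρ
    dsimp only
    have hνm := hμm j
    have ho : F j + offs m M + ν = F j - 1 + ν := by unfold offs; omega
    rw [ho]
    set L : List ℝ := (List.range ν).map fun v : ℕ => t (F j + M + v) with hL
    have hLlen : L.length = ν := by simp [hL]
    have hLx : ∀ z ∈ L, x j < z := by
      intro z hz
      obtain ⟨v, _, rfl⟩ := List.mem_map.1 hz
      exact lt_of_lt_of_le (f3 j) (ht (by omega))
    obtain ⟨c, hc1, hc2⟩ := tri_rows τ hτ (p j) (hpp j) M (x j) L hLx (by omega)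
    rw [hLlen] at hc1 hc2
    refine ⟨c, hc1, ?_⟩
    intro κ
    have q1 : t (F j - 1 + ν) ≤ x j := by
      rw [← f2 j ν (by omega)]; exact ht (by omega)
    have q2 : x j < t (F j - 1 + ν + ((M : ℤ) + 1)) := lt_of_lt_of_le (f3 j) (ht (by omega))
    rw [hV (F j - 1 + ν) (p j) (hpp j) (lt_of_le_of_lt q1 (hp1 j)) (by rw [hpx]; exact q2)
      (lt_of_le_of_lt q1 q2) κ]
    simp only [hbv]
    rw [← hc2]
    apply Bl_perm τ hτ _ (hpp j)
    have hsplit : M = (M - ν) + ν := by omega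
    have hW : Win M t (F j - 1 + ν) = List.replicate (M - ν) (x j) ++ L := by
      unfold Win
      conv_lhs => rw [hsplit]
      rw [List.range_add, List.map_append, List.map_map]
      congr 1
      · rw [List.eq_replicate_iff]
        refine ⟨by simp, ?_⟩
        intro z hz
        obtain ⟨u, hu, rfl⟩ := List.mem_map.1 hz
        rw [List.mem_range] at hu
        rw [← f2 j (ν + u) (by omega)]
        congr 1
        push_cast
        ring
      · rw [hL]
        apply List.map_congr_left
        intro u _
        simp only [Function.comp]
        congr 1
        omega
    rw [hW]
    exact List.perm_append_comm
  choose c hc1 hc2 using hβ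
  obtain ⟨D, hD, hDe⟩ := det_tri K hKi hK
    (Matrix.of fun ρ => β (F ρ.1 + offs m M + ρ.2.1)) bv c hc1 (fun ρ κ => hc2 ρ κ)
  have hbpos : 0 < Matrix.det (Matrix.of fun ρ κ : (j : Fin r) × Fin (μ j) => bv ρ.1 ρ.2.1 κ) := by
    rw [hDe] at hdet
    exact (mul_pos_iff_of_pos_left hD).1 hdet
  have key2 : ∃ D : ℝ, 0 < D ∧ Matrix.det
    (Matrix.of fun p q : (j : Fin r) × Fin (μ j) =>
        if h : ℓ q.1 - m + q.2.1 - 1 < n - m then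
          Amat θ m n r ℓ μ p ⟨ℓ q.1 - m + q.2.1 - 1, h⟩
        else 0) = D * Matrix.det (Matrix.of fun ρ κ : (j : Fin r) × Fin (μ j) => bv ρ.1 ρ.2.1 κ) := by
    refine det_tri K hKi hK _ bv (fun ρ i => ((m - 1 - ρ.2.1).factorial : ℝ) * cB M ρ.2.1 i) ?_ ?_
    · intro ρ
      have := ρ.2.2
      have := hμm ρ.1
      apply mul_pos
      · exact_mod_cast Nat.factorial_pos _
      · exact cB_pos _ _ (by omega)
    · intro ρ κ
      have k1 := κ.2.2
      have k2 := hμs κ.1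
      have k3 := kf κ.1
      have k4 := hlb κ.1
      have r1 := ρ.2.2
      have r2 := hμm ρ.1
      have r3 := kf ρ.1
      have r4 := hlb ρ.1
      rw [Matrix.of_apply, dif_pos (by omega)]
      unfold Amat
      rw [Matrix.of_apply]
      dsimp only
      have ek : ℓ κ.1 - m + κ.2.1 - 1 + 1 = ℓ κ.1 - m + κ.2.1 := by omega
      rw [ek]
      have eK : (((ℓ κ.1 - m + κ.2.1 : ℕ)) : ℤ) = K κ := by simp only [hKdef]; omega
      have e2m : 2 * m = M + 1 := by omega
      rw [e2m]
      have hpl : τ ((ℓ ρ.1 : ℤ) - 1) < τ ((ℓ ρ.1 : ℤ) - 1 + 1) := by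
        have := t2 ρ.1 0 (by have := hμs ρ.1; have := hμ1 ρ.1; omega)
        simp only [Nat.cast_zero, add_zero] at this
        rw [sub_add_cancel, this]
        exact t1 ρ.1
      have hpl' : τ ((ℓ ρ.1 : ℤ) - 1 + 1) = x ρ.1 := by
        have := t2 ρ.1 0 (by have := hμs ρ.1; have := hμ1 ρ.1; omega)
        simp only [Nat.cast_zero, add_zero] at this
        rw [sub_add_cancel, this]
      have main : iteratedDeriv ρ.2.1 (Nspl θ (M + 1) (ℓ κ.1 - m + κ.2.1)) (x ρ.1) =
          ((⇑Polynomial.derivative)^[ρ.2.1] (pieceP τ (p ρ.1) M (x ρ.1) (K κ))).eval 0 := by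
        refine piecewise_deriv ρ.2.1 (Nspl θ (M + 1) (ℓ κ.1 - m + κ.2.1))
          (pieceP τ ((ℓ ρ.1 : ℤ) - 1) M (x ρ.1) (K κ)) (pieceP τ (p ρ.1) M (x ρ.1) (K κ))
          (x ρ.1) (τ ((ℓ ρ.1 : ℤ) - 1)) (τ (p ρ.1 + 1)) (t1 ρ.1) (hp1 ρ.1) ?_ ?_ ?_
        · intro z hz1 hz2
          rw [Nspl_eq_s5 θ τ hτ (n + m) hag (p ρ.1) z (by rw [hpx]; exact hz1) hz2 M _ (by omega) (by omega),
            eK, pieceP_eval τ hτ _ (hpp ρ.1) M (x ρ.1)]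
        · intro z hz1 hz2
          rw [Nspl_eq_s5 θ τ hτ (n + m) hag ((ℓ ρ.1 : ℤ) - 1) z hz1.le (by rw [hpl']; exact hz2) M _
            (by omega) (by omega), eK, pieceP_eval τ hτ _ hpl M (x ρ.1)]
        · intro i hi
          rw [pieceP_deriv _ _ _ _ _ _ (by omega), pieceP_deriv _ _ _ _ _ _ (by omega)]
          apply Finset.sum_congr rfl
          intro i' hi'
          rw [Finset.mem_range] at hi'
          congr 1
          unfold bb
          exact Bl_agree τ (ℓ ρ.1) (s ρ.1) (x ρ.1) (t1 ρ.1) (t2 ρ.1) _ _ (by omega) _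
      change _ * iteratedDeriv _ _ (x ρ.1) = _
      rw [main, pieceP_deriv _ _ _ _ _ _ (by omega), Finset.mul_sum]
      apply Finset.sum_congr rfl
      intro i _
      simp only [hbv]
      ring
  obtain ⟨D', hD', hDe'⟩ := key2
  rw [hDe']
  exact mul_pos hD' hbpos
end
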